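/- arXiv:1409.2034 — 8 statements merged into one kernel-verified Lean document; each statement's English description precedes it below -/
import Mathlib

section
/- Assume condition (C). There exists a constant C > 0 (depending only on μ) such that for every n ≥ 1, every integer k with 1 ≤ k ≤ n, and every α ∈ ℂ with α^k = 1, the probability that α is a root of P_n' satisfies P(P_n'(α) = 0) ≤ ( C / ⌊n/k⌋ )^{3·deg(α)/2}, where deg(α) denotes the degree of α over ℚ. -/
open MeasureTheory

/-- The polynomial `∑_{j=0}^n a_j z^j` with integer coefficients, viewed over `ℂ`. -/
noncomputable def polyOf (n : ℕ) (a : Fin (n + 1) → ℤ) : Polynomial ℂ :=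
  ∑ j : Fin (n + 1), Polynomial.C (a j : ℂ) * Polynomial.X ^ (j : ℕ)


lemma aux_dirichlet (M : ℕ) (t : ℝ) :
    2 * Real.sin (t/2) * ∑ l ∈ Finset.range M, Real.cos ((l+1 : ℕ) * t)
      = Real.sin ((M + 1/2) * t) - Real.sin (t/2) := by
  induction M with
  | zero => simp; ring_nf
  | succ M ih =>
    rw [Finset.sum_range_succ, mul_add, ih]
    have h1 : ((M+1 : ℕ) + 1/2 : ℝ) * t = ((M+1:ℕ):ℝ) * t + t/2 := by push_cast; ring
    have h2 : ((M:ℝ) + 1/2 : ℝ) * t = ((M+1:ℕ):ℝ) * t - t/2 := by push_cast; ring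
    rw [h1, h2, Real.sin_add, Real.sin_sub]; ring

lemma aux_sq_sum (M : ℕ) : (M:ℝ)^3/3 ≤ ∑ l ∈ Finset.range M, ((l+1 : ℕ):ℝ)^2 := by
  induction M with
  | zero => simp
  | succ M ih =>
    rw [Finset.sum_range_succ]
    push_cast at ih ⊢
    have : (0:ℝ) ≤ M := Nat.cast_nonneg M
    nlinarith

lemma aux_lower_small (M : ℕ) (t : ℝ) (h : M * |t| ≤ Real.pi) :
    2 / (3 * Real.pi^2) * M^3 * t^2 ≤ ∑ l ∈ Finset.range M, (1 - Real.cos ((l+1 : ℕ) * t)) := by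
  have h1 : ∑ l ∈ Finset.range M, (2 / Real.pi^2 * t^2 * ((l+1 : ℕ):ℝ)^2) ≤
      ∑ l ∈ Finset.range M, (1 - Real.cos ((l+1 : ℕ) * t)) := by
    apply Finset.sum_le_sum
    intro l hl
    have hl' : ((l+1:ℕ):ℝ) ≤ M := by
      exact_mod_cast Finset.mem_range.1 hl
    have := Real.cos_le_one_sub_mul_cos_sq (x := ((l+1:ℕ):ℝ) * t) (by
      rw [abs_mul, Nat.abs_cast]
      exact (mul_le_mul_of_nonneg_right hl' (abs_nonneg _)).trans h)
    nlinarith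
  rw [← Finset.mul_sum] at h1
  refine le_trans ?_ h1
  have h2 := mul_le_mul_of_nonneg_left (aux_sq_sum M)
    (show 0 ≤ 2 / Real.pi^2 * t^2 by positivity)
  refine le_trans (le_of_eq ?_) h2
  have := Real.pi_pos
  field_simp

lemma aux_lower_big (M : ℕ) (t : ℝ) (h : Real.pi ≤ M * |t|) (ht : |t| ≤ Real.pi) :
    (M:ℝ)/2 ≤ ∑ l ∈ Finset.range M, (1 - Real.cos ((l+1 : ℕ) * t)) := by
  have hpi := Real.pi_pos
  rw [Finset.sum_sub_distrib]
  simp only [Finset.sum_const, Finset.card_range, nsmul_eq_mul, mul_one]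
  have hd := aux_dirichlet M t
  set S := ∑ l ∈ Finset.range M, Real.cos ((l+1 : ℕ) * t) with hS
  have hs := Real.mul_abs_le_abs_sin (x := t/2) (by rw [abs_div]; simp; linarith)
  rw [abs_div, abs_two] at hs
  have hs' : |t| / Real.pi ≤ |Real.sin (t/2)| := by
    refine le_trans (le_of_eq ?_) hs
    field_simp
  have hM : 1 ≤ M * |Real.sin (t/2)| := by
    calc (1:ℝ) ≤ M * (|t| / Real.pi) := by
          rw [← mul_div_assoc, le_div_iff₀ hpi]; linarith
      _ ≤ _ := by gcongr
  have hspos : 0 < |Real.sin (t/2)| := by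
    by_contra hc
    have : |Real.sin (t/2)| = 0 := le_antisymm (not_lt.1 hc) (abs_nonneg _)
    rw [this] at hM; norm_num at hM
  have h3 : (2 * S + 1) * |Real.sin (t/2)| ≤ 1 := by
    have : (2*S+1) * Real.sin (t/2) = Real.sin ((M + 1/2) * t) := by linarith
    calc _ ≤ |(2*S+1)| * |Real.sin (t/2)| := by gcongr; exact le_abs_self _
      _ = |Real.sin ((M + 1/2) * t)| := by rw [← abs_mul, this]
      _ ≤ 1 := Real.abs_sin_le_one _
  have h4 : 2 * S + 1 ≤ M := by
    by_contra hc
    push Not at hc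
    have := mul_lt_mul_of_pos_right hc hspos
    linarith
  linarith

lemma aux_kernel (c : ℝ) (hc : 0 < c) : ∃ K > (0:ℝ), ∀ M : ℕ, 1 ≤ M →
    ∫ t in (-Real.pi)..Real.pi,
      Real.exp (-c * ∑ l ∈ Finset.range M, (1 - Real.cos ((l+1 : ℕ) * t)))
      ≤ K * (1 / (M:ℝ)) ^ (3/2 : ℝ) := by
  have hpi := Real.pi_pos
  set b := c * (2 / (3 * Real.pi^2)) with hb
  have hbpos : 0 < b := by positivity
  refine ⟨√(Real.pi / b) + 2 * Real.pi * (8 / c^2), by positivity, fun M hM => ?_⟩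
  have hM' : (1:ℝ) ≤ M := by exact_mod_cast hM
  have hM0 : (0:ℝ) < M := by linarith
  have hpt : ∀ t ∈ Set.Icc (-Real.pi) Real.pi,
      Real.exp (-c * ∑ l ∈ Finset.range M, (1 - Real.cos ((l+1 : ℕ) * t))) ≤
      Real.exp (-(b * M^3) * t^2) + Real.exp (-(c * M / 2)) := by
    intro t ht
    have ht' : |t| ≤ Real.pi := abs_le.2 ht
    rcases le_total (M * |t|) Real.pi with h | h
    · have := aux_lower_small M t h
      have h2 := mul_le_mul_of_nonneg_left this hc.le
      have : Real.exp (-c * ∑ l ∈ Finset.range M, (1 - Real.cos ((l+1 : ℕ) * t))) ≤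
        Real.exp (-(b * M^3) * t^2) := by
        apply Real.exp_le_exp.2
        rw [hb]; linarith
      linarith [Real.exp_pos (-(c * M / 2))]
    · have := aux_lower_big M t h ht'
      have h2 := mul_le_mul_of_nonneg_left this hc.le
      have : Real.exp (-c * ∑ l ∈ Finset.range M, (1 - Real.cos ((l+1 : ℕ) * t))) ≤
        Real.exp (-(c * M / 2)) := by
        apply Real.exp_le_exp.2
        linarith
      linarith [Real.exp_pos (-(b * M^3) * t^2)]
  have hB : 0 < b * M^3 := by positivity
  have hint : Integrable (fun t : ℝ => Real.exp (-(b * M^3) * t^2)) := integrable_exp_neg_mul_sq hB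
  have hrp : √(1 / (M:ℝ)^3) = (1/(M:ℝ))^(3/2:ℝ) := by
    rw [Real.sqrt_eq_rpow, show (1:ℝ)/(M:ℝ)^3 = (1/(M:ℝ))^(3:ℝ) by
      rw [show (3:ℝ) = ((3:ℕ):ℝ) by norm_num, Real.rpow_natCast]; simp]
    rw [← Real.rpow_mul (by positivity)]; norm_num
  calc _ ≤ ∫ t in (-Real.pi)..Real.pi,
        (Real.exp (-(b * M^3) * t^2) + Real.exp (-(c * M / 2))) := by
        apply intervalIntegral.integral_mono_on (by linarith) _ _ hpt
        · apply Continuous.intervalIntegrable; fun_prop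
        · apply Continuous.intervalIntegrable; fun_prop
    _ = (∫ t in (-Real.pi)..Real.pi, Real.exp (-(b * M^3) * t^2))
          + 2 * Real.pi * Real.exp (-(c * M / 2)) := by
        rw [intervalIntegral.integral_add]
        · simp; ring
        · apply Continuous.intervalIntegrable; fun_prop
        · simp
    _ ≤ √(Real.pi / (b * M^3)) + 2 * Real.pi * Real.exp (-(c * M / 2)) := by
        gcongr
        rw [← integral_gaussian, intervalIntegral.integral_of_le (by linarith)]
        exact setIntegral_le_integral hint (Filter.Eventually.of_forall fun t => (Real.exp_pos _).le)
    _ ≤ √(Real.pi / b) * (1/(M:ℝ))^(3/2:ℝ) + 2 * Real.pi * (8 / c^2 * (1/(M:ℝ))^(3/2:ℝ)) := by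
        gcongr
        · rw [← hrp, ← Real.sqrt_mul (by positivity)]
          apply le_of_eq; congr 1; field_simp
        · rw [Real.exp_neg]
          have hx : 0 < c * M / 2 := by positivity
          have h1 := Real.quadratic_le_exp_of_nonneg hx.le
          have h2 : (c * M / 2)^2/2 ≤ Real.exp (c*M/2) := by linarith
          calc (Real.exp (c * M / 2))⁻¹ ≤ ((c * M / 2)^2/2)⁻¹ := by
                apply inv_anti₀ (by positivity) h2
            _ = 8 / c^2 * (1/(M:ℝ))^(2:ℝ) := by
                rw [show (2:ℝ) = ((2:ℕ):ℝ) by norm_num, Real.rpow_natCast]; field_simp; norm_num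
            _ ≤ _ := by
                gcongr ?_ * ?_
                apply Real.rpow_le_rpow_of_exponent_ge (by positivity)
                · rw [div_le_one hM0]; exact hM'
                · norm_num
    _ = _ := by ring

lemma aux_scale (f : ℝ → ℝ) (hf : Continuous f) (hp : Function.Periodic f (2 * Real.pi))
    (m : ℕ) (hm : 1 ≤ m) :
    ∫ t in (0:ℝ)..(2 * Real.pi), f (m * t) = ∫ t in (-Real.pi)..Real.pi, f t := by
  have hm0 : (m:ℝ) ≠ 0 := by positivity
  rw [intervalIntegral.integral_comp_mul_left f hm0]
  have := hp.intervalIntegral_add_zsmul_eq (m:ℤ) 0 (fun a b => hf.intervalIntegrable a b)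
  simp only [zero_add, zsmul_eq_mul, Int.cast_natCast] at this
  rw [mul_zero, this]
  have h2 := hp.intervalIntegral_add_eq 0 (-Real.pi)
  rw [zero_add, show -Real.pi + 2 * Real.pi = Real.pi by ring] at h2
  rw [h2, smul_eq_mul, ← mul_assoc, inv_mul_cancel₀ hm0, one_mul]

lemma aux_cos_pair (u v : ℝ) :
    (1 - Real.cos (v - u)) / 2 ≤ (1 - Real.cos u) + (1 - Real.cos v) := by
  have hu := Real.cos_sq_add_sin_sq u
  have hv := Real.cos_sq_add_sin_sq v
  rw [Real.cos_sub]
  have h1 := Real.cos_le_one u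
  have h2 := Real.cos_le_one v
  nlinarith [sq_nonneg (Real.cos u + Real.cos v - 2), sq_nonneg (Real.sin u + Real.sin v), sq_nonneg (Real.sin u - Real.sin v), mul_nonneg (sub_nonneg.2 h1) (sub_nonneg.2 h2), sq_nonneg (Real.cos u - Real.cos v)]


lemma aux_charfun (μ : Measure ℤ) [IsProbabilityMeasure μ]
    (hsupp : μ (({-1, 0, 1} : Set ℤ)ᶜ) = 0) (f : ℤ → ℂ) :
    ∫ x, f x ∂μ = μ.real {-1} * f (-1) + μ.real {0} * f 0 + μ.real {1} * f 1 := by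
  have h : μ.restrict (({-1,0,1} : Finset ℤ) : Set ℤ) = μ := by
    apply Measure.restrict_eq_self_of_ae_mem
    rw [ae_iff]
    convert hsupp using 2
    ext; simp
  conv_lhs => rw [← h]
  rw [setIntegral_finset]
  · rw [Finset.sum_insert (by decide), Finset.sum_insert (by decide), Finset.sum_singleton]
    simp; ring
  · rw [IntegrableOn]
    refine IntegrableOn.finset

lemma aux_phi (μ : Measure ℤ) [IsProbabilityMeasure μ]
    (hsupp : μ (({-1, 0, 1} : Set ℤ)ᶜ) = 0)
    (hC : ∀ x ∈ ({-1, 0, 1} : Set ℤ), (μ {x}).toReal < 1 / Real.sqrt 3) :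
    ∃ c > (0:ℝ), ∃ e : ℕ, 1 ≤ e ∧ ∀ t : ℝ,
      ‖∫ x : ℤ, Complex.exp (((t * x : ℝ) : ℂ) * Complex.I) ∂μ‖ ≤ Real.exp (-c * (1 - Real.cos (e * t))) := by
  have hsq : 1 / Real.sqrt 3 < 1 := by
    rw [div_lt_one (by positivity)]
    rw [Real.lt_sqrt (by norm_num)]; norm_num
  have hsum := aux_charfun μ hsupp (fun _ => 1)
  simp only [integral_const, probReal_univ, one_smul, mul_one] at hsum
  have hp : (μ.real {-1}) < 1 := (hC (-1) (by simp)).trans hsq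
  have hq : (μ.real {0}) < 1 := (hC (0) (by simp)).trans hsq
  have hr : (μ.real {1}) < 1 := (hC (1) (by simp)).trans hsq
  have hp0 : 0 ≤ (μ.real {-1}) := measureReal_nonneg
  have hq0 : 0 ≤ (μ.real {0}) := measureReal_nonneg
  have hr0 : 0 ≤ (μ.real {1}) := measureReal_nonneg
  have key : ∀ t : ℝ, ‖∫ x : ℤ, Complex.exp (((t * x : ℝ) : ℂ) * Complex.I) ∂μ‖ =
      √((μ.real {-1} * Real.cos t + μ.real {0} + μ.real {1} * Real.cos t)^2 +
        (-μ.real {-1} * Real.sin t + μ.real {1} * Real.sin t)^2) := by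
    intro t
    rw [aux_charfun μ hsupp, Complex.norm_eq_sqrt_sq_add_sq]
    congr 3
    · simp [Complex.exp_re, Real.cos_neg]
    · simp [Complex.exp_im]
  have hsum' : μ.real {-1} + μ.real {0} + μ.real {1} = 1 := by exact_mod_cast hsum.symm
  have fin : ∀ (A y : ℝ), A ≤ 1 - 2 * y → √A ≤ Real.exp (-y) := by
    intro A y h
    rw [Real.sqrt_le_left (Real.exp_pos _).le, ← Real.exp_nat_mul]
    have := Real.add_one_le_exp (-(2*y))
    push_cast
    rw [show (2:ℝ) * -y = -(2*y) by ring]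
    linarith
  generalize μ.real {-1} = p at *
  generalize μ.real {0} = q at *
  generalize μ.real {1} = r at *
  have hid : ∀ t : ℝ, (p * Real.cos t + q + r * Real.cos t)^2 + (-p * Real.sin t + r * Real.sin t)^2
     = 1 - 2 * (q * (1-q)) * (1 - Real.cos t) - 2 * (p * r) * (1 - Real.cos (2*t)) := by
    intro t
    rw [Real.cos_two_mul]
    have h1 := Real.sin_sq t
    have h2 : p = 1 - q - r := by linarith
    subst h2
    ring_nf
    rw [h1]
    ring
  by_cases hq' : q = 0
  · refine ⟨p * r, ?_, 2, by norm_num, fun t => ?_⟩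
    · apply mul_pos <;> linarith
    · rw [key, hid, hq', neg_mul]
      apply fin
      push_cast
      linarith
  · have hqp : 0 < q := lt_of_le_of_ne hq0 (Ne.symm hq')
    refine ⟨q * (1-q), mul_pos hqp (by linarith), 1, le_refl _, fun t => ?_⟩
    rw [key, hid, neg_mul]
    apply fin
    have := mul_nonneg (mul_nonneg hp0 hr0) (sub_nonneg.2 (Real.cos_le_one (2*t)))
    rw [Nat.cast_one, one_mul]
    linarith

lemma aux_exp_int (m : ℤ) :
    ∫ t in (0:ℝ)..(2 * Real.pi), Complex.exp (((t * m : ℝ) : ℂ) * Complex.I)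
      = if m = 0 then ((2 * Real.pi : ℝ) : ℂ) else 0 := by
  split_ifs with h
  · simp [h]
  · have hc : (m : ℂ) * Complex.I ≠ 0 := by simp [h]
    have := integral_exp_mul_complex (a := 0) (b := 2 * Real.pi) hc
    rw [show (fun t : ℝ => Complex.exp (((t * m : ℝ) : ℂ) * Complex.I)) =
      fun t : ℝ => Complex.exp ((m : ℂ) * Complex.I * t) by ext t; congr 1; push_cast; ring]
    rw [this, show (m : ℂ) * Complex.I * ((2 * Real.pi : ℝ) : ℂ) = m * (2 * Real.pi * Complex.I) by
      push_cast; ring, Complex.exp_int_mul_two_pi_mul_I]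
    simp

lemma aux_fourier (μ : Measure ℤ) [IsProbabilityMeasure μ] {N : ℕ} (a : Fin N → ℤ) (z : ℤ) :
    2 * Real.pi * (Measure.pi fun _ : Fin N => μ).real {x | ∑ i, a i * x i = z} ≤
      ∫ t in (0:ℝ)..(2 * Real.pi), ∏ i, ‖∫ x : ℤ, Complex.exp ((((t * a i) * x : ℝ) : ℂ) * Complex.I) ∂μ‖ := by
  have hpi := Real.pi_pos
  set P := (Measure.pi fun _ : Fin N => μ) with hP
  have h1 : ((2 * Real.pi * P.real {x | ∑ i, a i * x i = z} : ℝ) : ℂ) =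
      ∫ x : Fin N → ℤ, (∫ t in (0:ℝ)..(2 * Real.pi),
        Complex.exp (((t * ((∑ i, a i * x i - z : ℤ):ℝ) : ℝ) : ℂ) * Complex.I)) ∂P := by
    simp_rw [aux_exp_int, sub_eq_zero]
    have : (fun x : Fin N → ℤ => if ∑ i, a i * x i = z then ((2 * Real.pi : ℝ) : ℂ) else 0)
      = Set.indicator {x | ∑ i, a i * x i = z} (fun _ => ((2 * Real.pi : ℝ) : ℂ)) := by
      ext x; simp [Set.indicator]
    rw [this, integral_indicator (Set.to_countable _).measurableSet, setIntegral_const]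
    simp; ring
  have h2 : ∫ x : Fin N → ℤ, (∫ t in (0:ℝ)..(2 * Real.pi),
        Complex.exp (((t * ((∑ i, a i * x i - z : ℤ):ℝ) : ℝ) : ℂ) * Complex.I)) ∂P =
      ∫ t in (0:ℝ)..(2 * Real.pi), ∫ x,
        Complex.exp (((t * ((∑ i, a i * x i - z : ℤ):ℝ) : ℝ) : ℂ) * Complex.I) ∂P := by
    rw [intervalIntegral_integral_swap]
    have hfin : IsFiniteMeasure (volume.restrict (Set.uIoc 0 (2 * Real.pi))) := by
      rw [Set.uIoc_of_le (by positivity)]; infer_instance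
    refine Integrable.of_bound (C := 1) ?_ ?_
    · apply Measurable.aestronglyMeasurable
      apply measurable_from_prod_countable_left
      intro x
      apply Continuous.measurable
      simp only [Function.uncurry]
      fun_prop
    · refine Filter.Eventually.of_forall fun x => ?_
      simp only [Function.uncurry]
      rw [Complex.norm_exp_ofReal_mul_I]
  have h3 : ∀ t : ℝ, ‖∫ x, Complex.exp (((t * ((∑ i, a i * x i - z : ℤ):ℝ) : ℝ) : ℂ) * Complex.I) ∂P‖ =
      ∏ i, ‖∫ x : ℤ, Complex.exp ((((t * a i) * x : ℝ) : ℂ) * Complex.I) ∂μ‖ := by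
    intro t
    have : ∀ x : Fin N → ℤ, Complex.exp (((t * ((∑ i, a i * x i - z : ℤ):ℝ) : ℝ) : ℂ) * Complex.I)
      = Complex.exp (((-(t * z) : ℝ) : ℂ) * Complex.I) *
        ∏ i, Complex.exp ((((t * a i) * x i : ℝ) : ℂ) * Complex.I) := by
      intro x
      rw [← Complex.exp_sum, ← Complex.exp_add]
      congr 1
      rw [← Finset.sum_mul, ← add_mul]
      congr 1
      push_cast
      rw [mul_sub, Finset.mul_sum]
      simp only [mul_assoc]; ring
    simp_rw [this]
    rw [integral_const_mul, norm_mul, Complex.norm_exp_ofReal_mul_I, one_mul, ← norm_prod]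
    rw [hP, integral_fintype_prod_eq_prod (𝕜 := ℂ) (fun i (y : ℤ) => Complex.exp ((((t * a i) * y : ℝ) : ℂ) * Complex.I))]
  have h4 : ‖((2 * Real.pi * P.real {x | ∑ i, a i * x i = z} : ℝ) : ℂ)‖ =
      2 * Real.pi * P.real {x | ∑ i, a i * x i = z} := by
    rw [Complex.norm_real, Real.norm_of_nonneg (by positivity)]
  rw [← h4, h1, h2]
  refine (intervalIntegral.norm_integral_le_integral_norm (by positivity)).trans (le_of_eq ?_)
  simp_rw [h3]

lemma aux_conc (μ : Measure ℤ) [IsProbabilityMeasure μ]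
    (hsupp : μ (({-1, 0, 1} : Set ℤ)ᶜ) = 0)
    (hC : ∀ x ∈ ({-1, 0, 1} : Set ℤ), (μ {x}).toReal < 1 / Real.sqrt 3) :
    ∃ C > (0:ℝ), ∀ N : ℕ, 1 ≤ N → ∀ s k : ℕ, 1 ≤ k → ∀ z : ℤ,
      (Measure.pi fun _ : Fin N => μ).real
        {x | ∑ i : Fin N, ((s + k * (i:ℕ) : ℕ) : ℤ) * x i = z} ≤ (C / N) ^ (3/2 : ℝ) := by
  obtain ⟨c, hc, e, he, hphi⟩ := aux_phi μ hsupp hC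
  obtain ⟨K, hK, hker⟩ := aux_kernel (c/2) (by positivity)
  have hpi := Real.pi_pos
  set D : ℝ := 1 + K / (2 * Real.pi) with hD
  have hD1 : 1 ≤ D := by rw [hD]; have : 0 < K / (2 * Real.pi) := by positivity
                         linarith
  refine ⟨4 * D, by positivity, fun N hN s k hk z => ?_⟩
  have hN0 : (0:ℝ) < N := by exact_mod_cast hN
  by_cases hN3 : N < 3
  · refine measureReal_le_one.trans ?_
    apply Real.one_le_rpow _ (by norm_num)
    rw [le_div_iff₀ hN0]
    have : (N:ℝ) < 3 := by exact_mod_cast hN3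
    linarith
  push Not at hN3
  set M := (N-1)/2 with hM
  have hM1 : 1 ≤ M := by omega
  have hMN : 2 * M + 1 ≤ N := by omega
  have hM4 : N ≤ 4 * M := by omega
  have hM0 : (0:ℝ) < M := by exact_mod_cast hM1
  set F : ℝ → ℝ := fun t =>
    Real.exp (-(c/2) * ∑ l ∈ Finset.range M, (1 - Real.cos ((l+1 : ℕ) * t))) with hF
  have hFc : Continuous F := by rw [hF]; fun_prop
  have hFp : Function.Periodic F (2 * Real.pi) := by
    intro t
    simp only [hF]
    congr 3; ext l
    rw [mul_add, Real.cos_add_nat_mul_two_pi]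
  have hf := aux_fourier μ (fun i : Fin N => ((s + k * (i:ℕ) : ℕ) : ℤ)) z
  have hpt : ∀ t : ℝ, ∏ i : Fin N, ‖∫ x : ℤ, Complex.exp ((((t * (((s + k * (i:ℕ) : ℕ) : ℤ) : ℝ)) * x : ℝ) : ℂ) * Complex.I) ∂μ‖
      ≤ F ((2 * e * k : ℕ) * t) := by
    intro t
    set g : ℕ → ℝ := fun i => 1 - Real.cos (e * (t * (((s + k * i : ℕ) : ℤ) : ℝ))) with hg
    have hg0 : ∀ i, 0 ≤ g i := fun i => sub_nonneg.2 (Real.cos_le_one _)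
    calc _ ≤ ∏ i : Fin N, Real.exp (-c * g i) := by
          apply Finset.prod_le_prod
          · intro i _; exact norm_nonneg _
          · intro i _; exact hphi _
      _ = Real.exp (-c * ∑ i ∈ Finset.range N, g i) := by
          rw [← Real.exp_sum, ← Finset.mul_sum, Fin.sum_univ_eq_sum_range]
      _ ≤ _ := by
          simp only [hF]
          apply Real.exp_le_exp.2
          have h1 : ∑ i ∈ Finset.range (M + (1 + M)), g i ≤ ∑ i ∈ Finset.range N, g i := by
            apply Finset.sum_le_sum_of_subset_of_nonneg
            · apply Finset.range_subset_range.2; omega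
            · intro i _ _; exact hg0 i
          rw [Finset.sum_range_add, ← Finset.sum_range_reflect, Finset.sum_range_add] at h1
          simp only [Finset.sum_range_one] at h1
          have h2 : ∑ l ∈ Finset.range M, (1 - Real.cos ((l+1 : ℕ) * ((2 * e * k : ℕ) * t))) / 2 ≤
              ∑ l ∈ Finset.range M, (g (M - 1 - l) + g (M + (1 + l))) := by
            apply Finset.sum_le_sum
            intro l hl
            have hl := Finset.mem_range.1 hl
            have := aux_cos_pair (e * (t * (((s + k * (M - 1 - l) : ℕ) : ℤ) : ℝ)))
              (e * (t * (((s + k * (M + (1 + l)) : ℕ) : ℤ) : ℝ)))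
            refine le_trans (le_of_eq ?_) this
            congr 3
            obtain ⟨w, hw⟩ : ∃ w, M = w + 1 + l := ⟨M - 1 - l, by omega⟩
            rw [show M - 1 - l = w by omega, hw]
            push_cast
            ring
          rw [Finset.sum_add_distrib, ← Finset.sum_div] at h2
          have h3 := hg0 (M + 0)
          have h4 : (∑ l ∈ Finset.range M, (1 - Real.cos ((l+1 : ℕ) * ((2 * e * k : ℕ) * t)))) / 2 ≤
            ∑ i ∈ Finset.range N, g i := by linarith
          have := mul_le_mul_of_nonneg_left h4 hc.le
          linarith
  have hcont : Continuous fun t : ℝ => ∏ i : Fin N, ‖∫ x : ℤ, Complex.exp ((((t * (((s + k * (i:ℕ) : ℕ) : ℤ) : ℝ)) * x : ℝ) : ℂ) * Complex.I) ∂μ‖ := by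
    simp_rw [aux_charfun μ hsupp]
    fun_prop
  have h5 : ∫ t in (0:ℝ)..(2 * Real.pi), ∏ i : Fin N, ‖∫ x : ℤ, Complex.exp ((((t * (((s + k * (i:ℕ) : ℕ) : ℤ) : ℝ)) * x : ℝ) : ℂ) * Complex.I) ∂μ‖
      ≤ ∫ t in (0:ℝ)..(2 * Real.pi), F ((2 * e * k : ℕ) * t) := by
    apply intervalIntegral.integral_mono_on (by positivity)
    · exact hcont.intervalIntegrable _ _
    · apply Continuous.intervalIntegrable; fun_prop
    · intro t _; exact hpt t
  rw [aux_scale F hFc hFp _ (by have := Nat.mul_pos he hk; nlinarith)] at h5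
  have h6 := (hf.trans h5).trans (hker M hM1)
  rw [mul_comm, ← le_div_iff₀ (by positivity)] at h6
  refine h6.trans ?_
  calc K * (1 / (M:ℝ)) ^ (3/2 : ℝ) / (2 * Real.pi)
      = (K / (2 * Real.pi)) * (1 / (M:ℝ)) ^ (3/2 : ℝ) := by ring
    _ ≤ D ^ (3/2 : ℝ) * (4 / (N:ℝ)) ^ (3/2 : ℝ) := by
        gcongr ?_ * ?_
        · calc K / (2 * Real.pi) ≤ D := by rw [hD]; linarith
            _ = D ^ (1:ℝ) := by simp
            _ ≤ _ := Real.rpow_le_rpow_of_exponent_le hD1 (by norm_num)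
        · apply Real.rpow_le_rpow (by positivity) _ (by norm_num)
          rw [div_le_div_iff₀ hM0 hN0]
          have : (N:ℝ) ≤ 4 * M := by exact_mod_cast hM4
          linarith
    _ = _ := by
        rw [← Real.mul_rpow (by positivity) (by positivity)]; congr 1; ring

/-- merging map -/
noncomputable def aux_merge {ι κ η : Type*} (e : κ × η → ι)
    (q : (κ → η → ℤ) × (ι → ℤ)) : ι → ℤ := fun j =>
  open Classical in if h : ∃ p, e p = j then q.1 h.choose.1 h.choose.2 else q.2 j

lemma aux_merge_apply {ι κ η : Type*} (e : κ × η → ι) (he : Function.Injective e)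
    (q : (κ → η → ℤ) × (ι → ℤ)) (r : κ) (i : η) : aux_merge e q (e (r, i)) = q.1 r i := by
  have h : ∃ p, e p = e (r, i) := ⟨_, rfl⟩
  have h2 := he h.choose_spec
  simp only [aux_merge, dif_pos h, h2]

lemma aux_merge_not {ι κ η : Type*} (e : κ × η → ι)
    (q : (κ → η → ℤ) × (ι → ℤ)) (j : ι) (hj : j ∉ Set.range e) : aux_merge e q j = q.2 j := by
  simp only [aux_merge]
  rw [dif_neg]; simpa using hj

lemma aux_merge_map {ι κ η : Type*} [Fintype ι] [Fintype κ] [Fintype η]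
    (e : κ × η → ι) (he : Function.Injective e)
    (μ : Measure ℤ) [IsProbabilityMeasure μ] :
    Measure.pi (fun _ : ι => μ) = Measure.map (aux_merge e)
      ((Measure.pi fun _ : κ => Measure.pi fun _ : η => μ).prod (Measure.pi fun _ : ι => μ)) := by
  classical
  apply Measure.pi_eq
  intro s hs
  have hme : Measurable (aux_merge e) := by
    apply measurable_of_countable
  rw [Measure.map_apply hme (MeasurableSet.univ_pi hs)]
  have : aux_merge e ⁻¹' (Set.univ.pi s) =
      (Set.univ.pi fun r => Set.univ.pi fun i => s (e (r, i))) ×ˢ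
      (Set.univ.pi fun j => if j ∈ Set.range e then Set.univ else s j) := by
    ext q
    simp only [Set.mem_preimage, Set.mem_univ_pi, Set.mem_prod]
    constructor
    · intro h
      refine ⟨fun r i => ?_, fun j => ?_⟩
      · have := h (e (r, i)); rwa [aux_merge_apply e he] at this
      · split_ifs with hj
        · trivial
        · have := h j; rwa [aux_merge_not e q j hj] at this
    · rintro ⟨h1, h2⟩ j
      by_cases hj : j ∈ Set.range e
      · obtain ⟨⟨r, i⟩, rfl⟩ := hj
        rw [aux_merge_apply e he]; exact h1 r i
      · have := h2 j
        rw [if_neg hj] at this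
        rwa [aux_merge_not e q j hj]
  rw [this, Measure.prod_prod, Measure.pi_pi, Measure.pi_pi]
  simp_rw [Measure.pi_pi]
  rw [← Fintype.prod_prod_type (f := fun p : κ × η => μ (s (e p)))]
  rw [← Finset.prod_image (s := Finset.univ) (g := e) (f := fun j => μ (s j)) (fun a _ b _ h => he h)]
  rw [← Finset.prod_mul_prod_compl (Finset.univ.image e) (fun j => μ (s j))]
  congr 1
  rw [← Finset.prod_mul_prod_compl (Finset.univ.image e)]
  rw [Finset.prod_eq_one, one_mul]
  · apply Finset.prod_congr rfl
    intro j hj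
    rw [if_neg]; simpa using hj
  · intro j hj
    rw [if_pos]
    · simp
    · simpa using hj

lemma aux_block {d N : ℕ} (α : ℂ) (hd : d = (minpoly ℚ α).natDegree)
    (μ : Measure ℤ) [IsProbabilityMeasure μ] (k : ℕ) (B : ℝ) (hB0 : 0 ≤ B)
    (hB : ∀ s : ℕ, ∀ z : ℤ, (Measure.pi fun _ : Fin N => μ).real
        {x | ∑ i : Fin N, ((s + k * (i:ℕ) : ℕ) : ℤ) * x i = z} ≤ B) (w : ℂ) :
    (Measure.pi fun _ : Fin d => Measure.pi fun _ : Fin N => μ)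
      {x | ∑ r : Fin d, ((∑ i : Fin N, (((r:ℕ) + 1 + k * (i:ℕ) : ℕ) : ℤ) * x r i : ℤ) : ℂ) * α ^ (r:ℕ) + w = 0}
      ≤ ENNReal.ofReal (B ^ d) := by
  set E := {x : Fin d → Fin N → ℤ | ∑ r : Fin d, ((∑ i : Fin N, (((r:ℕ) + 1 + k * (i:ℕ) : ℕ) : ℤ) * x r i : ℤ) : ℂ) * α ^ (r:ℕ) + w = 0} with hE
  rcases E.eq_empty_or_nonempty with h | ⟨x0, hx0⟩
  · rw [h]; simp
  have hsub : E ⊆ Set.univ.pi fun r : Fin d =>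
      {u : Fin N → ℤ | ∑ i : Fin N, (((r:ℕ) + 1 + k * (i:ℕ) : ℕ) : ℤ) * u i =
        ∑ i : Fin N, (((r:ℕ) + 1 + k * (i:ℕ) : ℕ) : ℤ) * x0 r i} := by
    intro x hx
    have hli := linearIndependent_pow (K := ℚ) α
    rw [← hd, Fintype.linearIndependent_iff] at hli
    have := hli (fun r => ((∑ i : Fin N, (((r:ℕ) + 1 + k * (i:ℕ) : ℕ) : ℤ) * x r i -
      ∑ i : Fin N, (((r:ℕ) + 1 + k * (i:ℕ) : ℕ) : ℤ) * x0 r i : ℤ) : ℚ)) (by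
        have h1 : _ = (0:ℂ) := hx
        have h2 : _ = (0:ℂ) := hx0
        rw [← h2, add_left_inj, ← sub_eq_zero, ← Finset.sum_sub_distrib] at h1
        rw [← h1]
        apply Finset.sum_congr rfl
        intro r _
        rw [Algebra.smul_def, ← sub_mul]
        congr 1
        rw [Int.cast_sub (R := ℚ), map_sub, map_intCast, map_intCast])
    intro r _
    have h := this r
    have h' := Int.cast_eq_zero.1 h
    exact sub_eq_zero.1 h'
  refine (measure_mono hsub).trans ?_
  rw [Measure.pi_pi]
  calc _ ≤ ∏ r : Fin d, ENNReal.ofReal B := by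
        apply Finset.prod_le_prod'
        intro r _
        rw [← ENNReal.ofReal_toReal (measure_ne_top _ _)]
        exact ENNReal.ofReal_le_ofReal (hB _ _)
    _ = _ := by simp [ENNReal.ofReal_pow hB0]

theorem root_of_unity_derivative_root (μ : MeasureTheory.Measure ℤ) [IsProbabilityMeasure μ]
    (hsupp : μ (({-1, 0, 1} : Set ℤ)ᶜ) = 0)
    (hC : ∀ x ∈ ({-1, 0, 1} : Set ℤ), (μ {x}).toReal < 1 / Real.sqrt 3) :
    ∃ C > (0 : ℝ), ∀ n : ℕ, 1 ≤ n → ∀ k : ℕ, 1 ≤ k → k ≤ n → ∀ α : ℂ, α ^ k = 1 →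
      ((Measure.pi fun _ : Fin (n + 1) => μ)
          {a | (Polynomial.derivative (polyOf n a)).eval α = 0}).toReal
        ≤ (C / ((n / k : ℕ) : ℝ)) ^ ((3 * ((minpoly ℚ α).natDegree : ℝ)) / 2) := by
  obtain ⟨C, hC0, hconc⟩ := aux_conc μ hsupp hC
  refine ⟨C, hC0, fun n hn k hk hkn α hα => ?_⟩
  obtain ⟨d, hd⟩ : ∃ d, d = (minpoly ℚ α).natDegree := ⟨_, rfl⟩
  obtain ⟨N, hN⟩ : ∃ N, N = n / k := ⟨_, rfl⟩
  rw [← hd, ← hN]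
  have hN1 : 1 ≤ N := by rw [hN]; exact Nat.div_pos hkn hk
  have hkN : k * N ≤ n := by rw [hN]; exact Nat.mul_div_le n k
  have hdk : d ≤ k := by
    rw [hd]
    have hm : (Polynomial.X ^ k - Polynomial.C (1:ℚ)).Monic :=
      Polynomial.monic_X_pow_sub_C 1 (by omega)
    have h := minpoly.min ℚ α hm (by simp [hα])
    have h2 := Polynomial.natDegree_le_natDegree h
    rwa [Polynomial.natDegree_X_pow_sub_C] at h2
  have hlt : ∀ p : Fin d × Fin N, (p.1:ℕ) + 1 + k * (p.2:ℕ) < n + 1 := by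
    rintro ⟨r, i⟩
    have h1 : k * ((i:ℕ) + 1) ≤ k * N := Nat.mul_le_mul_left k i.2
    have h2 := r.2
    simp only
    rw [mul_add] at h1
    omega
  set e : Fin d × Fin N → Fin (n+1) := fun p => ⟨(p.1:ℕ) + 1 + k * (p.2:ℕ), hlt p⟩ with he
  have hinj : Function.Injective e := by
    rintro ⟨r, i⟩ ⟨r', i'⟩ h
    have h1 : (r:ℕ) + 1 + k * (i:ℕ) = (r':ℕ) + 1 + k * (i':ℕ) := by
      simpa [he] using h
    have h2 : (r:ℕ) + k * i = r' + k * i' := by omega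
    have hr : (r:ℕ) < k := lt_of_lt_of_le r.2 hdk
    have hr' : (r':ℕ) < k := lt_of_lt_of_le r'.2 hdk
    have h3 : (r:ℕ) = r' := by
      have := congrArg (· % k) h2
      simpa [Nat.add_mul_mod_self_left, Nat.mod_eq_of_lt hr, Nat.mod_eq_of_lt hr'] using this
    have h4 : (i:ℕ) = i' := by
      have : k * (i:ℕ) = k * i' := by omega
      exact Nat.eq_of_mul_eq_mul_left hk this
    exact Prod.ext (Fin.ext h3) (Fin.ext h4)
  set B : ℝ := (C / N) ^ (3/2 : ℝ) with hB
  have hB0 : 0 ≤ B := by positivity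
  have hblock := aux_block (N := N) α hd μ k B hB0 (fun s z => hconc N hN1 s k hk z)
  have heval : ∀ a : Fin (n+1) → ℤ, (Polynomial.derivative (polyOf n a)).eval α =
      ∑ j : Fin (n+1), (a j : ℂ) * ((j:ℕ) * α ^ ((j:ℕ) - 1)) := by
    intro a
    simp only [polyOf, Polynomial.derivative_sum, Polynomial.eval_finsetSum]
    apply Finset.sum_congr rfl
    intro j _
    simp [Polynomial.derivative_X_pow]
  have hmer : ∀ x : Fin d → Fin N → ℤ, ∀ y : Fin (n+1) → ℤ,
      (Polynomial.derivative (polyOf n (aux_merge e (x, y)))).eval α =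
      ∑ r : Fin d, ((∑ i : Fin N, (((r:ℕ) + 1 + k * (i:ℕ) : ℕ) : ℤ) * x r i : ℤ) : ℂ) * α ^ (r:ℕ)
       + ∑ j ∈ (Finset.univ.image e)ᶜ, (y j : ℂ) * ((j:ℕ) * α ^ ((j:ℕ) - 1)) := by
    intro x y
    rw [heval, ← Finset.sum_add_sum_compl (Finset.univ.image e)]
    congr 1
    · rw [Finset.sum_image (fun a _ b _ h => hinj h), Fintype.sum_prod_type]
      apply Finset.sum_congr rfl
      intro r _
      rw [Int.cast_sum, Finset.sum_mul]
      apply Finset.sum_congr rfl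
      intro i _
      rw [aux_merge_apply e hinj]
      have : α ^ ((e (r, i) : ℕ) - 1) = α ^ (r:ℕ) := by
        simp only [he]
        rw [show (r:ℕ) + 1 + k * (i:ℕ) - 1 = r + k * i by omega, pow_add, pow_mul, hα, one_pow, mul_one]
      rw [this]
      simp only [he]
      push_cast
      ring
    · apply Finset.sum_congr rfl
      intro j hj
      rw [aux_merge_not e _ j (by simpa using hj)]
  have hmeas : (Measure.pi fun _ : Fin (n + 1) => μ)
      {a | (Polynomial.derivative (polyOf n a)).eval α = 0} ≤ ENNReal.ofReal (B ^ d) := by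
    rw [aux_merge_map e hinj μ, Measure.map_apply (measurable_of_countable _)
      (Set.to_countable _).measurableSet, Measure.prod_apply_symm (Set.to_countable _).measurableSet]
    calc _ ≤ ∫⁻ y : Fin (n+1) → ℤ, ENNReal.ofReal (B ^ d) ∂(Measure.pi fun _ : Fin (n + 1) => μ) := by
          apply lintegral_mono
          intro y
          refine le_trans (measure_mono ?_) (hblock (∑ j ∈ (Finset.univ.image e)ᶜ, (y j : ℂ) * ((j:ℕ) * α ^ ((j:ℕ) - 1))))
          intro x hx
          have h1 : (Polynomial.derivative (polyOf n (aux_merge e (x, y)))).eval α = 0 := hx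
          rw [hmer] at h1
          exact h1
      _ = _ := by simp
  refine (ENNReal.toReal_mono ENNReal.ofReal_ne_top hmeas).trans (le_of_eq ?_)
  rw [ENNReal.toReal_ofReal (by positivity), hB, ← Real.rpow_natCast, ← Real.rpow_mul (by positivity)]
  congr 1
  ring
end

section
/- Assume condition (C). Then for every n ≥ 1 and every complex number α with α ≠ 0 and |α| ≠ 1, the probability that α is a root of P_n satisfies P(P_n(α) = 0) ≤ exp( − n·log 3 / (2·⌈ log 3 / |log |α|| ⌉) ). -/
open MeasureTheory

lemma aux_small (β : ℂ) (h0 : β ≠ 0) (h : ‖β‖ ≤ 1/3) : ∀ (m : ℕ) (e : ℕ → ℤ), (∀ i, |e i| ≤ 2) →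
    ∑ i ∈ Finset.range m, (e i : ℂ) * β ^ i = 0 → ∀ i < m, e i = 0 := by
  have bd : ∀ (m : ℕ) (e : ℕ → ℤ), (∀ i, |e i| ≤ 2) →
      ‖∑ i ∈ Finset.range m, (e i : ℂ) * β ^ i‖ < 3 := by
    intro m
    induction m with
    | zero => intro e he; simp
    | succ m ih =>
      intro e he
      rw [Finset.sum_range_succ']
      have h1 : ∑ i ∈ Finset.range m, (e (i+1) : ℂ) * β ^ (i+1)
          = β * ∑ i ∈ Finset.range m, (e (i+1) : ℂ) * β ^ i := by
        rw [Finset.mul_sum]; refine Finset.sum_congr rfl fun i _ => by ring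
      rw [h1]
      have h2 := ih (fun i => e (i+1)) (fun i => he _)
      have h3 : ‖(e 0 : ℂ)‖ ≤ 2 := by
        rw [Complex.norm_intCast]; exact_mod_cast he 0
      refine (norm_add_le _ _).trans_lt ?_
      rw [norm_mul, pow_zero, mul_one]
      have := norm_nonneg β
      have := norm_nonneg (∑ i ∈ Finset.range m, (e (i+1) : ℂ) * β ^ i)
      nlinarith
  intro m
  induction m with
  | zero => intro e _ _ i hi; omega
  | succ m ih =>
    intro e he hs
    rw [Finset.sum_range_succ'] at hs
    have h1 : ∑ i ∈ Finset.range m, (e (i+1) : ℂ) * β ^ (i+1)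
        = β * ∑ i ∈ Finset.range m, (e (i+1) : ℂ) * β ^ i := by
      rw [Finset.mul_sum]; refine Finset.sum_congr rfl fun i _ => by ring
    rw [h1, pow_zero, mul_one] at hs
    have h2 := bd m (fun i => e (i+1)) (fun i => he _)
    have e0 : e 0 = 0 := by
      have h3 : (e 0 : ℂ) = -(β * ∑ i ∈ Finset.range m, (e (i+1) : ℂ) * β ^ i) := by
        linear_combination hs
      have h4 : ‖(e 0 : ℂ)‖ < 1 := by
        rw [h3, norm_neg, norm_mul]
        have := norm_pos_iff.mpr h0
        nlinarith
      rw [Complex.norm_intCast] at h4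
      have h5 : |e 0| < 1 := by exact_mod_cast h4
      exact Int.abs_lt_one_iff.mp h5
    rw [e0] at hs
    have hs' : ∑ i ∈ Finset.range m, (e (i+1) : ℂ) * β ^ i = 0 := by
      simpa [h0] using hs
    have h6 := ih (fun i => e (i+1)) (fun i => he _) hs'
    intro i hi
    cases i with
    | zero => exact e0
    | succ i => exact h6 i (by omega)

lemma aux_big (β : ℂ) (h : 3 ≤ ‖β‖) (m : ℕ) (e : ℕ → ℤ) (he : ∀ i, |e i| ≤ 2)
    (hs : ∑ i ∈ Finset.range m, (e i : ℂ) * β ^ i = 0) : ∀ i < m, e i = 0 := by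
  have h0 : β ≠ 0 := by rintro rfl; norm_num at h
  have h1 := aux_small β⁻¹ (inv_ne_zero h0) (by
    rw [norm_inv, one_div]; exact inv_anti₀ (by norm_num) h) m (fun i => e (m - 1 - i))
    (fun i => he _) (by
      rw [← Finset.sum_range_reflect] at hs
      have : β ^ (m-1) * ∑ i ∈ Finset.range m, (e (m - 1 - i) : ℂ) * β⁻¹ ^ i = 0 := by
        rw [← hs, Finset.mul_sum]
        refine Finset.sum_congr rfl fun i hi => ?_
        have hi' := Finset.mem_range.mp hi
        have : β ^ (m-1) = β ^ (m-1-i) * β ^ i := by rw [← pow_add]; congr 1; omega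
        rw [this, inv_pow]
        field_simp
      simpa [h0] using this)
  intro i hi
  have := h1 (m-1-i) (by omega)
  simpa [show m - 1 - (m-1-i) = i by omega] using this

lemma aux_uniq (n k : ℕ) (hk : 0 < k) (α : ℂ) (h0 : α ≠ 0)
    (h : 3 ≤ ‖α ^ k‖ ∨ ‖α ^ k‖ ≤ 1/3) (d : Fin (n+1) → ℤ) (hd : ∀ i, |d i| ≤ 2)
    (hd0 : ∀ i : Fin (n+1), ¬ k ∣ (i : ℕ) → d i = 0)
    (hs : ∑ i : Fin (n+1), (d i : ℂ) * α ^ (i : ℕ) = 0) : d = 0 := by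
  set D : ℕ → ℤ := fun j => if h : j < n+1 then d ⟨j, h⟩ else 0 with hD
  have hDd : ∀ i : Fin (n+1), D i = d i := fun i => by simp only [hD, i.2, dif_pos]
  have hD2 : ∀ j, |D j| ≤ 2 := by
    intro j; simp only [hD]; split_ifs
    · exact hd _
    · simp
  have h1 : ∑ j ∈ Finset.range (n+1), (D j : ℂ) * α ^ j = 0 := by
    rw [← Fin.sum_univ_eq_sum_range (fun j => (D j : ℂ) * α ^ j)]
    simpa only [hDd] using hs
  have h2 : ∑ i ∈ Finset.range (n/k+1), (D (k*i) : ℂ) * (α ^ k) ^ i = 0 := by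
    rw [← h1]
    simp only [← pow_mul]
    rw [← Finset.sum_image (s := Finset.range (n/k+1)) (g := fun i => k * i)
      (f := fun j => (D j : ℂ) * α ^ j)
      (fun a _ b _ hab => Nat.eq_of_mul_eq_mul_left hk hab)]
    apply Finset.sum_subset
    · intro j hj
      obtain ⟨i, hi, rfl⟩ := Finset.mem_image.mp hj
      have := Finset.mem_range.mp hi
      have h3 : k * i ≤ k * (n/k) := Nat.mul_le_mul_left _ (by omega)
      have := Nat.mul_div_le n k
      exact Finset.mem_range.mpr (by omega)
    · intro j hj hj'
      have hjn := Finset.mem_range.mp hj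
      have : D j = 0 := by
        simp only [hD, hjn, dif_pos]
        apply hd0
        rintro ⟨c, hc⟩
        apply hj'
        refine Finset.mem_image.mpr ⟨c, Finset.mem_range.mpr ?_, hc.symm⟩
        simp only at hc
        have : c ≤ n / k := (Nat.le_div_iff_mul_le hk).mpr (by rw [mul_comm]; omega)
        omega
      simp [this]
  have h3 : ∀ i < n/k+1, D (k*i) = 0 := by
    rcases h with h | h
    · exact aux_big _ h _ (fun i => D (k*i)) (fun i => hD2 _) h2
    · exact aux_small _ (pow_ne_zero _ h0) h _ (fun i => D (k*i)) (fun i => hD2 _) h2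
  funext i
  by_cases hi : k ∣ (i : ℕ)
  · obtain ⟨c, hc⟩ := hi
    rw [← hDd, hc]
    apply h3
    have := i.2
    have : c ≤ n / k := (Nat.le_div_iff_mul_le hk).mpr (by rw [mul_comm]; omega)
    omega
  · exact hd0 i hi

lemma aux_sub {ι : Type*} [Fintype ι] (μ : Measure ℤ) [IsProbabilityMeasure μ]
    (A : Set ℤ) (hA : μ Aᶜ = 0) (c : ENNReal) (hc : ∀ x ∈ A, μ {x} ≤ c)
    (T : Set (ι → ℤ)) (hT : ∀ a ∈ T, ∀ b ∈ T, (∀ i, a i ∈ A) → (∀ i, b i ∈ A) → a = b) :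
    (Measure.pi fun _ : ι => μ) T ≤ c ^ Fintype.card ι := by
  set P := (Measure.pi fun _ : ι => μ)
  have hae : ∀ᵐ a ∂P, ∀ i, a i ∈ A := by
    rw [MeasureTheory.ae_all_iff]
    intro i
    have : ∀ᵐ x ∂μ, x ∈ A := by rw [MeasureTheory.ae_iff]; exact hA
    exact (Measure.quasiMeasurePreserving_eval (fun _ : ι => μ) i).ae this
  have h1 : P T ≤ P (T ∩ {a | ∀ i, a i ∈ A}) := by
    apply measure_mono_ae
    filter_upwards [hae] with a ha haT
    exact ⟨haT, ha⟩
  refine h1.trans ?_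
  rcases Set.eq_empty_or_nonempty (T ∩ {a | ∀ i, a i ∈ A}) with he | ⟨x, hx⟩
  · rw [he]; simp
  · have : T ∩ {a | ∀ i, a i ∈ A} ⊆ {x} := fun y hy => hT y hy.1 x hx.1 hy.2 hx.2
    refine (measure_mono this).trans ?_
    rw [Measure.pi_singleton]
    calc ∏ i, μ {x i} ≤ ∏ i : ι, c := Finset.prod_le_prod' fun i _ => hc _ (hx.2 i)
      _ = _ := by simp

lemma aux_split {ι : Type*} [Fintype ι] (p : ι → Prop) [DecidablePred p]
    (μ : Measure ℤ) [IsProbabilityMeasure μ]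
    (A : Set ℤ) (hA : μ Aᶜ = 0) (c : ENNReal) (hc : ∀ x ∈ A, μ {x} ≤ c)
    (S : Set (ι → ℤ)) (hS : ∀ a ∈ S, ∀ b ∈ S, (∀ i, p i → a i ∈ A) → (∀ i, p i → b i ∈ A) →
      (∀ i, ¬ p i → a i = b i) → a = b) :
    (Measure.pi fun _ : ι => μ) S ≤ c ^ Fintype.card {i // p i} := by
  have mp := measurePreserving_piEquivPiSubtypeProd (fun _ : ι => μ) p
  set E := MeasurableEquiv.piEquivPiSubtypeProd (fun _ : ι => ℤ) p with hE
  have hm : MeasurableSet (E.symm ⁻¹' S) := (Set.to_countable _).measurableSet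
  have h1 := mp.symm.measure_preimage_equiv S
  rw [← h1]
  change ((Measure.pi fun _ => μ).prod (Measure.pi fun _ => μ)) (E.symm ⁻¹' S) ≤ _
  rw [Measure.prod_apply_symm hm]
  calc _ ≤ ∫⁻ y : {i // ¬ p i} → ℤ, c ^ Fintype.card {i // p i} ∂(Measure.pi fun _ => μ) := by
        apply lintegral_mono
        intro y
        apply aux_sub μ A hA c hc
        intro a ha b hb haA hbA
        have key : E.symm (a, y) = E.symm (b, y) := by
          apply hS _ ha _ hb
          · intro i hi
            simpa [hE, MeasurableEquiv.piEquivPiSubtypeProd, Equiv.piEquivPiSubtypeProd, hi] using haA ⟨i, hi⟩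
          · intro i hi
            simpa [hE, MeasurableEquiv.piEquivPiSubtypeProd, Equiv.piEquivPiSubtypeProd, hi] using hbA ⟨i, hi⟩
          · intro i hi
            simp [hE, MeasurableEquiv.piEquivPiSubtypeProd, Equiv.piEquivPiSubtypeProd, hi]
        exact congrArg Prod.fst (E.symm.injective key)
    _ = _ := by simp

/-- Under condition (C), for `α ≠ 0` with `|α| ≠ 1`, the probability that `α` is a root of
`P_n` is at most `exp(-n·log 3 / (2·⌈log 3 / |log |α||⌉))`. -/
theorem root_off_unit_circle (μ : MeasureTheory.Measure ℤ) [IsProbabilityMeasure μ]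
    (hsupp : μ (({-1, 0, 1} : Set ℤ)ᶜ) = 0)
    (hC : ∀ x ∈ ({-1, 0, 1} : Set ℤ), (μ {x}).toReal < 1 / Real.sqrt 3) :
    ∀ n : ℕ, 1 ≤ n → ∀ α : ℂ, α ≠ 0 → ‖α‖ ≠ 1 →
      ((Measure.pi fun _ : Fin (n + 1) => μ) {a | (polyOf n a).eval α = 0}).toReal
        ≤ Real.exp (-(n * Real.log 3) /
            (2 * (⌈Real.log 3 / |Real.log ‖α‖|⌉₊ : ℝ))) := by
  intro n hn α h0 h1
  have hr : 0 < ‖α‖ := norm_pos_iff.mpr h0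
  have hl0 : Real.log ‖α‖ ≠ 0 := by
    intro h
    rcases Real.log_eq_zero.mp h with h | h | h
    · linarith
    · exact h1 h
    · linarith
  have hlp : 0 < |Real.log ‖α‖| := abs_pos.mpr hl0
  have hl3 : 0 < Real.log 3 := Real.log_pos (by norm_num)
  set k := ⌈Real.log 3 / |Real.log ‖α‖|⌉₊ with hk
  have hk0 : 0 < k := Nat.ceil_pos.mpr (div_pos hl3 hlp)
  have hkl : Real.log 3 ≤ k * |Real.log ‖α‖| := by
    rw [← div_le_iff₀ hlp]; exact Nat.le_ceil _
  have hβ : 3 ≤ ‖α ^ k‖ ∨ ‖α ^ k‖ ≤ 1/3 := by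
    rw [norm_pow]
    have hp : 0 < ‖α‖ ^ k := pow_pos hr k
    rcases abs_cases (Real.log ‖α‖) with ⟨h, _⟩ | ⟨h, _⟩
    · left
      rw [h] at hkl
      rw [← Real.log_le_log_iff (by norm_num) hp, Real.log_pow]; exact hkl
    · right
      rw [h] at hkl
      rw [← Real.log_le_log_iff hp (by norm_num), Real.log_pow, one_div, Real.log_inv]; linarith
  set c : ℝ := 1 / Real.sqrt 3 with hcdef
  have hc0 : 0 < c := by positivity
  have hc1 : c ≤ 1 := by
    rw [hcdef, div_le_one (by positivity)]
    exact Real.one_le_sqrt.mpr (by norm_num)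
  have hlogc : Real.log c = -(Real.log 3 / 2) := by
    rw [hcdef, one_div, Real.log_inv, Real.log_sqrt (by norm_num)]
  have main := aux_split (fun i : Fin (n+1) => k ∣ (i : ℕ)) μ {-1, 0, 1} hsupp (ENNReal.ofReal c)
    (fun x hx => by
      rw [← ENNReal.ofReal_toReal (measure_ne_top μ {x})]
      exact ENNReal.ofReal_le_ofReal (hC x hx).le)
    {a | (polyOf n a).eval α = 0} (by
      intro a ha b hb haA hbA hab
      have hab' : (fun i => a i - b i) = 0 := by
        apply aux_uniq n k hk0 α h0 hβ
        · intro i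
          by_cases hi : k ∣ (i : ℕ)
          · have h1 := haA i hi
            have h2 := hbA i hi
            simp only [Set.mem_insert_iff, Set.mem_singleton_iff] at h1 h2
            rw [abs_le]
            omega
          · simp [hab i hi]
        · intro i hi
          simp [hab i hi]
        · simp only [Set.mem_setOf_eq, polyOf, Polynomial.eval_finset_sum, Polynomial.eval_mul,
            Polynomial.eval_C, Polynomial.eval_pow, Polynomial.eval_X] at ha hb
          simp only [Int.cast_sub, sub_mul, Finset.sum_sub_distrib, ha, hb, sub_zero]
      funext i
      have := congrFun hab' i
      simp only [Pi.zero_apply] at this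
      omega)
  have hcard : n / k + 1 ≤ Fintype.card {i : Fin (n+1) // k ∣ (i : ℕ)} := by
    have hlt : ∀ j : Fin (n/k+1), k * (j : ℕ) < n + 1 := by
      intro j
      have := j.2
      have h3 : k * (j : ℕ) ≤ k * (n/k) := Nat.mul_le_mul_left _ (by omega)
      have := Nat.mul_div_le n k
      omega
    have := Fintype.card_le_of_injective
      (fun j : Fin (n/k+1) => (⟨⟨k * j, hlt j⟩, Dvd.intro _ rfl⟩ : {i : Fin (n+1) // k ∣ (i : ℕ)}))
      (by
        intro a b hab
        simp only [Subtype.mk.injEq, Fin.mk.injEq] at hab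
        exact Fin.ext (Nat.eq_of_mul_eq_mul_left hk0 hab))
    simpa using this
  have h2 : ((Measure.pi fun _ : Fin (n + 1) => μ) {a | (polyOf n a).eval α = 0}).toReal
      ≤ c ^ (Fintype.card {i : Fin (n+1) // k ∣ (i : ℕ)}) := by
    rw [← ENNReal.ofReal_pow hc0.le] at main
    exact ENNReal.toReal_le_of_le_ofReal (by positivity) main
  refine h2.trans ((pow_le_pow_of_le_one hc0.le hc1 hcard).trans ?_)
  rw [← Real.log_le_iff_le_exp (by positivity), Real.log_pow, hlogc]
  have hkR : (0:ℝ) < k := by exact_mod_cast hk0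
  have h3 : (n : ℝ) / k ≤ ((n / k + 1 : ℕ) : ℝ) := by
    rw [div_le_iff₀ hkR]
    have := (Nat.lt_mul_div_succ n hk0).le
    rw [mul_comm] at this
    exact_mod_cast this
  have h4 : -(n * Real.log 3) / (2 * (k:ℝ)) = -((n : ℝ) / k * (Real.log 3 / 2)) := by
    field_simp
  rw [h4]
  nlinarith
end

section
/- For every n ≥ 1 and every nonzero polynomial f(z) = Σ_{j=0}^n a_j z^j with all coefficients a_j ∈ {-1,0,1}, the number of distinct complex numbers z with f(z) = 0 and |z| ≥ 3/2 is at most 26. -/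
open Polynomial in
theorem aux_upper (f : Polynomial ℂ) (hcoeff : ∀ j : ℕ, f.coeff j ∈ ({-1, 0, 1} : Set ℂ)) :
    (f.scaleRoots (4/5)).mahlerMeasure ≤ 5 := by
  have hc : ∀ j, ‖f.coeff j‖ ≤ 1 := by
    intro j
    rcases hcoeff j with h | h | h <;> rw [h] <;> simp
  refine (mahlerMeasure_le_sum_norm_coeff _).trans ?_
  rw [Polynomial.sum_over_range _ (by simp), natDegree_scaleRoots]
  calc _ ≤ ∑ i ∈ Finset.range (f.natDegree + 1), (4/5 : ℝ) ^ (f.natDegree - i) := by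
        refine Finset.sum_le_sum fun i _ => ?_
        rw [coeff_scaleRoots, norm_mul, norm_pow]
        have : ‖(4/5 : ℂ)‖ = 4/5 := by simp
        rw [this]
        exact mul_le_of_le_one_left (by positivity) (hc i)
    _ = ∑ i ∈ Finset.range (f.natDegree + 1), (4/5 : ℝ) ^ i := by
        rw [← Finset.sum_range_reflect]
        refine Finset.sum_congr rfl fun i hi => ?_
        rw [Finset.mem_range] at hi
        congr 1; omega
    _ ≤ 5 := by
        rw [geom_sum_eq (by norm_num)]
        have : (0:ℝ) < (4/5) ^ (f.natDegree + 1) := by positivity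
        rw [div_le_iff_of_neg (by norm_num)]
        linarith

/-- For every nonzero polynomial of degree at most `n` whose coefficients all lie in
`{-1, 0, 1}`, the number of complex roots `z` with `|z| ≥ 3/2` is at most 26. -/
theorem roots_far_from_circle_count (n : ℕ) (hn : 1 ≤ n) (f : Polynomial ℂ) (hf : f ≠ 0)
    (hdeg : f.natDegree ≤ n)
    (hcoeff : ∀ j : ℕ, f.coeff j ∈ ({-1, 0, 1} : Set ℂ)) :
    {z : ℂ | f.eval z = 0 ∧ (3 : ℝ) / 2 ≤ ‖z‖}.ncard ≤ 26 := by
  classical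
  have hlead : ‖f.leadingCoeff‖ = 1 := by
    have h0 : f.leadingCoeff ≠ 0 := Polynomial.leadingCoeff_ne_zero.mpr hf
    rcases hcoeff f.natDegree with h | h | h
    · rw [Polynomial.leadingCoeff, h]; simp
    · exact absurd h h0
    · rw [Polynomial.leadingCoeff, h]; simp
  have hup := aux_upper f hcoeff
  rw [Polynomial.mahlerMeasure_eq_leadingCoeff_mul_prod_roots, Polynomial.leadingCoeff_scaleRoots,
    hlead, one_mul, Polynomial.roots_scaleRoots _ (isUnit_iff_ne_zero.mpr (by norm_num)),
    Multiset.map_map] at hup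
  set T : Finset ℂ := f.roots.toFinset.filter (fun z => (3 : ℝ) / 2 ≤ ‖z‖) with hT
  have hset : {z : ℂ | f.eval z = 0 ∧ (3 : ℝ) / 2 ≤ ‖z‖} = (T : Set ℂ) := by
    ext z
    simp [hT, hf]
  rw [hset, Set.ncard_coe_finset]
  have hle : T.val ≤ f.roots := by
    refine (Multiset.le_iff_subset T.nodup).mpr fun z hz => ?_
    have : z ∈ T := hz
    rw [hT, Finset.mem_filter, Multiset.mem_toFinset] at this
    exact this.1
  obtain ⟨U, hU⟩ := Multiset.le_iff_exists_add.mp hle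
  rw [hU, Multiset.map_add, Multiset.prod_add] at hup
  set F : ℂ → ℝ := (fun a : ℂ ↦ max 1 ‖a‖) ∘ (fun x => 4/5 * x) with hF
  have h1 : (1:ℝ) ≤ (U.map F).prod := by
    refine Multiset.one_le_prod fun x hx => ?_
    obtain ⟨a, -, rfl⟩ := Multiset.mem_map.mp hx
    exact le_max_left _ _
  have h2 : (6/5 : ℝ) ^ T.card ≤ (T.val.map F).prod := by
    change _ ≤ ∏ x ∈ T, F x
    rw [← Finset.prod_const]
    refine Finset.prod_le_prod (fun _ _ => by norm_num) fun z hz => ?_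
    rw [hT, Finset.mem_filter] at hz
    have h45 : ‖(4/5 : ℂ)‖ = 4/5 := by simp
    refine le_trans ?_ (le_max_right 1 ‖4/5 * z‖)
    rw [norm_mul, h45]
    linarith [hz.2]
  by_contra! hcon
  have h3 : (6/5 : ℝ) ^ 27 ≤ (6/5 : ℝ) ^ T.card := pow_le_pow_right₀ (by norm_num) hcon
  have h4 : (5:ℝ) < (6/5 : ℝ) ^ 27 := by norm_num
  nlinarith
end

section
/- Assume condition (C). There exists a constant C > 0 depending only on μ such that for every N ≥ 1 and every choice of pairwise distinct integers a_1, …, a_N, one has sup_{m ∈ ℤ} P( Σ_{j=1}^N ξ_j a_j = m ) ≤ C·N^{−3/2}. -/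
open MeasureTheory

section
variable {p : ℕ} [Fact p.Prime] {N : ℕ}
noncomputable def gg (b : Fin N → ZMod p) (t : ZMod p) : ℝ :=
  Real.sqrt (∑ j, ‖1 - ZMod.stdAddChar (t * b j)‖ ^ 2)
noncomputable def TT (b : Fin N → ZMod p) (r : ℝ) : Finset (ZMod p) :=
  Finset.univ.filter fun t => gg b t ≤ r

lemma norm_std (x : ZMod p) : ‖ZMod.stdAddChar x‖ = 1 := AddChar.norm_apply _ _

lemma std_sum {ι : Type*} (s : Finset ι) (f : ι → ZMod p) :
    (ZMod.stdAddChar (∑ i ∈ s, f i) : ℂ) = ∏ i ∈ s, ZMod.stdAddChar (f i) := by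
  classical
  induction s using Finset.induction_on with
  | empty => simp
  | insert i s hi ih =>
    rw [Finset.sum_insert hi, Finset.prod_insert hi, AddChar.map_add_eq_mul, ih]

lemma gg_add (b : Fin N → ZMod p) (s t : ZMod p) : gg b (s+t) ≤ gg b s + gg b t := by
  let v : EuclideanSpace ℂ (Fin N) := WithLp.toLp 2 fun j => 1 - ZMod.stdAddChar (s * b j)
  let w : EuclideanSpace ℂ (Fin N) := WithLp.toLp 2 fun j =>
    ZMod.stdAddChar (s * b j) * (1 - ZMod.stdAddChar (t * b j))
  have h := norm_add_le v w
  have hv : ‖v‖ = gg b s := by rw [EuclideanSpace.norm_eq]; rfl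
  have hw : ‖w‖ = gg b t := by
    rw [EuclideanSpace.norm_eq]; unfold gg
    congr 1; apply Finset.sum_congr rfl; intro j _
    simp only [w, norm_mul, norm_std, one_mul]
  have hvw : ‖v + w‖ = gg b (s+t) := by
    rw [EuclideanSpace.norm_eq]; unfold gg
    congr 1; apply Finset.sum_congr rfl; intro j _
    simp only [v, w, PiLp.add_apply, add_mul, AddChar.map_add_eq_mul]
    congr 2; ring
  rw [← hv, ← hw, ← hvw]; exact h

lemma gg_zero (b : Fin N → ZMod p) : gg b 0 = 0 := by simp [gg]

open Pointwise in
lemma TT_mul (b : Fin N → ZMod p) (r : ℝ) (hr : 0 ≤ r) (k : ℕ) :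
    min p (k * ((TT b r).card - 1) + 1) ≤ (TT b (k * r)).card := by
  have h0 : ∀ r : ℝ, 0 ≤ r → (0 : ZMod p) ∈ TT b r := by
    intro r hr; simp [TT, gg_zero, hr]
  induction k with
  | zero =>
    have : 0 < (TT b ((0:ℕ) * r)).card := Finset.card_pos.2 ⟨0, h0 _ (by simp)⟩
    simp only [zero_mul, zero_add]; omega
  | succ k ih =>
    have hk : (0:ℝ) ≤ k * r := by positivity
    have h := ZMod.cauchy_davenport (Fact.out : p.Prime) ⟨0, h0 _ hk⟩ ⟨0, h0 _ hr⟩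
    have hsub : TT b (k * r) + TT b r ⊆ TT b ((k+1 : ℕ) * r) := by
      intro x hx
      obtain ⟨y, hy, z, hz, rfl⟩ := Finset.mem_add.1 hx
      simp only [TT, Finset.mem_filter, Finset.mem_univ, true_and] at *
      push_cast
      linarith [gg_add b y z]
    have h2 := Finset.card_le_card hsub
    have h3 : 0 < (TT b r).card := Finset.card_pos.2 ⟨0, h0 _ hr⟩
    rw [Nat.succ_mul]
    generalize k * ((TT b r).card - 1) = M at *
    omega

lemma sum_sq (b : Fin N → ZMod p) (hb : Function.Injective b) :
    ∑ t : ZMod p, ‖∑ j, ZMod.stdAddChar (t * b j)‖ ^ 2 = (p : ℝ) * N := by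
  have : ((∑ t : ZMod p, ‖∑ j, ZMod.stdAddChar (t * b j)‖ ^ 2 : ℝ) : ℂ) = (p : ℂ) * N := by
    push_cast
    have h1 : ∀ t : ZMod p, ((‖∑ j, ZMod.stdAddChar (t * b j)‖ : ℝ) : ℂ) ^ 2
        = ∑ i, ∑ j, ZMod.stdAddChar (t * (b i - b j)) := by
      intro t
      rw [← Complex.mul_conj', map_sum, Finset.sum_mul_sum]
      refine Finset.sum_congr rfl fun i _ => Finset.sum_congr rfl fun j _ => ?_
      rw [← AddChar.map_neg_eq_conj, ← AddChar.map_add_eq_mul]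
      congr 1; ring
    simp_rw [h1]
    rw [Finset.sum_comm]
    simp_rw [Finset.sum_comm (s := (Finset.univ : Finset (ZMod p)))]
    simp_rw [AddChar.sum_mulShift _ (ZMod.isPrimitive_stdAddChar p), sub_eq_zero, hb.eq_iff]
    simp [mul_comm]
  exact_mod_cast this

lemma card_big (b : Fin N → ZMod p) (hb : Function.Injective b) (hN : 1 ≤ N) :
    ((TT b (Real.sqrt N)).card : ℝ) ≤ 4 * p / N := by
  have hN' : (1:ℝ) ≤ N := by exact_mod_cast hN
  have h : ∀ t ∈ TT b (Real.sqrt N), (N:ℝ)^2/4 ≤ ‖∑ j, ZMod.stdAddChar (t * b j)‖ ^ 2 := by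
    intro t ht
    simp only [TT, Finset.mem_filter, Finset.mem_univ, true_and] at ht
    unfold gg at ht
    rw [Real.sqrt_le_sqrt_iff (by positivity)] at ht
    have h1 : ∀ j, ‖1 - ZMod.stdAddChar (t * b j)‖ ^ 2 = 2 - 2 * (ZMod.stdAddChar (t * b j)).re := by
      intro j
      have := norm_std (t * b j)
      have h2 : ‖ZMod.stdAddChar (t * b j)‖^2 = 1 := by rw [this]; norm_num
      rw [Complex.sq_norm, Complex.normSq_apply] at *
      simp only [Complex.sub_re, Complex.sub_im, Complex.one_re, Complex.one_im]
      linarith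
    simp_rw [h1] at ht
    rw [Finset.sum_sub_distrib, ← Finset.mul_sum, ← Complex.re_sum] at ht
    simp at ht
    have h3 := Complex.re_le_norm (∑ j, ZMod.stdAddChar (t * b j))
    simp only [Complex.re_sum] at h3
    nlinarith
  have h2 := Finset.card_nsmul_le_sum _ _ _ h
  have h3 : ∑ t ∈ TT b (Real.sqrt N), ‖∑ j, ZMod.stdAddChar (t * b j)‖ ^ 2 ≤ p * N := by
    rw [← sum_sq b hb]
    exact Finset.sum_le_sum_of_subset_of_nonneg (Finset.subset_univ _) (fun _ _ _ => by positivity)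
  rw [nsmul_eq_mul] at h2
  rw [le_div_iff₀ (by positivity)]
  have : ((TT b (Real.sqrt N)).card : ℝ) * N * N ≤ 4 * p * N := by nlinarith
  exact le_of_mul_le_mul_right this (by positivity)

lemma card_level (b : Fin N → ZMod p) (hb : Function.Injective b) (hN : 1 ≤ N) (hp : N^2 ≤ p)
    (l : ℕ) (hl : 1 ≤ l) :
    ((TT b l).card : ℝ) ≤ 9 * p * l ^ 3 / (Real.sqrt N)^3 := by
  have hN' : (1:ℝ) ≤ N := by exact_mod_cast hN
  have hl' : (1:ℝ) ≤ l := by exact_mod_cast hl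
  set s := Real.sqrt N with hs
  have hs2 : s ^ 2 = N := Real.sq_sqrt (by positivity)
  have hs1 : 1 ≤ s := by rw [hs]; exact Real.one_le_sqrt.2 hN'
  have hp0 : (0:ℝ) ≤ p := by positivity
  have hcp : ((TT b l).card : ℝ) ≤ p := by
    have := Finset.card_le_univ (TT b l)
    rw [ZMod.card] at this; exact_mod_cast this
  have hl3 : (1:ℝ) ≤ (l:ℝ)^3 := one_le_pow₀ hl'
  rw [le_div_iff₀ (by positivity)]
  by_cases h4 : N ≤ 4
  · have : s ≤ 2 := by
      rw [hs, Real.sqrt_le_left (by norm_num)]; norm_num; exact_mod_cast h4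
    have h8 : s^3 ≤ 2^3 := by gcongr
    calc _ ≤ (p:ℝ) * 2^3 := by gcongr
      _ ≤ 9 * p * 1 := by linarith
      _ ≤ _ := by gcongr
  by_cases hls : s < l
  · calc _ ≤ (p:ℝ) * l^3 := by gcongr
      _ ≤ _ := by nlinarith [mul_nonneg hp0 (zero_le_one.trans hl3)]
  push Not at h4 hls
  have hN5 : (5:ℝ) ≤ N := by exact_mod_cast h4
  have hl0 : (0:ℝ) < l := by positivity
  set k := ⌊s / l⌋₊ with hk
  have hk1 : 1 ≤ k := by
    rw [hk, Nat.one_le_floor_iff, le_div_iff₀ hl0]; linarith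
  have hk1' : (1:ℝ) ≤ k := by exact_mod_cast hk1
  have hk2 : k * (l:ℝ) ≤ s := by
    rw [← le_div_iff₀ hl0]; exact Nat.floor_le (by positivity)
  have hk3 : s < (k + 1) * l := by
    rw [← div_lt_iff₀ hl0]; exact Nat.lt_floor_add_one _
  have hk4 : s ≤ 2 * k * l := by nlinarith
  have h1 := TT_mul b l hl0.le k
  have h2 : TT b (k * l) ⊆ TT b s := by
    intro x hx
    simp only [TT, Finset.mem_filter, Finset.mem_univ, true_and] at *
    linarith
  have h3 := Finset.card_le_card h2
  have h5 := card_big b hb hN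
  rw [← hs, le_div_iff₀ (by positivity)] at h5
  have hpp : (0:ℝ) < p := by exact_mod_cast (Fact.out : p.Prime).pos
  have h6 : (TT b s).card < p := by
    have : ((TT b s).card : ℝ) < p := by nlinarith
    exact_mod_cast this
  have h7 : k * ((TT b l).card - 1) + 1 ≤ (TT b s).card := by omega
  set c := (TT b l).card
  have h8 : (k:ℝ) * (c - 1) ≤ (TT b s).card := by
    have hc : (c:ℝ) - 1 ≤ ((c - 1 : ℕ) : ℝ) := by
      rw [sub_le_iff_le_add]; norm_cast; omega
    have : (k:ℝ) * ((c - 1 : ℕ) : ℝ) + 1 ≤ (TT b s).card := by exact_mod_cast h7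
    nlinarith
  -- (c-1) k N ≤ 4p
  have h9 : (k:ℝ) * (c - 1) * s^2 ≤ 4 * p := by rw [hs2]; nlinarith
  have hps : s^3 ≤ p := by
    have : (s^2)^2 ≤ p := by rw [hs2]; exact_mod_cast hp
    nlinarith [pow_pos (zero_lt_one.trans_le hs1) 3]
  have h10 : (c - 1 : ℝ) * s^3 ≤ 8 * p * l := by
    by_cases hc : (c:ℝ) ≤ 1
    · have : (c - 1 : ℝ) * s^3 ≤ 0 := mul_nonpos_of_nonpos_of_nonneg (by linarith) (by positivity)
      have : 0 ≤ 8 * (p:ℝ) * l := by positivity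
      linarith
    · push Not at hc
      have hc' : (0:ℝ) ≤ c - 1 := by linarith
      calc (c - 1 : ℝ) * s^3 = (c - 1) * s^2 * s := by ring
        _ ≤ (c-1) * s^2 * (2 * k * l) := by gcongr
        _ = (k * (c-1) * s^2) * (2 * l) := by ring
        _ ≤ (4 * p) * (2 * l) := by gcongr
        _ = _ := by ring
  have h11 : (l:ℝ) ≤ l^3 := le_self_pow₀ hl' (by norm_num)
  have h12 : (c:ℝ) * s^3 ≤ 8 * p * l + p := by linarith
  nlinarith [mul_le_mul_of_nonneg_left h11 hp0, mul_le_mul_of_nonneg_left hl3 hp0]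

lemma sum_exp (κ : ℝ) (hκ : 0 < κ) (b : Fin N → ZMod p) (hb : Function.Injective b) (hN : 1 ≤ N)
    (hp : N^2 ≤ p) :
    ∑ t : ZMod p, Real.exp (-κ * (gg b t)^2) ≤
      (9 * ∑' n : ℕ, ((n:ℝ)+1)^3 * Real.exp (-κ * n)) * p / (Real.sqrt N)^3 := by
  have hsum : Summable fun n : ℕ => ((n:ℝ)+1)^3 * Real.exp (-κ * n) := by
    have h := (Real.summable_pow_mul_exp_neg_nat_mul 3 hκ)
    have h2 := ((summable_nat_add_iff 1).2 h).mul_left (Real.exp κ)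
    refine h2.congr fun n => ?_
    push_cast
    rw [mul_left_comm, ← Real.exp_add]; congr 2; ring
  obtain ⟨M, hM⟩ : ∃ M : ℕ, ∀ t : ZMod p, ⌊gg b t⌋₊ < M :=
    ⟨(Finset.univ.sup fun t => ⌊gg b t⌋₊) + 1, fun t =>
      Nat.lt_succ_of_le (Finset.le_sup (f := fun t => ⌊gg b t⌋₊) (Finset.mem_univ t))⟩
  have hpt : ∀ t : ZMod p, Real.exp (-κ * (gg b t)^2) ≤
      ∑ n ∈ Finset.range M, if gg b t ≤ ((n+1 : ℕ):ℝ) then Real.exp (-κ * n) else 0 := by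
    intro t
    have h0 : 0 ≤ gg b t := Real.sqrt_nonneg _
    have hf := Nat.floor_le h0
    have hle : gg b t ≤ ((⌊gg b t⌋₊ + 1 : ℕ) : ℝ) := by
      push_cast; exact (Nat.lt_floor_add_one _).le
    have := Finset.single_le_sum
      (f := fun n : ℕ => if gg b t ≤ ((n+1 : ℕ):ℝ) then Real.exp (-κ * n) else 0)
      (s := Finset.range M) (fun n _ => by split_ifs <;> positivity) (Finset.mem_range.2 (hM t))
    refine le_trans ?_ this
    simp only [hle, if_true]
    apply Real.exp_le_exp.2
    have h1 : ((⌊gg b t⌋₊ : ℕ) : ℝ) ≤ ((⌊gg b t⌋₊ : ℕ) : ℝ)^2 := by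
      norm_cast; exact Nat.le_self_pow (by norm_num) _
    have h2 : ((⌊gg b t⌋₊ : ℕ) : ℝ)^2 ≤ (gg b t)^2 := by gcongr
    nlinarith
  have hs0 : 0 < Real.sqrt N := Real.sqrt_pos.2 (by exact_mod_cast hN)
  calc _ ≤ ∑ t : ZMod p, ∑ n ∈ Finset.range M,
        (if gg b t ≤ ((n+1 : ℕ):ℝ) then Real.exp (-κ * n) else 0) :=
        Finset.sum_le_sum fun t _ => hpt t
    _ = ∑ n ∈ Finset.range M, ((TT b ((n+1:ℕ):ℝ)).card : ℝ) * Real.exp (-κ * n) := by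
        rw [Finset.sum_comm]
        refine Finset.sum_congr rfl fun n _ => ?_
        rw [← Finset.sum_filter, Finset.sum_const, nsmul_eq_mul]; rfl
    _ ≤ ∑ n ∈ Finset.range M, (9 * p / (Real.sqrt N)^3) * (((n:ℝ)+1)^3 * Real.exp (-κ * n)) := by
        refine Finset.sum_le_sum fun n _ => ?_
        have := card_level b hb hN hp (n+1) (by omega)
        calc _ ≤ (9 * p * ((n+1:ℕ):ℝ) ^ 3 / (Real.sqrt N)^3) * Real.exp (-κ * n) := by gcongr
          _ = _ := by push_cast; ring
    _ = (9 * p / (Real.sqrt N)^3) * ∑ n ∈ Finset.range M, (((n:ℝ)+1)^3 * Real.exp (-κ * n)) := by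
        rw [Finset.mul_sum]
    _ ≤ (9 * p / (Real.sqrt N)^3) * ∑' n : ℕ, (((n:ℝ)+1)^3 * Real.exp (-κ * n)) := by
        gcongr
        exact hsum.sum_le_tsum _ (fun n _ => by positivity)
    _ = _ := by ring


lemma char_bound (μ : Measure ℤ) [IsProbabilityMeasure μ] (x y : ℤ) (hxy : x ≠ y) (s : ZMod p) :
    ‖∫ z, (ZMod.stdAddChar (s * (z : ZMod p)) : ℂ) ∂μ‖ ≤
      Real.exp (-(μ.real {x} * μ.real {y} / 2) * ‖1 - ZMod.stdAddChar (s * ((y - x : ℤ) : ZMod p))‖^2) := by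
  set F : ℤ → ℂ := fun z => ZMod.stdAddChar (s * (z : ZMod p)) with hF
  have hn : ∀ z, ‖F z‖ = 1 := fun z => norm_std _
  have hint : Integrable F μ := by
    refine Integrable.of_bound (C := 1) (Measurable.of_discrete).aestronglyMeasurable ?_
    exact Filter.Eventually.of_forall fun z => (hn z).le
  set S : Finset ℤ := {x, y} with hS
  have hSm : MeasurableSet (S : Set ℤ) := S.measurableSet
  rw [← integral_add_compl hSm hint, setIntegral_finset S hint.integrableOn]
  have hc : ‖∫ z in (S : Set ℤ)ᶜ, F z ∂μ‖ ≤ 1 - (μ.real {x} + μ.real {y}) := by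
    have h1 := norm_setIntegral_le_of_norm_le_const (μ := μ) (s := (S : Set ℤ)ᶜ) (C := 1) (f := F)
      (measure_lt_top _ _) (fun z _ => (hn z).le)
    have h2 : μ.real (S : Set ℤ) = μ.real {x} + μ.real {y} := by
      rw [← sum_measureReal_singleton, hS, Finset.sum_pair hxy]
    rw [probReal_compl_eq_one_sub hSm, h2, one_mul] at h1
    exact h1
  rw [hS, Finset.sum_pair hxy] 
  set u := μ.real {x}
  set v := μ.real {y}
  have hu : 0 ≤ u := measureReal_nonneg
  have hv : 0 ≤ v := measureReal_nonneg
  have huv : u + v ≤ 1 := by linarith [norm_nonneg (∫ z in (S : Set ℤ)ᶜ, F z ∂μ)]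
  set w : ℂ := ZMod.stdAddChar (s * ((y - x : ℤ) : ZMod p)) with hw
  have hwn : ‖w‖ = 1 := norm_std _
  have hy : F y = F x * w := by
    rw [hF, hw]; simp only
    rw [← AddChar.map_add_eq_mul]; congr 1; push_cast; ring
  have hm : ‖u • F x + v • F y‖ = ‖(u:ℂ) + v * w‖ := by
    have : u • F x + v • F y = F x * ((u:ℂ) + v * w) := by
      rw [hy]; simp only [Complex.real_smul]; ring
    rw [this, norm_mul, hn, one_mul]
  have hsq : ‖(u:ℂ) + v * w‖^2 = (u+v)^2 - u * v * ‖1 - w‖^2 := by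
    have h2 : ‖w‖^2 = 1 := by rw [hwn]; norm_num
    rw [Complex.sq_norm, Complex.normSq_apply] at *
    rw [Complex.sq_norm, Complex.normSq_apply]
    simp only [Complex.sub_re, Complex.sub_im, Complex.one_re, Complex.one_im, Complex.add_re,
      Complex.add_im, Complex.mul_re, Complex.mul_im, Complex.ofReal_re, Complex.ofReal_im]
    linear_combination (v^2 + u * v) * h2
  have hd : ‖1 - w‖ ≤ 2 := by
    have := norm_sub_le (1:ℂ) w
    rw [hwn, norm_one] at this; linarith
  set D := ‖1 - w‖^2 with hD
  have hD0 : 0 ≤ D := by positivity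
  have hD4 : D ≤ 4 := by rw [hD]; nlinarith [norm_nonneg (1 - w)]
  have huv0 : 0 ≤ u * v := by positivity
  have hr : 0 ≤ (u + v) - u * v * D / 2 := by
    have : u * v * D ≤ u * v * 4 := by gcongr
    nlinarith
  have hle : ‖(u:ℂ) + v * w‖ ≤ (u + v) - u * v * D / 2 := by
    refine (sq_le_sq₀ (norm_nonneg _) hr).1 ?_
    rw [hsq]
    have : 0 ≤ u * v * D := by positivity
    nlinarith [sq_nonneg (u * v * D)]
  have he := Real.add_one_le_exp (-(u * v / 2) * D)
  calc _ ≤ ‖u • F x + v • F y‖ + ‖∫ z in (S : Set ℤ)ᶜ, F z ∂μ‖ := norm_add_le _ _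
    _ ≤ ((u + v) - u * v * D / 2) + (1 - (u + v)) := by rw [hm]; gcongr
    _ ≤ _ := by linarith

lemma prob_bound (μ : Measure ℤ) [IsProbabilityMeasure μ] (x y : ℤ) (hxy : x ≠ y)
    (a : Fin N → ℤ) (m : ℤ) :
    (p : ℝ) * ((Measure.pi fun _ : Fin N => μ).real {ξ | ∑ j : Fin N, ξ j * a j = m})
      ≤ ∑ t : ZMod p, Real.exp (-(μ.real {x} * μ.real {y} / 2) *
          (gg (fun j => (a j : ZMod p) * ((y - x : ℤ) : ZMod p)) t)^2) := by
  set P := Measure.pi fun _ : Fin N => μ with hP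
  set κ := μ.real {x} * μ.real {y} / 2
  set G : ZMod p → (Fin N → ℤ) → ℂ := fun t ξ =>
    ZMod.stdAddChar (t * ((∑ j, ξ j * a j - m : ℤ) : ZMod p)) with hG
  have hGn : ∀ t ξ, ‖G t ξ‖ = 1 := fun t ξ => norm_std _
  have hGi : ∀ t, Integrable (G t) P := fun t =>
    Integrable.of_bound (C := 1) (Measurable.of_discrete).aestronglyMeasurable
      (Filter.Eventually.of_forall fun z => (hGn t z).le)
  set E : Set (Fin N → ℤ) := {ξ | ((∑ j, ξ j * a j - m : ℤ) : ZMod p) = 0} with hE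
  have hEm : MeasurableSet E := MeasurableSet.of_discrete
  have hsub : P.real {ξ | ∑ j : Fin N, ξ j * a j = m} ≤ P.real E := by
    refine measureReal_mono ?_ (measure_ne_top _ _)
    intro ξ hξ
    simp only [Set.mem_ofPred_eq, hE] at *
    rw [hξ]; simp
  have hsum : ∀ ξ, ∑ t, G t ξ = E.indicator (fun _ => (p:ℂ)) ξ := by
    intro ξ
    simp only [hG]
    rw [AddChar.sum_mulShift _ (ZMod.isPrimitive_stdAddChar p), Set.indicator_apply, ZMod.card]
    simp only [hE, Set.mem_ofPred_eq]
    split_ifs <;> simp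
  have hI : ∑ t, ∫ ξ, G t ξ ∂P = ((p * P.real E : ℝ) : ℂ) := by
    rw [← integral_finsetSum _ (fun t _ => hGi t)]
    simp_rw [hsum]
    rw [integral_indicator_const _ hEm]
    simp [mul_comm]
  have hGt : ∀ t, ‖∫ ξ, G t ξ ∂P‖ ≤
      Real.exp (-κ * (gg (fun j => (a j : ZMod p) * ((y - x : ℤ) : ZMod p)) t)^2) := by
    intro t
    have h1 : ∀ ξ, G t ξ = ZMod.stdAddChar (-(t * (m : ZMod p))) *
        ∏ j, (ZMod.stdAddChar ((t * (a j : ZMod p)) * (ξ j : ZMod p)) : ℂ) := by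
      intro ξ
      have hprod : ZMod.stdAddChar (∑ j, (t * (a j : ZMod p)) * (ξ j : ZMod p)) =
          ∏ j, (ZMod.stdAddChar ((t * (a j : ZMod p)) * (ξ j : ZMod p)) : ℂ) :=
        std_sum _ _
      rw [← hprod, ← AddChar.map_add_eq_mul]
      simp only [hG]
      congr 1
      push_cast
      rw [mul_sub, Finset.mul_sum]
      rw [sub_eq_neg_add]
      congr 1
      exact Finset.sum_congr rfl fun j _ => by ring
    simp_rw [h1]
    rw [integral_const_mul, norm_mul, norm_std, one_mul, hP,
      integral_fintype_prod_eq_prod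
        (fun j (z : ℤ) => (ZMod.stdAddChar ((t * (a j : ZMod p)) * (z : ZMod p)) : ℂ)), norm_prod]
    have h0 : ∀ b : Fin N → ZMod p, (gg b t)^2 = ∑ j, ‖1 - ZMod.stdAddChar (t * b j)‖ ^ 2 :=
      fun b => Real.sq_sqrt (by positivity)
    rw [h0, Finset.mul_sum, Real.exp_sum]
    refine Finset.prod_le_prod (fun _ _ => norm_nonneg _) fun j _ => ?_
    have := char_bound μ x y hxy (t * (a j : ZMod p))
    rw [← mul_assoc]
    exact this
  calc (p:ℝ) * P.real {ξ | ∑ j : Fin N, ξ j * a j = m} ≤ p * P.real E := by gcongr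
    _ = ‖((p * P.real E : ℝ) : ℂ)‖ := by
      rw [Complex.norm_real, Real.norm_of_nonneg (by positivity)]
    _ ≤ ∑ t, ‖∫ ξ, G t ξ ∂P‖ := by rw [← hI]; exact norm_sum_le _ _
    _ ≤ _ := Finset.sum_le_sum fun t _ => hGt t

end

lemma exists_atoms (μ : Measure ℤ) [IsProbabilityMeasure μ]
    (hsupp : μ (({-1, 0, 1} : Set ℤ)ᶜ) = 0)
    (hC : ∀ x ∈ ({-1, 0, 1} : Set ℤ), (μ {x}).toReal < 1 / Real.sqrt 3) :
    ∃ x y : ℤ, x ≠ y ∧ 0 < μ.real {x} ∧ 0 < μ.real {y} := by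
  have h3 : 1 / Real.sqrt 3 ≤ 1 := by
    rw [div_le_one (by positivity)]; exact Real.one_le_sqrt.2 (by norm_num)
  have h1 : μ.real {(-1:ℤ)} < 1 := (hC (-1) (by simp)).trans_le h3
  have h2 : μ.real {(0:ℤ)} < 1 := (hC 0 (by simp)).trans_le h3
  have h4 : μ.real {(1:ℤ)} < 1 := (hC 1 (by simp)).trans_le h3
  have hs : μ.real {(-1:ℤ)} + (μ.real {(0:ℤ)} + μ.real {(1:ℤ)}) = 1 := by
    have h : μ.real ((({-1, 0, 1} : Finset ℤ) : Set ℤ)) = 1 := by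
      have h5 : μ.real (({-1, 0, 1} : Set ℤ)ᶜ) = 0 := by simp [Measure.real, hsupp]
      rw [probReal_compl_eq_one_sub MeasurableSet.of_discrete] at h5
      push_cast
      linarith
    rw [← sum_measureReal_singleton, Finset.sum_insert (by decide),
      Finset.sum_pair (by decide)] at h
    exact h
  have n1 : 0 ≤ μ.real {(-1:ℤ)} := measureReal_nonneg
  have n2 : 0 ≤ μ.real {(0:ℤ)} := measureReal_nonneg
  have n3 : 0 ≤ μ.real {(1:ℤ)} := measureReal_nonneg
  by_cases c1 : 0 < μ.real {(-1:ℤ)}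
  · by_cases c2 : 0 < μ.real {(0:ℤ)}
    · exact ⟨-1, 0, by decide, c1, c2⟩
    · exact ⟨-1, 1, by decide, c1, by linarith⟩
  · exact ⟨0, 1, by decide, by linarith, by linarith⟩

/-- Under condition (C), for distinct integers `a_1, …, a_N`, the concentration probability
`sup_m P(∑ ξ_j a_j = m)` is at most `C·N^{-3/2}`. -/
theorem sarkozy_szemeredi_anticoncentration (μ : MeasureTheory.Measure ℤ)
    [IsProbabilityMeasure μ]
    (hsupp : μ (({-1, 0, 1} : Set ℤ)ᶜ) = 0)
    (hC : ∀ x ∈ ({-1, 0, 1} : Set ℤ), (μ {x}).toReal < 1 / Real.sqrt 3) :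
    ∃ C > (0 : ℝ), ∀ N : ℕ, 1 ≤ N → ∀ a : Fin N → ℤ, Function.Injective a → ∀ m : ℤ,
      ((Measure.pi fun _ : Fin N => μ) {ξ | ∑ j : Fin N, ξ j * a j = m}).toReal
        ≤ C * (N : ℝ) ^ (-(3 : ℝ) / 2) := by
  obtain ⟨x, y, hxy, hx, hy⟩ := exists_atoms μ hsupp hC
  set κ := μ.real {x} * μ.real {y} / 2 with hκ
  have hκ0 : 0 < κ := by positivity
  set K := 9 * ∑' n : ℕ, ((n:ℝ)+1)^3 * Real.exp (-κ * n) with hK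
  have hK0 : 0 ≤ K := mul_nonneg (by norm_num) (tsum_nonneg fun n => by positivity)
  refine ⟨K + 1, by linarith, ?_⟩
  intro N hN a ha m
  obtain ⟨p, hp, hpp⟩ := Nat.exists_infinite_primes
    (N^2 + (∑ i, ∑ j, ((a i - a j) * (y - x)).natAbs) + 1)
  have : Fact p.Prime := ⟨hpp⟩
  have hb : Function.Injective (fun j => (a j : ZMod p) * ((y - x : ℤ) : ZMod p)) := by
    intro i j hij
    have h1 : (((a i - a j) * (y - x) : ℤ) : ZMod p) = 0 := by
      simp only at hij
      push_cast at hij ⊢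
      rw [sub_mul, hij, sub_self]
    rw [ZMod.intCast_zmod_eq_zero_iff_dvd] at h1
    have h2 : ((a i - a j) * (y - x)).natAbs < p := by
      have e1 := Finset.single_le_sum (f := fun j => ((a i - a j) * (y - x)).natAbs)
        (fun _ _ => Nat.zero_le _) (Finset.mem_univ j)
      have e2 := Finset.single_le_sum (f := fun i => ∑ j, ((a i - a j) * (y - x)).natAbs)
        (fun _ _ => Nat.zero_le _) (Finset.mem_univ i)
      omega
    have h3 : (a i - a j) * (y - x) = 0 := by
      apply Int.eq_zero_of_dvd_of_natAbs_lt_natAbs h1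
      simpa using h2
    rcases mul_eq_zero.1 h3 with h | h
    · exact ha (sub_eq_zero.1 h)
    · exact absurd (sub_eq_zero.1 h).symm hxy
  have h1 := prob_bound (p := p) μ x y hxy a m
  have h2 := sum_exp κ hκ0 _ hb hN (by omega)
  have h3 := h1.trans h2
  rw [← hK] at h3
  have hp0 : (0:ℝ) < p := by exact_mod_cast hpp.pos
  have hN0 : (0:ℝ) < N := by exact_mod_cast hN
  have hpow : (N : ℝ) ^ (-(3 : ℝ) / 2) = 1 / (Real.sqrt N)^3 := by
    rw [Real.sqrt_eq_rpow, ← Real.rpow_natCast, ← Real.rpow_mul hN0.le, one_div,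
      ← Real.rpow_neg hN0.le]
    norm_num
  have hs0 : 0 < Real.sqrt N := Real.sqrt_pos.2 hN0
  rw [hpow]
  change (Measure.pi fun _ : Fin N => μ).real {ξ | ∑ j : Fin N, ξ j * a j = m} ≤ _
  have h4 : (p:ℝ) * (Measure.pi fun _ : Fin N => μ).real {ξ | ∑ j : Fin N, ξ j * a j = m}
      ≤ p * (K * (1 / (Real.sqrt N)^3)) := h3.trans (le_of_eq (by ring))
  refine (le_of_mul_le_mul_left h4 hp0).trans ?_
  gcongr
  linarith
end

section
/- There exists an absolute constant C > 0 such that for every n ≥ 1 with n+1 divisible by 4, every p ∈ (0,1), and every θ = (θ₁,θ₂) ∈ D, one has |X̂(θ) − Ŷ(θ)| ≤ C·n^{−1/4}. -/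
open MeasureTheory

/-- The characteristic function `X̂(θ)` of `(P_n(-1), P_n'(-1))`, where the coefficients of
`P_n` are i.i.d. taking value `1` with probability `p` and `-1` with probability `1 - p`. -/
noncomputable def Xhat (n : ℕ) (p : ℝ) (θ : ℝ × ℝ) : ℂ :=
  ∏ j : Fin (n + 1),
    ((p : ℂ) * Complex.exp (2 * Real.pi * Complex.I *
        ((-1 : ℂ) ^ (j : ℕ) * (θ.1 : ℂ) + ((j : ℕ) : ℂ) * (-1 : ℂ) ^ ((j : ℕ) - 1) * (θ.2 : ℂ))) +
     ((1 - p : ℝ) : ℂ) * Complex.exp (-(2 * Real.pi * Complex.I *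
        ((-1 : ℂ) ^ (j : ℕ) * (θ.1 : ℂ) + ((j : ℕ) : ℂ) * (-1 : ℂ) ^ ((j : ℕ) - 1) * (θ.2 : ℂ)))))

/-- The quadratic form `θᵀ Σ θ` associated with the covariance matrix `Σ` of
`(P_n(-1), P_n'(-1))`: `Σ₁₁ = 4pq(n+1)`, `Σ₁₂ = Σ₂₁ = -2pq·n(n+1)`,
`Σ₂₂ = (2/3)pq·n(n+1)(2n+1)` with `q = 1 - p`. -/
noncomputable def quadFormSigma (n : ℕ) (p : ℝ) (θ : ℝ × ℝ) : ℝ :=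
  4 * p * (1 - p) * (n + 1) * θ.1 ^ 2 +
    2 * (-(2 * p * (1 - p) * n * (n + 1))) * θ.1 * θ.2 +
    (2 / 3) * p * (1 - p) * n * (n + 1) * (2 * n + 1) * θ.2 ^ 2

/-- The characteristic function `Ŷ(θ)` of the Gaussian vector with mean
`(0, (n+1)(2p-1)/2)` and covariance `Σ`. -/
noncomputable def Yhat (n : ℕ) (p : ℝ) (θ : ℝ × ℝ) : ℂ :=
  Complex.exp (2 * Real.pi * Complex.I * (θ.2 : ℂ) * ((n : ℂ) + 1) * (2 * (p : ℂ) - 1) / 2 -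
    2 * (Real.pi : ℂ) ^ 2 * (quadFormSigma n p θ : ℂ))

/-- The region `D = [-n^{-5/12}, n^{-5/12}] × [-n^{-17/12}, n^{-17/12}]`. -/
noncomputable def Dset (n : ℕ) : Set (ℝ × ℝ) :=
  Set.Icc (-(n : ℝ) ^ (-(5 : ℝ) / 12)) ((n : ℝ) ^ (-(5 : ℝ) / 12)) ×ˢ
    Set.Icc (-(n : ℝ) ^ (-(17 : ℝ) / 12)) ((n : ℝ) ^ (-(17 : ℝ) / 12))


lemma aux_prod (N : ℕ) (a b : ℕ → ℂ) (ε : ℝ) (ha : ∀ j, ‖a j‖ ≤ 1) (hb : ∀ j, ‖b j‖ ≤ 1)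
    (hab : ∀ j < N, ‖a j - b j‖ ≤ ε) :
    ‖∏ j ∈ Finset.range N, a j - ∏ j ∈ Finset.range N, b j‖ ≤ N * ε := by
  induction N with
  | zero => simp
  | succ k ih =>
    rw [Finset.prod_range_succ, Finset.prod_range_succ]
    have h1 := ih (fun j hj => hab j (by omega))
    have h2 := hab k (by omega)
    have hB : ‖∏ j ∈ Finset.range k, b j‖ ≤ 1 := by
      rw [norm_prod]
      exact Finset.prod_le_one (fun _ _ => norm_nonneg _) (fun j _ => hb j)
    set A := ∏ j ∈ Finset.range k, a j
    set B := ∏ j ∈ Finset.range k, b j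
    have e : A * a k - B * b k = (A - B) * a k + B * (a k - b k) := by ring
    rw [e]
    have h3 : ‖(A - B) * a k‖ ≤ ‖A - B‖ := by
      rw [norm_mul]; exact mul_le_of_le_one_right (norm_nonneg _) (ha k)
    have h4 : ‖B * (a k - b k)‖ ≤ ‖a k - b k‖ := by
      rw [norm_mul]; exact mul_le_of_le_one_left (norm_nonneg _) hB
    have := norm_add_le ((A - B) * a k) (B * (a k - b k))
    push_cast
    linarith

noncomputable def fa (p x : ℝ) : ℂ :=
  (p : ℂ) * Complex.exp (x * Complex.I) + ((1 - p : ℝ) : ℂ) * Complex.exp (-(x * Complex.I))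

noncomputable def fb (p x : ℝ) : ℂ :=
  Complex.exp (((2 * p - 1) * x : ℝ) * Complex.I + ((-(2 * p * (1 - p) * x ^ 2) : ℝ) : ℂ))

lemma fa_le (p x : ℝ) (h0 : 0 < p) (h1 : p < 1) : ‖fa p x‖ ≤ 1 := by
  unfold fa
  refine (norm_add_le _ _).trans ?_
  have e : (-(x * Complex.I) : ℂ) = ((-x : ℝ) : ℂ) * Complex.I := by push_cast; ring
  rw [e, norm_mul, norm_mul, Complex.norm_exp_ofReal_mul_I, Complex.norm_exp_ofReal_mul_I,
    Complex.norm_real, Complex.norm_real, Real.norm_of_nonneg h0.le,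
    Real.norm_of_nonneg (by linarith)]
  linarith

lemma fb_le (p x : ℝ) (h0 : 0 < p) (h1 : p < 1) : ‖fb p x‖ ≤ 1 := by
  unfold fb
  rw [Complex.exp_add, norm_mul, Complex.norm_exp_ofReal_mul_I, Complex.norm_exp_ofReal, one_mul]
  apply Real.exp_le_one_iff.2
  have : 0 ≤ p * (1 - p) := mul_nonneg h0.le (by linarith)
  nlinarith [mul_nonneg this (sq_nonneg x)]

lemma exp3 (z : ℂ) (r : ℝ) (hr : ‖z‖ ≤ r) (hr2 : r ≤ 2) :
    ‖Complex.exp z - (1 + z + z ^ 2 / 2)‖ ≤ 8 * r ^ 3 := by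
  have h := Complex.norm_exp_sub_sum_le_norm_mul_exp z 3
  simp only [Finset.sum_range_succ, Finset.sum_range_zero] at h
  norm_num [Nat.factorial] at h
  refine h.trans ?_
  have : Real.exp ‖z‖ ≤ 8 := by
    have h2 : Real.exp ‖z‖ ≤ Real.exp 2 := Real.exp_le_exp.2 (by linarith)
    have h3 : Real.exp 2 = Real.exp 1 * Real.exp 1 := by rw [← Real.exp_add]; norm_num
    have := Real.exp_one_lt_d9
    have := Real.exp_pos 1
    nlinarith
  have h3 : ‖z‖ ^ 3 ≤ r ^ 3 := pow_le_pow_left₀ (norm_nonneg _) hr 3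
  calc ‖z‖ ^ 3 * Real.exp ‖z‖ ≤ r ^ 3 * 8 :=
        mul_le_mul h3 this (Real.exp_pos _).le (le_trans (by positivity) h3)
    _ = _ := by ring

lemma fab (p x : ℝ) (h0 : 0 < p) (h1 : p < 1) : ‖fa p x - fb p x‖ ≤ 100 * |x| ^ 3 := by
  rcases le_total 1 |x| with hx | hx
  · have := norm_sub_le (fa p x) (fb p x)
    have := fa_le p x h0 h1
    have := fb_le p x h0 h1
    have : 1 ≤ |x| ^ 3 := one_le_pow₀ hx
    linarith
  have hx0 := abs_nonneg x
  have hpq : 0 ≤ p * (1 - p) := mul_nonneg h0.le (by linarith)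
  have hpq4 : p * (1 - p) ≤ 1 / 4 := by nlinarith [sq_nonneg (2 * p - 1)]
  have hm : |2 * p - 1| ≤ 1 := by rw [abs_le]; constructor <;> linarith
  have E1 := exp3 (x * Complex.I) |x| (by simp) (by linarith)
  have E2 := exp3 (-(x * Complex.I)) |x| (by simp) (by linarith)
  set z : ℂ := ((2 * p - 1) * x : ℝ) * Complex.I + ((-(2 * p * (1 - p) * x ^ 2) : ℝ) : ℂ) with hz
  have hx2 : x ^ 2 ≤ |x| := by rw [← sq_abs]; nlinarith
  have hzn : ‖z‖ ≤ 2 * |x| := by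
    refine (norm_add_le _ _).trans ?_
    rw [norm_mul, Complex.norm_I, Complex.norm_real, Complex.norm_real, Real.norm_eq_abs,
      Real.norm_eq_abs, abs_mul, abs_neg, abs_of_nonneg (a := 2 * p * (1 - p) * x ^ 2)
        (by nlinarith [mul_nonneg hpq (sq_nonneg x)])]
    nlinarith [mul_le_mul_of_nonneg_right hm hx0, mul_le_mul_of_nonneg_right hpq4 (sq_nonneg x)]
  have E3 := exp3 z (2 * |x|) hzn (by linarith)
  set R : ℂ := ((2 * p * (1 - p) * (2 * p - 1) * x ^ 3 : ℝ) : ℂ) * Complex.I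
    - ((2 * (p * (1 - p)) ^ 2 * x ^ 4 : ℝ) : ℂ) with hR
  have hRn : ‖R‖ ≤ |x| ^ 3 := by
    refine (norm_sub_le _ _).trans ?_
    rw [norm_mul, Complex.norm_I, Complex.norm_real, Complex.norm_real, Real.norm_eq_abs,
      Real.norm_eq_abs, abs_mul, abs_mul, abs_mul (2 * (p * (1 - p)) ^ 2), abs_pow, abs_pow]
    have a1 : |2 * p * (1 - p)| ≤ 1 / 2 := by rw [abs_le]; constructor <;> linarith
    have a2 : |2 * (p * (1 - p)) ^ 2| ≤ 1 / 2 := by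
      rw [abs_of_nonneg (by positivity)]; nlinarith
    have a3 : |x| ^ 4 ≤ |x| ^ 3 := pow_le_pow_of_le_one hx0 hx (by norm_num)
    have a4 : |2 * p * (1 - p)| * |2 * p - 1| ≤ 1 / 2 := by
      nlinarith [abs_nonneg (2 * p * (1 - p)), abs_nonneg (2 * p - 1)]
    have a5 := mul_le_mul_of_nonneg_right a4 (pow_nonneg hx0 3)
    have a6 := mul_le_mul a2 a3 (pow_nonneg hx0 4) (by norm_num)
    linarith
  have key : fa p x - fb p x =
      (p : ℂ) * (Complex.exp (x * Complex.I) - (1 + x * Complex.I + (x * Complex.I) ^ 2 / 2))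
      + ((1 - p : ℝ) : ℂ) * (Complex.exp (-(x * Complex.I)) -
          (1 + -(x * Complex.I) + (-(x * Complex.I)) ^ 2 / 2))
      + R - (Complex.exp z - (1 + z + z ^ 2 / 2)) := by
    unfold fa fb
    rw [← hz, hR]
    generalize Complex.exp z = w
    rw [hz]
    push_cast
    ring_nf
    simp only [Complex.I_sq]
    ring
  rw [key]
  set u := Complex.exp (x * Complex.I) - (1 + x * Complex.I + (x * Complex.I) ^ 2 / 2)
  set v := Complex.exp (-(x * Complex.I)) - (1 + -(x * Complex.I) + (-(x * Complex.I)) ^ 2 / 2)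
  set w := Complex.exp z - (1 + z + z ^ 2 / 2)
  have t1 := norm_sub_le ((p : ℂ) * u + ((1 - p : ℝ) : ℂ) * v + R) w
  have t2 := norm_add_le ((p : ℂ) * u + ((1 - p : ℝ) : ℂ) * v) R
  have t3 := norm_add_le ((p : ℂ) * u) (((1 - p : ℝ) : ℂ) * v)
  rw [norm_mul, norm_mul, Complex.norm_real, Complex.norm_real, Real.norm_of_nonneg h0.le,
    Real.norm_of_nonneg (by linarith)] at t3
  have t4 := mul_le_mul_of_nonneg_left E1 h0.le
  have t5 := mul_le_mul_of_nonneg_left E2 (by linarith : 0 ≤ 1 - p)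
  have t6 : (2 * |x|) ^ 3 = 8 * |x| ^ 3 := by ring
  rw [t6] at E3
  have := pow_nonneg hx0 3
  linarith

noncomputable def cc (θ : ℝ × ℝ) (j : ℕ) : ℝ :=
  (-1) ^ j * θ.1 + (j : ℝ) * (-1) ^ (j - 1) * θ.2

lemma cc_eq (θ : ℝ × ℝ) (j : ℕ) : cc θ j = (-1) ^ j * (θ.1 - j * θ.2) := by
  unfold cc
  cases j with
  | zero => simp
  | succ k => simp only [Nat.add_sub_cancel, pow_succ]; ring

lemma cc_sq (θ : ℝ × ℝ) (j : ℕ) : cc θ j ^ 2 = (θ.1 - j * θ.2) ^ 2 := by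
  rw [cc_eq, mul_pow, ← pow_mul, mul_comm j 2, pow_mul]; simp

lemma sum1 (θ : ℝ × ℝ) (k : ℕ) : ∑ j ∈ Finset.range (2 * k), cc θ j = k * θ.2 := by
  induction k with
  | zero => simp
  | succ k ih =>
    rw [show 2 * (k + 1) = 2 * k + 1 + 1 by ring, Finset.sum_range_succ, Finset.sum_range_succ, ih,
      cc_eq, cc_eq, pow_succ, pow_mul]
    push_cast
    norm_num
    ring

lemma sum2 (θ : ℝ × ℝ) (n : ℕ) : ∑ j ∈ Finset.range (n + 1), cc θ j ^ 2 =
    (n + 1) * θ.1 ^ 2 - n * (n + 1) * θ.1 * θ.2 + n * (n + 1) * (2 * n + 1) / 6 * θ.2 ^ 2 := by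
  induction n with
  | zero => simp [cc]
  | succ k ih =>
    rw [Finset.sum_range_succ, ih, cc_sq]
    push_cast
    ring

theorem Xhat_close_to_Yhat_on_D :
    ∃ C > (0 : ℝ), ∀ n : ℕ, 1 ≤ n → 4 ∣ n + 1 → ∀ p : ℝ, 0 < p → p < 1 →
      ∀ θ ∈ Dset n, ‖Xhat n p θ - Yhat n p θ‖ ≤ C * (n : ℝ) ^ (-(1 : ℝ) / 4) := by
  refine ⟨2 * (100 * 4096), by norm_num, ?_⟩
  intro n hn h4 p h0 h1 θ hθ
  have hX : Xhat n p θ = ∏ j ∈ Finset.range (n + 1), fa p (2 * Real.pi * cc θ j) := by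
    unfold Xhat
    rw [← Fin.prod_univ_eq_prod_range (fun j => fa p (2 * Real.pi * cc θ j))]
    refine Finset.prod_congr rfl fun j _ => ?_
    unfold fa cc
    push_cast
    congr 3 <;> ring_nf
  have hY : Yhat n p θ = ∏ j ∈ Finset.range (n + 1), fb p (2 * Real.pi * cc θ j) := by
    unfold Yhat fb
    rw [← Complex.exp_sum]
    congr 1
    have s2 := sum2 θ n
    obtain ⟨k, hk⟩ := h4
    have s1 := sum1 θ (2 * k)
    rw [show 2 * (2 * k) = n + 1 by omega] at s1
    have hk' : ((2 * k : ℕ) : ℝ) = ((n : ℝ) + 1) / 2 := by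
      have : ((n + 1 : ℕ) : ℝ) = (4 * k : ℕ) := by rw [hk]
      push_cast at this ⊢
      linarith
    rw [hk'] at s1
    rw [Finset.sum_add_distrib, ← Finset.sum_mul, ← Complex.ofReal_sum, ← Complex.ofReal_sum]
    have r1 : ∑ j ∈ Finset.range (n + 1), (2 * p - 1) * (2 * Real.pi * cc θ j)
        = (2 * p - 1) * (2 * Real.pi) * (((n : ℝ) + 1) / 2 * θ.2) := by
      rw [← s1, Finset.mul_sum]
      exact Finset.sum_congr rfl fun j _ => by ring
    have r2 : ∑ j ∈ Finset.range (n + 1), -(2 * p * (1 - p) * (2 * Real.pi * cc θ j) ^ 2)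
        = -(2 * Real.pi ^ 2 * quadFormSigma n p θ) := by
      have : -(2 * Real.pi ^ 2 * quadFormSigma n p θ) = -(8 * Real.pi ^ 2 * p * (1 - p)) *
          ∑ j ∈ Finset.range (n + 1), cc θ j ^ 2 := by
        rw [s2]; unfold quadFormSigma; ring
      rw [this, Finset.mul_sum]
      exact Finset.sum_congr rfl fun j _ => by ring
    rw [r1, r2]
    push_cast
    ring
  have hn0 : (0 : ℝ) < n := by exact_mod_cast hn
  have hn1 : (1 : ℝ) ≤ n := by exact_mod_cast hn
  set s : ℝ := (n : ℝ) ^ (-(5 : ℝ) / 12) with hs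
  have hs0 : 0 ≤ s := by positivity
  have hs17 : (n : ℝ) * (n : ℝ) ^ (-(17 : ℝ) / 12) = s := by
    rw [hs]; nth_rewrite 1 [← Real.rpow_one (n : ℝ)]
    rw [← Real.rpow_add hn0]; norm_num
  have hs3 : (n : ℝ) * s ^ 3 = (n : ℝ) ^ (-(1 : ℝ) / 4) := by
    rw [hs, ← Real.rpow_natCast, ← Real.rpow_mul hn0.le]
    nth_rewrite 1 [← Real.rpow_one (n : ℝ)]
    rw [← Real.rpow_add hn0]; norm_num
  have ht1 : |θ.1| ≤ s := abs_le.2 hθ.1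
  have ht2 : |θ.2| ≤ (n : ℝ) ^ (-(17 : ℝ) / 12) := abs_le.2 hθ.2
  have hb : ∀ j < n + 1, ‖fa p (2 * Real.pi * cc θ j) - fb p (2 * Real.pi * cc θ j)‖
      ≤ 100 * 4096 * s ^ 3 := by
    intro j hj
    refine (fab p _ h0 h1).trans ?_
    have hc : |cc θ j| ≤ 2 * s := by
      rw [cc_eq, abs_mul, abs_pow, abs_neg, abs_one, one_pow, one_mul]
      refine (abs_sub _ _).trans ?_
      have hjn : (j : ℝ) ≤ n := by exact_mod_cast (by omega : j ≤ n)
      have : |(j : ℝ) * θ.2| ≤ s := by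
        rw [abs_mul, abs_of_nonneg (Nat.cast_nonneg j), ← hs17]
        exact mul_le_mul hjn ht2 (abs_nonneg _) hn0.le
      linarith
    have hx : |2 * Real.pi * cc θ j| ≤ 16 * s := by
      rw [abs_mul, abs_of_nonneg (by positivity)]
      have := Real.pi_le_four
      have := mul_le_mul (by linarith : 2 * Real.pi ≤ 8) hc (abs_nonneg _) (by norm_num)
      linarith
    have := pow_le_pow_left₀ (abs_nonneg _) hx 3
    rw [mul_pow] at this
    norm_num at this
    norm_num
    linarith
  have := aux_prod (n + 1) _ _ _ (fun j => fa_le p (2 * Real.pi * cc θ j) h0 h1)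
    (fun j => fb_le p (2 * Real.pi * cc θ j) h0 h1) hb
  rw [hX, hY]
  refine this.trans ?_
  rw [← hs3]
  push_cast
  have : 0 ≤ s ^ 3 := by positivity
  nlinarith [mul_le_mul_of_nonneg_right hn1 this]
end

section
/- There exists an absolute constant C > 0 and, for every p ∈ (0,1), a constant c_p > 0 such that for every n ≥ 1 with n+1 divisible by 4 and every θ ∈ [−1/4, 1/4]² \ D, one has |X̂(θ)| ≤ C·exp(−c_p·n^{1/6}). -/
open MeasureTheory

lemma factor_bound (p b : ℝ) (hp : 0 < p) (hp1 : p < 1) :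
    ‖(p : ℂ) * Complex.exp ((b : ℂ) * Complex.I) +
      ((1 - p : ℝ) : ℂ) * Complex.exp (-((b : ℂ) * Complex.I))‖
      ≤ Real.exp (-(2 * (p * (1 - p)) * Real.sin b ^ 2)) := by
  have e : (p : ℂ) * Complex.exp ((b : ℂ) * Complex.I) +
      ((1 - p : ℝ) : ℂ) * Complex.exp (-((b : ℂ) * Complex.I)) =
      ((Real.cos b : ℝ) : ℂ) + (((2 * p - 1) * Real.sin b : ℝ) : ℂ) * Complex.I := by
    rw [← neg_mul, Complex.exp_mul_I, Complex.exp_mul_I, Complex.cos_neg, Complex.sin_neg]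
    push_cast
    ring
  rw [e]
  apply le_of_sq_le_sq _ (Real.exp_pos _).le
  rw [Complex.sq_norm, Complex.normSq_add_mul_I, ← Real.exp_nat_mul]
  refine le_trans (le_of_eq ?_) (Real.add_one_le_exp _)
  have := Real.sin_sq_add_cos_sq b
  push_cast
  linear_combination this

lemma sin_sq_sub (a b : ℝ) : Real.sin (a - b) ^ 2 ≤ 2 * (Real.sin a ^ 2 + Real.sin b ^ 2) := by
  rw [Real.sin_sub]
  have h1 := Real.sin_sq_add_cos_sq a
  have h2 := Real.sin_sq_add_cos_sq b
  have h3 : (Real.sin a * Real.cos b) ^ 2 ≤ Real.sin a ^ 2 := by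
    rw [mul_pow]; nlinarith [sq_nonneg (Real.sin a), sq_nonneg (Real.sin b)]
  have h4 : (Real.cos a * Real.sin b) ^ 2 ≤ Real.sin b ^ 2 := by
    rw [mul_pow]; nlinarith [sq_nonneg (Real.sin a), sq_nonneg (Real.sin b)]
  nlinarith [sq_nonneg (Real.sin a * Real.cos b + Real.cos a * Real.sin b)]

lemma sin_sq_lower (x : ℝ) (hx : |x| ≤ 1 / 2) : 4 * x ^ 2 ≤ Real.sin (Real.pi * x) ^ 2 := by
  have hpi := Real.pi_pos
  have h : |Real.pi * x| ≤ Real.pi / 2 := by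
    rw [abs_mul, abs_of_pos hpi]; nlinarith
  have := Real.mul_abs_le_abs_sin h
  rw [abs_mul, abs_of_pos hpi] at this
  have e : 2 / Real.pi * (Real.pi * |x|) = 2 * |x| := by field_simp
  rw [e] at this
  have h2 := pow_le_pow_left₀ (by positivity) this 2
  rw [sq_abs, mul_pow, sq_abs] at h2
  linarith

lemma shift_bound (N m : ℕ) (hm : m ≤ N) (a b : ℝ) :
    ((N : ℝ) - m) * Real.sin (Real.pi * (m * b)) ^ 2 ≤
      4 * ∑ j ∈ Finset.range N, Real.sin (Real.pi * (a - j * b)) ^ 2 := by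
  obtain ⟨k, rfl⟩ := Nat.exists_eq_add_of_le hm
  have h1 : ∑ j ∈ Finset.range k, Real.sin (Real.pi * (a - j * b)) ^ 2 ≤
      ∑ j ∈ Finset.range (m + k), Real.sin (Real.pi * (a - j * b)) ^ 2 := by
    apply Finset.sum_le_sum_of_subset_of_nonneg
    · intro x; simp; omega
    · intros; positivity
  have h2 : ∑ j ∈ Finset.range k, Real.sin (Real.pi * (a - (m + j : ℕ) * b)) ^ 2 ≤
      ∑ j ∈ Finset.range (m + k), Real.sin (Real.pi * (a - j * b)) ^ 2 := by
    rw [Finset.sum_range_add]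
    have : 0 ≤ ∑ j ∈ Finset.range m, Real.sin (Real.pi * (a - j * b)) ^ 2 :=
      Finset.sum_nonneg (fun _ _ => by positivity)
    linarith
  have h3 : ∑ j ∈ Finset.range k, Real.sin (Real.pi * (m * b)) ^ 2 ≤
      ∑ j ∈ Finset.range k, (2 * (Real.sin (Real.pi * (a - j * b)) ^ 2 +
        Real.sin (Real.pi * (a - (m + j : ℕ) * b)) ^ 2)) := by
    apply Finset.sum_le_sum
    intro j _
    refine le_trans (le_of_eq ?_) (sin_sq_sub _ _)
    congr 2
    push_cast
    ring
  rw [← Finset.mul_sum, Finset.sum_add_distrib, Finset.sum_const, Finset.card_range,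
    nsmul_eq_mul] at h3
  push_cast at *
  have : (m : ℝ) + k - m = k := by ring
  rw [this]
  linarith

lemma sum_lower (n : ℕ) (hn : 1 ≤ n) (h4 : 4 ∣ n + 1) (a b : ℝ) (ha : |a| ≤ 1 / 2)
    (hb : |b| ≤ 1 / 2) (d : ℝ) (hd : 0 < d) (hd1 : d ≤ 1)
    (h : 2 * d < |a| ∨ 2 * d < n * |b|) :
    n * d ^ 2 / 32 ≤ ∑ j ∈ Finset.range (n + 1), Real.sin (Real.pi * (a - j * b)) ^ 2 := by
  have hn0 : (1 : ℝ) ≤ n := by exact_mod_cast hn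
  have hd2 : d ^ 2 ≤ 1 := by nlinarith
  by_cases hB : 2 * d < n * |b|
  · have hbpos : 0 < |b| := by
      by_contra hc
      nlinarith [abs_nonneg b]
    by_cases hA : 1 ≤ (n + 1) * |b|
    · -- large second coordinate
      set m := ⌊1 / (2 * |b|)⌋₊ with hmdef
      have hm1 : (m : ℝ) ≤ 1 / (2 * |b|) := Nat.floor_le (by positivity)
      have hm2 : 1 / (2 * |b|) < m + 1 := Nat.lt_floor_add_one _
      have hm3 : 1 ≤ m := by
        rw [hmdef, Nat.one_le_floor_iff, le_div_iff₀ (by positivity)]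
        linarith
      have hm3' : (1 : ℝ) ≤ m := by exact_mod_cast hm3
      rw [le_div_iff₀ (by positivity)] at hm1
      rw [div_lt_iff₀ (by positivity)] at hm2
      have hmN : 2 * (m : ℝ) ≤ n + 1 := by
        by_contra hc
        push Not at hc
        nlinarith
      have hmN' : m ≤ n + 1 := by
        have : 2 * m ≤ n + 1 := by exact_mod_cast hmN
        omega
      have hs := shift_bound (n + 1) m hmN' a b
      have habs : |(m : ℝ) * b| = m * |b| := by rw [abs_mul, abs_of_nonneg (by positivity)]
      have hl := sin_sq_lower (m * b) (by rw [habs]; linarith)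
      have hq : (1 / 4 : ℝ) ≤ |(m : ℝ) * b| := by rw [habs]; nlinarith
      have hq2 : (1 / 16 : ℝ) ≤ ((m : ℝ) * b) ^ 2 := by
        rw [← sq_abs]; nlinarith
      push_cast at hs
      have : ((n : ℝ) + 1) / 2 * (1 / 4) ≤ ((n : ℝ) + 1 - m) * Real.sin (Real.pi * (m * b)) ^ 2 := by
        apply mul_le_mul <;> linarith
      nlinarith
    · push Not at hA
      obtain ⟨k, hk⟩ := h4
      have hkR : (n : ℝ) + 1 = 4 * k := by exact_mod_cast hk
      have hs := shift_bound (n + 1) (2 * k) (by omega) a b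
      have habs : |((2 * k : ℕ) : ℝ) * b| = (n + 1) / 2 * |b| := by
        rw [abs_mul, abs_of_nonneg (by positivity)]
        push_cast
        rw [hkR]; ring
      have hl := sin_sq_lower ((2 * k : ℕ) * b) (by rw [habs]; linarith)
      have hq : d ≤ |((2 * k : ℕ) : ℝ) * b| := by rw [habs]; nlinarith
      have hq2 : d ^ 2 ≤ (((2 * k : ℕ) : ℝ) * b) ^ 2 := by
        rw [← sq_abs (_ * b)]; exact pow_le_pow_left₀ hd.le hq 2
      have : ((n : ℝ) + 1) / 2 * (4 * d ^ 2) ≤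
          (((n + 1 : ℕ) : ℝ) - (2 * k : ℕ)) * Real.sin (Real.pi * ((2 * k : ℕ) * b)) ^ 2 := by
        apply mul_le_mul
        · push_cast; linarith
        · linarith
        · positivity
        · push_cast; linarith
      nlinarith [sq_nonneg d]
  · have hA : 2 * d < |a| := by tauto
    push Not at hB
    obtain ⟨k, hk⟩ := h4
    have hkR : (n : ℝ) + 1 = 4 * k := by exact_mod_cast hk
    have h1 : ∑ j ∈ Finset.range k, Real.sin (Real.pi * (a - j * b)) ^ 2 ≤
        ∑ j ∈ Finset.range (n + 1), Real.sin (Real.pi * (a - j * b)) ^ 2 := by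
      apply Finset.sum_le_sum_of_subset_of_nonneg
      · intro x; simp; omega
      · intros; positivity
    have h2 : ∑ j ∈ Finset.range k, d ^ 2 ≤
        ∑ j ∈ Finset.range k, Real.sin (Real.pi * (a - j * b)) ^ 2 := by
      apply Finset.sum_le_sum
      intro j hj
      have hj' : 4 * j ≤ n := by
        have := Finset.mem_range.mp hj
        omega
      have hjR : 4 * (j : ℝ) ≤ n := by exact_mod_cast hj'
      have e := sin_sq_sub (Real.pi * (a - j * b)) (-(Real.pi * (j * b)))
      rw [show Real.pi * (a - j * b) - -(Real.pi * (j * b)) = Real.pi * a by ring,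
        Real.sin_neg, neg_sq] at e
      have hl := sin_sq_lower a ha
      have ha2 : (2 * d) ^ 2 ≤ a ^ 2 := by
        rw [← sq_abs a]; exact pow_le_pow_left₀ (by positivity) hA.le 2
      have hu : |Real.sin (Real.pi * (j * b))| ≤ 2 * d := by
        refine le_trans Real.abs_sin_le_abs ?_
        rw [abs_mul, abs_mul, abs_of_pos Real.pi_pos, Nat.abs_cast]
        have h5 : (j : ℝ) * |b| ≤ d / 2 := by nlinarith [abs_nonneg b]
        nlinarith [Real.pi_le_four, Real.pi_pos]
      have hu2 : Real.sin (Real.pi * (j * b)) ^ 2 ≤ (2 * d) ^ 2 := by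
        rw [← sq_abs (Real.sin _)]; exact pow_le_pow_left₀ (abs_nonneg _) hu 2
      nlinarith
    rw [Finset.sum_const, Finset.card_range, nsmul_eq_mul] at h2
    nlinarith [sq_nonneg d]

/-- On `[-1/4, 1/4]² \ D`, the characteristic function `X̂` is exponentially small:
`|X̂(θ)| ≤ C·exp(-c_p·n^{1/6})`. -/
theorem Xhat_small_off_D :
    ∃ C > (0 : ℝ), ∀ p : ℝ, 0 < p → p < 1 → ∃ c > (0 : ℝ),
      ∀ n : ℕ, 1 ≤ n → 4 ∣ n + 1 →
        ∀ θ ∈ (Set.Icc (-(1 : ℝ) / 4) (1 / 4) ×ˢ Set.Icc (-(1 : ℝ) / 4) (1 / 4)) \ Dset n,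
          ‖Xhat n p θ‖ ≤ C * Real.exp (-c * (n : ℝ) ^ ((1 : ℝ) / 6)) := by
  refine ⟨1, one_pos, fun p hp hp1 => ⟨p * (1 - p) / 16, ?_, ?_⟩⟩
  · have : 0 < 1 - p := by linarith
    positivity
  intro n hn h4 θ hθ
  have hpq : 0 < p * (1 - p) := mul_pos hp (by linarith)
  have hn0 : (1 : ℝ) ≤ n := by exact_mod_cast hn
  have hnp : (0 : ℝ) < n := by linarith
  obtain ⟨⟨⟨ha1, ha2⟩, ⟨hb1, hb2⟩⟩, hD⟩ := hθ
  set d : ℝ := (n : ℝ) ^ (-(5 : ℝ) / 12) with hd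
  have hdpos : 0 < d := by positivity
  have hd1 : d ≤ 1 := Real.rpow_le_one_of_one_le_of_nonpos hn0 (by norm_num)
  have e1 : (n : ℝ) * (n : ℝ) ^ (-(17 : ℝ) / 12) = d := by
    rw [hd, ← Real.rpow_one_add' hnp.le (by norm_num)]
    norm_num
  have e2 : (n : ℝ) * d ^ 2 = (n : ℝ) ^ ((1 : ℝ) / 6) := by
    rw [hd, ← Real.rpow_natCast, ← Real.rpow_mul hnp.le,
      ← Real.rpow_one_add' hnp.le (by norm_num)]
    norm_num
  have hS := sum_lower n hn h4 (2 * θ.1) (2 * θ.2) (by rw [abs_le]; constructor <;> linarith)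
    (by rw [abs_le]; constructor <;> linarith) d hdpos hd1 (by
      by_contra hc
      push Not at hc
      obtain ⟨hc1, hc2⟩ := hc
      rw [abs_mul, abs_two] at hc1 hc2
      apply hD
      refine ⟨abs_le.mp (by linarith), abs_le.mp ?_⟩
      have : (n : ℝ) * |θ.2| ≤ n * (n : ℝ) ^ (-(17 : ℝ) / 12) := by rw [e1]; linarith
      exact le_of_mul_le_mul_left this hnp)
  rw [e2] at hS
  have hX : ‖Xhat n p θ‖ ≤ ∏ j : Fin (n + 1), Real.exp (-(2 * (p * (1 - p)) *
      Real.sin (Real.pi * (2 * θ.1 - (j : ℕ) * (2 * θ.2))) ^ 2)) := by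
    unfold Xhat
    rw [norm_prod]
    apply Finset.prod_le_prod
    · intros; positivity
    · rintro ⟨j, hj⟩ _
      simp only
      set x := Real.pi * (2 * θ.1 - (j : ℕ) * (2 * θ.2)) with hx
      have key : ∃ s : ℝ, (s = 1 ∨ s = -1) ∧ 2 * Real.pi * Complex.I *
          ((-1 : ℂ) ^ j * (θ.1 : ℂ) + (j : ℂ) * (-1 : ℂ) ^ (j - 1) * (θ.2 : ℂ)) =
          ((s * x : ℝ) : ℂ) * Complex.I := by
        refine ⟨(-1) ^ j, neg_one_pow_eq_or ℝ j, ?_⟩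
        rw [hx]
        rcases j with _ | j
        · push_cast; ring
        · rw [Nat.add_sub_cancel]; push_cast; ring
      obtain ⟨s, hs, hk⟩ := key
      rw [hk]
      refine (factor_bound p (s * x) hp hp1).trans (le_of_eq ?_)
      rcases hs with rfl | rfl <;> simp
  refine hX.trans ?_
  rw [← Real.exp_sum, one_mul, Real.exp_le_exp, Finset.sum_neg_distrib, ← Finset.mul_sum,
    Fin.sum_univ_eq_sum_range
      (fun j => Real.sin (Real.pi * (2 * θ.1 - (j : ℕ) * (2 * θ.2))) ^ 2) (n + 1)]
  nlinarith
end

section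
/- For every p ∈ (0,1) there exist constants C_p, c_p > 0 such that for every n ≥ 1 with n+1 divisible by 4, the integral of |Ŷ(θ)| over ℝ² \ D is at most C_p·exp(−c_p·n^{1/6}). -/
open MeasureTheory

lemma quad_lower (n : ℕ) (p : ℝ) (hp : 0 < p) (hp1 : p < 1) (hn : 1 ≤ n) (θ : ℝ × ℝ) :
    p * (1 - p) / 4 * (n * θ.1 ^ 2 + n ^ 3 * θ.2 ^ 2) ≤ quadFormSigma n p θ := by
  obtain ⟨x, y⟩ := θ
  have ha : 0 < p * (1 - p) := mul_pos hp (by linarith)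
  have hn' : (1 : ℝ) ≤ n := by exact_mod_cast hn
  unfold quadFormSigma
  simp only
  have h1 : 0 ≤ x ^ 2 - x * (n * y) + (n * y) ^ 2 / 3 - (x ^ 2 + (n * y) ^ 2) / 16 := by
    nlinarith [sq_nonneg (x - 8 / 15 * (n * y)), sq_nonneg (n * y)]
  have h2 : 0 ≤ (x ^ 2 + (n * y) ^ 2) := by positivity
  have h3 : 0 ≤ n * y ^ 2 := by positivity
  have h4 : 4 * p * (1 - p) * (n + 1) * x ^ 2 +
    2 * (-(2 * p * (1 - p) * n * (n + 1))) * x * y +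
    (2 / 3) * p * (1 - p) * n * (n + 1) * (2 * n + 1) * y ^ 2
    - p * (1 - p) / 4 * (n * x ^ 2 + n ^ 3 * y ^ 2)
    = p * (1 - p) * (4 * (n + 1) * (x ^ 2 - x * (n * y) + (n * y) ^ 2 / 3 - (x ^ 2 + (n * y) ^ 2) / 16)
      + (x ^ 2 + (n * y) ^ 2) / 4 + 2 / 3 * (n + 1) * (n * y ^ 2)) := by ring
  have h5 : 0 ≤ p * (1 - p) * (4 * ((n : ℝ) + 1) * (x ^ 2 - x * (n * y) + (n * y) ^ 2 / 3 - (x ^ 2 + (n * y) ^ 2) / 16)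
      + (x ^ 2 + (n * y) ^ 2) / 4 + 2 / 3 * (n + 1) * (n * y ^ 2)) := by positivity
  linarith

lemma off_D (n : ℕ) (hn : 1 ≤ n) (θ : ℝ × ℝ) (h : θ ∈ (Dset n)ᶜ) :
    (n : ℝ) ^ ((1 : ℝ) / 6) ≤ n * θ.1 ^ 2 + n ^ 3 * θ.2 ^ 2 := by
  obtain ⟨x, y⟩ := θ
  have hn' : (0 : ℝ) < n := by exact_mod_cast hn
  have e1 : (n : ℝ) ^ ((1 : ℝ) / 6) = n * ((n : ℝ) ^ (-(5 : ℝ) / 12)) ^ 2 := by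
    rw [← Real.rpow_natCast, ← Real.rpow_mul hn'.le]
    nth_rewrite 2 [← Real.rpow_one (n : ℝ)]
    rw [← Real.rpow_add hn']; norm_num
  have e2 : (n : ℝ) ^ ((1 : ℝ) / 6) = n ^ 3 * ((n : ℝ) ^ (-(17 : ℝ) / 12)) ^ 2 := by
    rw [← Real.rpow_natCast (_ ^ _), ← Real.rpow_mul hn'.le, ← Real.rpow_natCast,
      ← Real.rpow_add hn']; norm_num
  have hx : 0 ≤ n * x ^ 2 := by positivity
  have hy : 0 ≤ n ^ 3 * y ^ 2 := by positivity
  simp only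
  by_cases h1 : |x| ≤ (n : ℝ) ^ (-(5 : ℝ) / 12)
  · have h2 : ¬ |y| ≤ (n : ℝ) ^ (-(17 : ℝ) / 12) := by
      intro h2
      exact h ⟨abs_le.mp h1, abs_le.mp h2⟩
    have : ((n : ℝ) ^ (-(17 : ℝ) / 12)) ^ 2 ≤ y ^ 2 := by
      rw [← sq_abs y]
      exact pow_le_pow_left₀ (by positivity) (not_le.mp h2).le 2
    have := mul_le_mul_of_nonneg_left this (by positivity : (0 : ℝ) ≤ n ^ 3)
    linarith
  · have : ((n : ℝ) ^ (-(5 : ℝ) / 12)) ^ 2 ≤ x ^ 2 := by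
      rw [← sq_abs x]
      exact pow_le_pow_left₀ (by positivity) (not_le.mp h1).le 2
    have := mul_le_mul_of_nonneg_left this hn'.le
    linarith

lemma norm_Yhat (n : ℕ) (p : ℝ) (θ : ℝ × ℝ) :
    ‖Yhat n p θ‖ = Real.exp (-(2 * Real.pi ^ 2 * quadFormSigma n p θ)) := by
  unfold Yhat
  rw [Complex.norm_exp]
  congr 1
  have : (2 * Real.pi * Complex.I * (θ.2 : ℂ) * ((n : ℂ) + 1) * (2 * (p : ℂ) - 1) / 2 -
    2 * (Real.pi : ℂ) ^ 2 * (quadFormSigma n p θ : ℂ))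
    = ((-(2 * Real.pi ^ 2 * quadFormSigma n p θ) : ℝ) : ℂ)
      + ((Real.pi * θ.2 * (n + 1) * (2 * p - 1) : ℝ) : ℂ) * Complex.I := by
    push_cast; ring
  rw [this]
  simp only [Complex.add_re, Complex.ofReal_re, Complex.re_ofReal_mul, Complex.I_re, mul_zero, add_zero]

/-- The integral of `|Ŷ|` over the complement of `D` is exponentially small:
`∫_{ℝ² \ D} |Ŷ(θ)| dθ ≤ C_p·exp(-c_p·n^{1/6})`. -/
theorem Yhat_integral_off_D_small :
    ∀ p : ℝ, 0 < p → p < 1 → ∃ C > (0 : ℝ), ∃ c > (0 : ℝ),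
      ∀ n : ℕ, 1 ≤ n → 4 ∣ n + 1 →
        (∫ θ in (Dset n)ᶜ, ‖Yhat n p θ‖) ≤ C * Real.exp (-c * (n : ℝ) ^ ((1 : ℝ) / 6)) := by
  intro p hp hp1
  have ha : 0 < p * (1 - p) := mul_pos hp (by linarith)
  set a := p * (1 - p) with ha_def
  let g : ℝ × ℝ → ℝ := fun θ => Real.exp (-a * θ.1 ^ 2) * Real.exp (-a * θ.2 ^ 2)
  have hg : Integrable g :=
    (integrable_exp_neg_mul_sq ha).mul_prod (integrable_exp_neg_mul_sq ha)
  have hg0 : ∀ θ, 0 ≤ g θ := fun θ => by positivity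
  have hI : 0 ≤ ∫ θ, g θ := integral_nonneg hg0
  refine ⟨(∫ θ, g θ) + 1, by linarith, a, ha, ?_⟩
  intro n hn _
  have hn' : (1 : ℝ) ≤ n := by exact_mod_cast hn
  set E := Real.exp (-a * (n : ℝ) ^ ((1 : ℝ) / 6)) with hE
  have hE0 : 0 < E := Real.exp_pos _
  have hm : MeasurableSet (Dset n)ᶜ := (measurableSet_Icc.prod measurableSet_Icc).compl
  have key : ∀ θ ∈ (Dset n)ᶜ, ‖Yhat n p θ‖ ≤ g θ * E := by
    intro θ hθ
    rw [norm_Yhat]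
    simp only [g, hE]
    rw [← Real.exp_add, ← Real.exp_add]
    apply Real.exp_le_exp.mpr
    have h1 := quad_lower n p hp hp1 hn θ
    rw [← ha_def] at h1
    have h2 := off_D n hn θ hθ
    have hn3 : (1 : ℝ) ≤ n ^ 3 := one_le_pow₀ hn'
    have h3 : θ.1 ^ 2 + θ.2 ^ 2 ≤ n * θ.1 ^ 2 + n ^ 3 * θ.2 ^ 2 := by
      nlinarith [sq_nonneg θ.1, sq_nonneg θ.2]
    set S := n * θ.1 ^ 2 + n ^ 3 * θ.2 ^ 2 with hS
    have hS0 : 0 ≤ S := by positivity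
    have hpi : (8 : ℝ) ≤ 2 * Real.pi ^ 2 := by nlinarith [Real.pi_gt_three]
    have h4 : 8 * (a / 4 * S) ≤ 2 * Real.pi ^ 2 * quadFormSigma n p θ :=
      mul_le_mul hpi h1 (by positivity) (by positivity)
    have h5 := mul_le_mul_of_nonneg_left h2 ha.le
    have h6 := mul_le_mul_of_nonneg_left h3 ha.le
    linarith
  have hgE : Integrable (fun θ => g θ * E) := hg.mul_const E
  calc (∫ θ in (Dset n)ᶜ, ‖Yhat n p θ‖) ≤ ∫ θ in (Dset n)ᶜ, g θ * E := by
        apply integral_mono_of_nonneg (Filter.Eventually.of_forall fun _ => norm_nonneg _)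
          hgE.integrableOn
        exact (ae_restrict_iff' hm).mpr (Filter.Eventually.of_forall key)
    _ ≤ ∫ θ, g θ * E := setIntegral_le_integral hgE
        (Filter.Eventually.of_forall fun θ => mul_nonneg (hg0 θ) hE0.le)
    _ = (∫ θ, g θ) * E := integral_mul_const _ _
    _ ≤ _ := by nlinarith
end

section
/- Assume condition (C) and μ({0}) = 0. Then as n → ∞ along integers n for which n+1 is divisible by 4, n² · P( P_n(−1) = 0 and P_n'(−1) = 0 ) → 4√3 / (π·Var(ξ_0)); that is, the probability that −1 is a double root of P_n equals 4√3/(π·Var(ξ_0)·n²) + o(n^{−2}) along this subsequence. -/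
open Filter MeasureTheory

/-- The mean `E(ξ₀)` of a coefficient with distribution `μ`. -/
noncomputable def coeffMean (μ : MeasureTheory.Measure ℤ) : ℝ :=
  ∫ x, (x : ℝ) ∂μ

/-- The variance `Var(ξ₀)` of a coefficient with distribution `μ`. -/
noncomputable def coeffVar (μ : MeasureTheory.Measure ℤ) : ℝ :=
  ∫ x, ((x : ℝ) - coeffMean μ) ^ 2 ∂μ

lemma aux_pair (m k : ℕ) (hk : k ≤ 2 * m) (s t : ℝ) :
    (m : ℝ) / 2 * Real.sin (k * t) ^ 2 ≤ ∑ j ∈ Finset.range (4 * m), Real.sin (s + j * t) ^ 2 := by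
  set Q := ∑ j ∈ Finset.range (4 * m), Real.sin (s + j * t) ^ 2 with hQ
  have h1 : ∑ j ∈ Finset.range (2 * m), Real.sin (s + j * t) ^ 2 ≤ Q := by
    apply Finset.sum_le_sum_of_subset_of_nonneg
    · intro x; simp; omega
    · intros; positivity
  have h2 : ∑ j ∈ Finset.range (2 * m), Real.sin (s + ((k + j : ℕ) : ℝ) * t) ^ 2 ≤ Q := by
    have := Finset.sum_Ico_eq_sum_range (fun j : ℕ => Real.sin (s + j * t) ^ 2) k (k + 2 * m)
    rw [show k + 2 * m - k = 2 * m by omega] at this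
    rw [← this]
    apply Finset.sum_le_sum_of_subset_of_nonneg
    · intro x; simp; omega
    · intros; positivity
  have h3 : ∑ j ∈ Finset.range (2 * m), Real.sin (k * t) ^ 2 / 2 ≤
      ∑ j ∈ Finset.range (2 * m), (Real.sin (s + j * t) ^ 2 +
        Real.sin (s + ((k + j : ℕ) : ℝ) * t) ^ 2) := by
    apply Finset.sum_le_sum
    intro j _
    have e : (k : ℝ) * t = (s + ((k + j : ℕ) : ℝ) * t) - (s + j * t) := by push_cast; ring
    rw [e, Real.sin_sub]
    set a := s + ((k + j : ℕ) : ℝ) * t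
    set b := s + (j : ℝ) * t
    have ha := Real.sin_sq_add_cos_sq a
    have hb := Real.sin_sq_add_cos_sq b
    have h5 : (Real.sin a * Real.cos b - Real.cos a * Real.sin b) ^ 2 ≤
      2 * ((Real.sin a * Real.cos b) ^ 2 + (Real.cos a * Real.sin b) ^ 2) := by
      nlinarith [sq_nonneg (Real.sin a * Real.cos b + Real.cos a * Real.sin b)]
    have h6 : (Real.sin a * Real.cos b) ^ 2 ≤ Real.sin a ^ 2 := by
      rw [mul_pow]; nlinarith [sq_nonneg (Real.sin a), sq_nonneg (Real.sin b), mul_nonneg (sq_nonneg (Real.sin a)) (sq_nonneg (Real.sin b))]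
    have h7 : (Real.cos a * Real.sin b) ^ 2 ≤ Real.sin b ^ 2 := by
      rw [mul_pow]; nlinarith [sq_nonneg (Real.sin a), sq_nonneg (Real.sin b), mul_nonneg (sq_nonneg (Real.sin a)) (sq_nonneg (Real.sin b))]
    linarith
  rw [Finset.sum_add_distrib, Finset.sum_const, Finset.card_range, nsmul_eq_mul] at h3
  push_cast at h3 h2
  linarith

lemma aux_sin_lower (x : ℝ) (hx : |x| ≤ Real.pi / 2) : x ^ 2 / 4 ≤ Real.sin x ^ 2 := by
  have h := Real.mul_abs_le_abs_sin hx
  have h1 : |x| / 2 ≤ |Real.sin x| := by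
    refine le_trans ?_ h
    have : 1 / 2 ≤ 2 / Real.pi := by
      rw [div_le_div_iff₀ (by norm_num) Real.pi_pos]; linarith [Real.pi_le_four]
    nlinarith [abs_nonneg x]
  have h2 := pow_le_pow_left₀ (by positivity) h1 2
  rw [div_pow, sq_abs, sq_abs] at h2
  linarith

lemma aux_Q (m : ℕ) (hm : 1 ≤ m) (s t : ℝ) (hs : |s| ≤ Real.pi / 2) (ht : |t| ≤ Real.pi / 2) :
    min (m : ℝ) (m * s ^ 2 + m ^ 3 * t ^ 2) / 260 ≤
      ∑ j ∈ Finset.range (4 * m), Real.sin (s + j * t) ^ 2 := by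
  set Q := ∑ j ∈ Finset.range (4 * m), Real.sin (s + j * t) ^ 2 with hQ
  have hm' : (1 : ℝ) ≤ m := by exact_mod_cast hm
  by_cases hc : 2 * m * |t| ≤ Real.pi / 2
  · have h1 := aux_pair m (2 * m) le_rfl s t
    have h2 := aux_sin_lower (((2 * m : ℕ) : ℝ) * t) (by
      rw [abs_mul, abs_of_nonneg (by positivity)]; push_cast; exact hc)
    rw [← hQ] at h1
    have h3 : (m : ℝ) ^ 3 * t ^ 2 / 2 ≤ Q := by
      refine le_trans ?_ h1
      calc (m : ℝ) ^ 3 * t ^ 2 / 2 = m / 2 * ((((2 * m : ℕ) : ℝ) * t) ^ 2 / 4) := by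
            push_cast; ring
        _ ≤ _ := by gcongr
    have h4 : ∑ j ∈ Finset.range (4 * m), Real.sin s ^ 2 ≤
        ∑ j ∈ Finset.range (4 * m), (2 * Real.sin (s + j * t) ^ 2 + 32 * m ^ 2 * t ^ 2) := by
      apply Finset.sum_le_sum
      intro j hj
      have hj' : (j : ℝ) ≤ 4 * m := by
        have := Finset.mem_range.mp hj
        exact_mod_cast this.le
      have e : s = (s + j * t) - j * t := by ring
      have hb : Real.sin (j * t) ^ 2 ≤ (j * t) ^ 2 := Real.sin_sq_le_sq
      have hb2 : ((j : ℝ) * t) ^ 2 ≤ 16 * m ^ 2 * t ^ 2 := by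
        rw [mul_pow]
        have : (j : ℝ) ^ 2 ≤ (4 * m) ^ 2 := by gcongr
        nlinarith [sq_nonneg t]
      have key : Real.sin s ^ 2 ≤ 2 * Real.sin (s + j * t) ^ 2 + 2 * Real.sin (j * t) ^ 2 := by
        conv_lhs => rw [e, Real.sin_sub]
        set a := s + (j : ℝ) * t
        set b := (j : ℝ) * t
        have ha := Real.sin_sq_add_cos_sq a
        have hb := Real.sin_sq_add_cos_sq b
        have h5 : (Real.sin a * Real.cos b - Real.cos a * Real.sin b) ^ 2 ≤
          2 * ((Real.sin a * Real.cos b) ^ 2 + (Real.cos a * Real.sin b) ^ 2) := by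
          nlinarith [sq_nonneg (Real.sin a * Real.cos b + Real.cos a * Real.sin b)]
        have h6 : (Real.sin a * Real.cos b) ^ 2 ≤ Real.sin a ^ 2 := by
          rw [mul_pow]; nlinarith [sq_nonneg (Real.sin a), sq_nonneg (Real.sin b), mul_nonneg (sq_nonneg (Real.sin a)) (sq_nonneg (Real.sin b))]
        have h7 : (Real.cos a * Real.sin b) ^ 2 ≤ Real.sin b ^ 2 := by
          rw [mul_pow]; nlinarith [sq_nonneg (Real.sin a), sq_nonneg (Real.sin b), mul_nonneg (sq_nonneg (Real.sin a)) (sq_nonneg (Real.sin b))]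
        linarith
      linarith
    rw [Finset.sum_add_distrib, ← Finset.mul_sum, Finset.sum_const, Finset.sum_const,
      Finset.card_range, nsmul_eq_mul, nsmul_eq_mul, ← hQ] at h4
    push_cast at h4
    have h5 := aux_sin_lower s hs
    have h6 : (m : ℝ) * s ^ 2 ≤ 4 * m * Real.sin s ^ 2 := by nlinarith
    have h7 := min_le_right (m : ℝ) (m * s ^ 2 + m ^ 3 * t ^ 2)
    have h8 : 4 * (m : ℝ) * (32 * m ^ 2 * t ^ 2) = 128 * (m ^ 3 * t ^ 2) := by ring
    linarith
  · push Not at hc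
    have ht0 : 0 < |t| := by
      by_contra h
      have : |t| = 0 := le_antisymm (not_lt.mp h) (abs_nonneg t)
      rw [this] at hc
      linarith [Real.pi_pos]
    set k := ⌈Real.pi / (4 * |t|)⌉₊ with hk
    have hk1 : Real.pi / (4 * |t|) ≤ k := Nat.le_ceil _
    have hk2 : (k : ℝ) < Real.pi / (4 * |t|) + 1 := Nat.ceil_lt_add_one (by positivity)
    have hk3 : Real.pi / 4 ≤ k * |t| := by
      rw [div_le_iff₀ (by positivity)] at hk1; linarith
    have hk4 : k * |t| ≤ Real.pi / 4 + |t| := by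
      have : Real.pi / (4 * |t|) * |t| = Real.pi / 4 := by field_simp
      nlinarith
    have hkm : k ≤ 2 * m := by
      have : Real.pi / (4 * |t|) ≤ m := by
        rw [div_le_iff₀ (by positivity)]; linarith
      have : k ≤ m := Nat.ceil_le.mpr this
      omega
    have h1 := aux_pair m k hkm s t
    rw [← hQ] at h1
    have h2 : 1 / 2 ≤ Real.sin (k * t) ^ 2 := by
      have e : Real.sin (k * t) ^ 2 = Real.sin (k * |t|) ^ 2 := by
        rcases abs_choice t with h | h <;> rw [h]
        rw [mul_neg, Real.sin_neg, neg_sq]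
      rw [e, Real.sin_sq_eq_half_sub]
      have : Real.cos (2 * (k * |t|)) ≤ 0 :=
        Real.cos_nonpos_of_pi_div_two_le_of_le (by linarith) (by linarith)
      linarith
    have h7 := min_le_left (m : ℝ) (m * s ^ 2 + m ^ 3 * t ^ 2)
    nlinarith

noncomputable def auxPhi (p q x : ℝ) : ℂ :=
  (p : ℂ) * Complex.exp (Complex.I * x) + (q : ℂ) * Complex.exp (-(Complex.I * x))

lemma auxPhi_norm_sq (p q x : ℝ) (hpq : p + q = 1) :
    ‖auxPhi p q x‖ ^ 2 = 1 - 4 * p * q * Real.sin x ^ 2 := by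
  have e : auxPhi p q x = ((Real.cos x : ℝ) : ℂ) + (((p - q) * Real.sin x : ℝ) : ℂ) * Complex.I := by
    unfold auxPhi
    rw [show -(Complex.I * (x : ℂ)) = ((-x : ℝ) : ℂ) * Complex.I by push_cast; ring, mul_comm Complex.I,
      Complex.exp_mul_I, Complex.exp_mul_I]
    push_cast
    rw [Complex.cos_neg, Complex.sin_neg]
    have : (p : ℂ) + q = 1 := by exact_mod_cast hpq
    linear_combination Complex.cos x * this
  rw [e, Complex.sq_norm, Complex.normSq_add_mul_I]
  have hq : q = 1 - p := by linarith
  have := Real.sin_sq_add_cos_sq x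
  rw [hq]
  linear_combination this

lemma auxPhi_norm_le (p q x : ℝ) (hpq : p + q = 1) :
    ‖auxPhi p q x‖ ≤ Real.exp (-(2 * p * q * Real.sin x ^ 2)) := by
  have h := auxPhi_norm_sq p q x hpq
  have h1 : ‖auxPhi p q x‖ ^ 2 ≤ Real.exp (-(2 * p * q * Real.sin x ^ 2)) ^ 2 := by
    rw [h, ← Real.exp_nat_mul]
    have := Real.add_one_le_exp (-(4 * p * q * Real.sin x ^ 2))
    have e : ((2 : ℕ) : ℝ) * -(2 * p * q * Real.sin x ^ 2) = -(4 * p * q * Real.sin x ^ 2) := by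
      push_cast; ring
    rw [e]; linarith
  exact le_of_sq_le_sq h1 (Real.exp_pos _).le

lemma aux_prod_bound (p q : ℝ) (hp : 0 < p) (hq : 0 < q) (hpq : p + q = 1) :
    ∃ K : ℝ, ∀ (m : ℕ), 1 ≤ m → ∀ u v r : ℝ, 0 < r → r ^ 2 = 4 * m → |u| ≤ Real.pi / 2 * r →
      |v| ≤ Real.pi / 2 * r ^ 3 →
      ‖∏ j ∈ Finset.range (4 * m), auxPhi p q ((-1) ^ j * (u / r + j * (v / r ^ 3)))‖ ≤
        K * ((1 + u ^ 2)⁻¹ * (1 + v ^ 2)⁻¹) := by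
  set κ : ℝ := 2 * p * q / 16640 with hκ
  have hκ0 : 0 < κ := by positivity
  refine ⟨16 * (24 * Real.exp κ / κ ^ 4), ?_⟩
  intro m hm u v r hr hr2 hu hv
  have hm' : (1 : ℝ) ≤ m := by exact_mod_cast hm
  set s := u / r with hs
  set t := v / r ^ 3 with ht
  have hs1 : |s| ≤ Real.pi / 2 := by
    rw [hs, abs_div, abs_of_pos hr, div_le_iff₀ hr]; exact hu
  have ht1 : |t| ≤ Real.pi / 2 := by
    rw [ht, abs_div, abs_of_pos (pow_pos hr 3), div_le_iff₀ (pow_pos hr 3)]; exact hv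
  have hQ := aux_Q m hm s t hs1 ht1
  set Q := ∑ j ∈ Finset.range (4 * m), Real.sin (s + j * t) ^ 2 with hQd
  have h1 : ‖∏ j ∈ Finset.range (4 * m), auxPhi p q ((-1) ^ j * (s + j * t))‖ ≤
      Real.exp (-(2 * p * q * Q)) := by
    rw [norm_prod, hQd, Finset.mul_sum, ← Finset.sum_neg_distrib, Real.exp_sum]
    apply Finset.prod_le_prod
    · intros; positivity
    · intro j _
      refine (auxPhi_norm_le p q _ hpq).trans (le_of_eq ?_)
      have hsin : Real.sin ((-1) ^ j * (s + j * t)) ^ 2 = Real.sin (s + j * t) ^ 2 := by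
        rcases neg_one_pow_eq_or ℝ j with h | h <;> rw [h]
        · rw [one_mul]
        · rw [neg_one_mul, Real.sin_neg, neg_sq]
      rw [hsin]
  refine h1.trans ?_
  have es : m * s ^ 2 = u ^ 2 / 4 := by
    rw [hs, div_pow, hr2]; field_simp
  have et : m ^ 3 * t ^ 2 = v ^ 2 / 64 := by
    rw [ht, div_pow, show (r ^ 3) ^ 2 = (r ^ 2) ^ 3 by ring, hr2]; field_simp; norm_num
  rw [es, et] at hQ
  set M := min (4 * (m : ℝ)) (u ^ 2 + v ^ 2) with hM
  have hM0 : 0 ≤ M := le_min (by positivity) (by positivity)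
  have hMQ : M / 16640 ≤ Q := by
    refine le_trans ?_ hQ
    have : M / 64 ≤ min (m : ℝ) (u ^ 2 / 4 + v ^ 2 / 64) := by
      apply le_min
      · have := min_le_left (4 * (m : ℝ)) (u ^ 2 + v ^ 2)
        rw [← hM] at this
        linarith
      · have := min_le_right (4 * (m : ℝ)) (u ^ 2 + v ^ 2)
        rw [← hM] at this
        nlinarith [sq_nonneg u]
    linarith
  have h2 : Real.exp (-(2 * p * q * Q)) ≤ Real.exp (-(κ * M)) := by
    apply Real.exp_le_exp.mpr
    have : κ * M = 2 * p * q * (M / 16640) := by rw [hκ]; ring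
    rw [this]
    have : 0 < 2 * p * q := by positivity
    nlinarith
  refine h2.trans ?_
  have h3 : Real.exp (-(κ * M)) ≤ 24 * Real.exp κ / κ ^ 4 / (1 + M) ^ 4 := by
    have := Real.pow_div_factorial_le_exp (κ * (1 + M)) (by positivity) 4
    have e : Real.exp (κ * (1 + M)) = Real.exp κ * Real.exp (κ * M) := by
      rw [← Real.exp_add]; ring_nf
    rw [e, mul_pow] at this
    norm_num [Nat.factorial] at this
    rw [Real.exp_neg, div_div, le_div_iff₀ (by positivity), inv_mul_le_iff₀ (Real.exp_pos _)]
    linarith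
  refine h3.trans ?_
  have h4 : (1 + u ^ 2) * (1 + v ^ 2) ≤ 16 * (1 + M) ^ 4 := by
    clear_value M Q s t κ
    clear h1 h2 h3 hQ hMQ es et
    have hp4 := Real.pi_le_four
    rcases min_choice (4 * (m : ℝ)) (u ^ 2 + v ^ 2) with h | h
    · rw [← hM] at h
      clear hM
      have hu2 : u ^ 2 ≤ 4 * M := by
        have : |u| ≤ 2 * r := hu.trans (mul_le_mul_of_nonneg_right (by linarith) hr.le)
        have := pow_le_pow_left₀ (abs_nonneg u) this 2
        rw [sq_abs, mul_pow, hr2] at this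
        linarith
      have hv2 : v ^ 2 ≤ 4 * M ^ 3 := by
        have : |v| ≤ 2 * r ^ 3 := hv.trans (mul_le_mul_of_nonneg_right (by linarith) (pow_pos hr 3).le)
        have := pow_le_pow_left₀ (abs_nonneg v) this 2
        rw [sq_abs, mul_pow, show (r ^ 3) ^ 2 = (r ^ 2) ^ 3 by ring, hr2] at this
        rw [h]
        linarith
      calc (1 + u ^ 2) * (1 + v ^ 2) ≤ (4 * (1 + M)) * (4 * (1 + M) ^ 3) := by
            apply mul_le_mul
            · linarith
            · nlinarith [pow_nonneg hM0 2]
            · positivity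
            · positivity
        _ = _ := by ring
    · rw [← hM] at h
      clear hM
      have a1 : 1 + u ^ 2 ≤ 1 + M := by rw [h]; nlinarith [sq_nonneg v]
      have a2 : 1 + v ^ 2 ≤ 1 + M := by rw [h]; nlinarith [sq_nonneg u]
      calc (1 + u ^ 2) * (1 + v ^ 2) ≤ (1 + M) * (1 + M) := by gcongr
        _ = (1 + M) ^ 2 := by ring
        _ ≤ (1 + M) ^ 4 := pow_le_pow_right₀ (by linarith) (by norm_num)
        _ ≤ _ := by nlinarith [pow_nonneg (show (0 : ℝ) ≤ 1 + M by linarith) 4]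
  rw [← mul_inv, ← div_eq_mul_inv, div_le_div_iff₀ (by positivity) (by positivity)]
  have h9 : 0 ≤ 24 * Real.exp κ / κ ^ 4 := by positivity
  calc _ ≤ 24 * Real.exp κ / κ ^ 4 * (16 * (1 + M) ^ 4) := mul_le_mul_of_nonneg_left h4 h9
    _ = _ := by ring

lemma auxPhi_norm_le_one (p q x : ℝ) (hp : 0 < p) (hq : 0 < q) (hpq : p + q = 1) :
    ‖auxPhi p q x‖ ≤ 1 := by
  refine (auxPhi_norm_le p q x hpq).trans ?_
  rw [Real.exp_le_one_iff]
  have : 0 ≤ 2 * p * q * Real.sin x ^ 2 := by positivity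
  linarith

lemma aux_prod_diff (N : ℕ) (a b : ℕ → ℂ) (ha : ∀ j, ‖a j‖ ≤ 1) (hb : ∀ j, ‖b j‖ ≤ 1) :
    ‖∏ j ∈ Finset.range N, a j - ∏ j ∈ Finset.range N, b j‖ ≤
      ∑ j ∈ Finset.range N, ‖a j - b j‖ := by
  induction N with
  | zero => simp
  | succ N ih =>
    rw [Finset.prod_range_succ, Finset.prod_range_succ, Finset.sum_range_succ]
    set A := ∏ j ∈ Finset.range N, a j
    set B := ∏ j ∈ Finset.range N, b j with hB
    have hB1 : ‖B‖ ≤ 1 := by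
      rw [hB, norm_prod]
      exact Finset.prod_le_one (fun _ _ => norm_nonneg _) (fun j _ => hb j)
    calc ‖A * a N - B * b N‖ = ‖(A - B) * a N + B * (a N - b N)‖ := by congr 1; ring
      _ ≤ ‖(A - B) * a N‖ + ‖B * (a N - b N)‖ := norm_add_le _ _
      _ ≤ ‖A - B‖ + ‖a N - b N‖ := by
        rw [norm_mul, norm_mul]
        gcongr
        · exact mul_le_of_le_one_right (norm_nonneg _) (ha N)
        · exact mul_le_of_le_one_left (norm_nonneg _) hB1
      _ ≤ _ := by gcongr

noncomputable def auxB (p q y : ℝ) : ℂ :=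
  Complex.exp (Complex.I * ((p - q) * y : ℝ) - (2 * p * q * y ^ 2 : ℝ))

lemma auxB_norm_le_one (p q x : ℝ) (hp : 0 < p) (hq : 0 < q) : ‖auxB p q x‖ ≤ 1 := by
  unfold auxB
  rw [Complex.norm_exp, Real.exp_le_one_iff]
  have : 0 ≤ 2 * p * q * x ^ 2 := by positivity
  rw [Complex.sub_re, Complex.ofReal_re, mul_comm Complex.I, Complex.re_ofReal_mul, Complex.I_re]
  linarith

lemma aux_exp3 (w : ℂ) (hw : ‖w‖ ≤ 1) : ‖Complex.exp w - (1 + w + w ^ 2 / 2)‖ ≤ ‖w‖ ^ 3 := by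
  have := Complex.exp_bound hw (n := 3) (by norm_num)
  simp [Finset.sum_range_succ, Nat.factorial] at this
  refine this.trans ?_
  have := pow_nonneg (norm_nonneg w) 3
  nlinarith

lemma aux_phiB (p q y : ℝ) (hp : 0 < p) (hq : 0 < q) (hpq : p + q = 1) (hy : |y| ≤ 1 / 2) :
    ‖auxPhi p q y - auxB p q y‖ ≤ 20 * |y| ^ 3 := by
  set w : ℂ := Complex.I * ((p - q) * y : ℝ) - (2 * p * q * y ^ 2 : ℝ) with hw
  have hpq4 : 4 * p * q ≤ 1 := by nlinarith [sq_nonneg (p - q)]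
  have hr : |p - q| ≤ 1 := by rw [abs_le]; constructor <;> linarith
  have hy2 : |y| ^ 2 ≤ |y| := by nlinarith [abs_nonneg y]
  have hwn : ‖w‖ ≤ 2 * |y| := by
    calc ‖w‖ ≤ ‖Complex.I * ((p - q) * y : ℝ)‖ + ‖((2 * p * q * y ^ 2 : ℝ) : ℂ)‖ := norm_sub_le _ _
      _ = |p - q| * |y| + 2 * p * q * |y| ^ 2 := by
        rw [norm_mul, Complex.norm_I, one_mul, Complex.norm_real, Complex.norm_real,
          Real.norm_eq_abs, Real.norm_eq_abs, abs_mul, abs_of_nonneg (show 0 ≤ 2 * p * q * y ^ 2 by positivity), sq_abs]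
      _ ≤ _ := by
        have : 0 < p * q := by positivity
        nlinarith [abs_nonneg y, abs_nonneg (p - q)]
  have n1 : ‖Complex.I * (y : ℂ)‖ = |y| := by
    rw [norm_mul, Complex.norm_I, one_mul, Complex.norm_real, Real.norm_eq_abs]
  have E1 := aux_exp3 (Complex.I * y) (by rw [n1]; linarith)
  have E2 := aux_exp3 (-(Complex.I * y)) (by rw [norm_neg, n1]; linarith)
  have E3 := aux_exp3 w (by linarith)
  rw [n1] at E1
  rw [norm_neg, n1] at E2
  have E3' : ‖Complex.exp w - (1 + w + w ^ 2 / 2)‖ ≤ 8 * |y| ^ 3 := by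
    refine E3.trans ?_
    calc ‖w‖ ^ 3 ≤ (2 * |y|) ^ 3 := by gcongr
      _ = _ := by ring
  set e1 := Complex.exp (Complex.I * y) - (1 + Complex.I * y + (Complex.I * y) ^ 2 / 2) with he1
  set e2 := Complex.exp (-(Complex.I * y)) - (1 + -(Complex.I * y) + (-(Complex.I * y)) ^ 2 / 2) with he2
  set e3 := Complex.exp w - (1 + w + w ^ 2 / 2) with he3
  have key : auxPhi p q y - auxB p q y = p * e1 + q * e2 - e3 +
      (Complex.I * ((2 * p * q * (p - q) * y ^ 3 : ℝ) : ℂ) - ((2 * p ^ 2 * q ^ 2 * y ^ 4 : ℝ) : ℂ)) := by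
    unfold auxPhi auxB
    rw [← hw, he1, he2, he3]
    have h1 : (q : ℂ) = 1 - p := by
      have : (p : ℂ) + q = 1 := by exact_mod_cast hpq
      linear_combination this
    rw [hw]
    push_cast
    rw [h1]
    have hI := Complex.I_sq
    ring_nf
    simp only [hI]
    ring
  rw [key]
  have hpp : p * q ≤ 1 := by nlinarith
  have hpq0 : 0 < p * q := by positivity
  calc _ ≤ ‖(p : ℂ) * e1‖ + ‖(q : ℂ) * e2‖ + ‖e3‖ +
        (‖Complex.I * ((2 * p * q * (p - q) * y ^ 3 : ℝ) : ℂ)‖ + ‖((2 * p ^ 2 * q ^ 2 * y ^ 4 : ℝ) : ℂ)‖) := by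
        refine (norm_add_le _ _).trans (add_le_add ((norm_sub_le _ _).trans (add_le_add (norm_add_le _ _) le_rfl)) (norm_sub_le _ _))
    _ = p * ‖e1‖ + q * ‖e2‖ + ‖e3‖ + (2 * (p * q) * |p - q| * |y| ^ 3 + 2 * (p * q) ^ 2 * |y| ^ 4) := by
        rw [norm_mul, norm_mul, norm_mul, Complex.norm_I, one_mul, Complex.norm_real, Complex.norm_real,
          Complex.norm_real, Complex.norm_real]
        simp only [Real.norm_eq_abs, abs_mul, abs_pow, abs_of_pos hp, abs_of_pos hq, abs_two]
        ring
    _ ≤ p * |y| ^ 3 + q * |y| ^ 3 + 8 * |y| ^ 3 + (2 * 1 * 1 * |y| ^ 3 + 2 * 1 ^ 2 * |y| ^ 3) := by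
        have : |y| ^ 4 ≤ |y| ^ 3 := pow_le_pow_of_le_one (abs_nonneg y) (by linarith) (by norm_num)
        gcongr
    _ ≤ _ := by
        have := pow_nonneg (abs_nonneg y) 3
        nlinarith

lemma aux_sum_alt (k : ℕ) : ∑ j ∈ Finset.range (2 * k), (-1 : ℤ) ^ j = 0 := by
  induction k with
  | zero => simp
  | succ k ih =>
    rw [show 2 * (k + 1) = 2 * k + 1 + 1 by ring, Finset.sum_range_succ, Finset.sum_range_succ, ih]
    ring

lemma aux_sum_alt_mul (k : ℕ) : ∑ j ∈ Finset.range (2 * k), (-1 : ℤ) ^ j * j = -k := by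
  induction k with
  | zero => simp
  | succ k ih =>
    rw [show 2 * (k + 1) = 2 * k + 1 + 1 by ring, Finset.sum_range_succ, Finset.sum_range_succ, ih,
      pow_succ, pow_mul]
    push_cast
    norm_num
    ring

lemma aux_sum_sq (N : ℕ) (s t : ℝ) : ∑ j ∈ Finset.range N, (s + j * t) ^ 2 =
    N * s ^ 2 + s * t * (N * (N - 1)) + t ^ 2 * (N * (N - 1) * (2 * N - 1) / 6) := by
  induction N with
  | zero => simp
  | succ N ih => rw [Finset.sum_range_succ, ih]; push_cast; ring

lemma aux_prodB (p q : ℝ) (k : ℕ) (s t : ℝ) :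
    ∏ j ∈ Finset.range (2 * k), auxB p q ((-1) ^ j * (s + j * t)) =
      Complex.exp (Complex.I * ((p - q) * (-k * t) : ℝ) -
        (2 * p * q * ∑ j ∈ Finset.range (2 * k), (s + j * t) ^ 2 : ℝ)) := by
  unfold auxB
  rw [← Complex.exp_sum, Finset.sum_sub_distrib, ← Finset.mul_sum]
  congr 3
  · rw [← Complex.ofReal_sum]
    congr 1
    rw [← Finset.mul_sum]
    congr 1
    have h1 : ∑ j ∈ Finset.range (2 * k), (-1 : ℝ) ^ j = 0 := by exact_mod_cast aux_sum_alt k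
    have h2 : ∑ j ∈ Finset.range (2 * k), (-1 : ℝ) ^ j * j = -k := by exact_mod_cast aux_sum_alt_mul k
    calc _ = ∑ j ∈ Finset.range (2 * k), ((-1 : ℝ) ^ j * s + (-1 : ℝ) ^ j * j * t) :=
          Finset.sum_congr rfl fun _ _ => by ring
      _ = _ := by rw [Finset.sum_add_distrib, ← Finset.sum_mul, ← Finset.sum_mul, h1, h2]; ring
  · rw [← Complex.ofReal_sum]
    congr 1
    rw [Finset.mul_sum]
    refine Finset.sum_congr rfl fun j _ => ?_
    rw [mul_pow, ← pow_mul, mul_comm j 2, pow_mul]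
    norm_num

/-- pointwise limit -/
lemma aux_pointwise (p q : ℝ) (hp : 0 < p) (hq : 0 < q) (hpq : p + q = 1) (u v : ℝ) :
    Tendsto (fun n : ℕ => ∏ j ∈ Finset.range (n + 1),
      auxPhi p q ((-1) ^ j * (u / √(n + 1 : ℝ) + j * (v / √(n + 1 : ℝ) ^ 3))))
      (atTop ⊓ Filter.principal {n : ℕ | 4 ∣ n + 1})
      (nhds ((Real.exp (-(2 * p * q) * (u ^ 2 + u * v + v ^ 2 / 3)) : ℝ) : ℂ)) := by
  have hε : Tendsto (fun n : ℕ => 1 / ((n : ℝ) + 1)) atTop (nhds 0) :=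
    tendsto_one_div_add_atTop_nhds_zero_nat
  have hε2 : Tendsto (fun n : ℕ => 1 / √((n : ℝ) + 1)) atTop (nhds 0) := by
    have := (Real.continuous_sqrt.tendsto 0).comp hε
    rw [Real.sqrt_zero] at this
    refine this.congr fun n => ?_
    simp
  set B : ℕ → ℂ := fun n => ∏ j ∈ Finset.range (n + 1),
      auxB p q ((-1) ^ j * (u / √(n + 1 : ℝ) + j * (v / √(n + 1 : ℝ) ^ 3))) with hB
  have hBl : Tendsto B (atTop ⊓ Filter.principal {n : ℕ | 4 ∣ n + 1})
      (nhds ((Real.exp (-(2 * p * q) * (u ^ 2 + u * v + v ^ 2 / 3)) : ℝ) : ℂ)) := by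
    have h1 : Tendsto (fun n : ℕ => Complex.exp (Complex.I * ((p - q) * (-(v / 2) * (1 / √((n : ℝ) + 1))) : ℝ) -
        (2 * p * q * (u ^ 2 + u * v * (1 - 1 / ((n : ℝ) + 1)) +
          v ^ 2 * ((1 - 1 / ((n : ℝ) + 1)) * (2 - 1 / ((n : ℝ) + 1)) / 6)) : ℝ))) atTop
        (nhds (Complex.exp (Complex.I * ((p - q) * (-(v / 2) * 0) : ℝ) -
        (2 * p * q * (u ^ 2 + u * v * (1 - 0) +
          v ^ 2 * ((1 - 0) * (2 - 0) / 6)) : ℝ)))) := by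
      have hc : Continuous (fun z : ℝ × ℝ => Complex.exp (Complex.I * ((p - q) * (-(v / 2) * z.1) : ℝ) -
        (2 * p * q * (u ^ 2 + u * v * (1 - z.2) +
          v ^ 2 * ((1 - z.2) * (2 - z.2) / 6)) : ℝ))) := by fun_prop
      have := (hc.tendsto (0, 0)).comp (hε2.prodMk_nhds hε)
      exact this
    have h2 := h1.mono_left (inf_le_left : atTop ⊓ Filter.principal {n : ℕ | 4 ∣ n + 1} ≤ atTop)
    have e : Complex.exp (Complex.I * ((p - q) * (-(v / 2) * 0) : ℝ) -
        (2 * p * q * (u ^ 2 + u * v * (1 - 0) +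
          v ^ 2 * ((1 - 0) * (2 - 0) / 6)) : ℝ)) =
        ((Real.exp (-(2 * p * q) * (u ^ 2 + u * v + v ^ 2 / 3)) : ℝ) : ℂ) := by
      rw [Complex.ofReal_exp]; congr 1; push_cast; ring
    rw [e] at h2
    refine h2.congr' ?_
    rw [EventuallyEq, eventually_inf_principal]
    refine Eventually.of_forall fun n hn => ?_
    obtain ⟨m, hm⟩ := hn
    have hN : n + 1 = 2 * (2 * m) := by omega
    have hN' : (n : ℝ) + 1 = 4 * m := by exact_mod_cast hm
    have hr0 : 0 < √((n : ℝ) + 1) := Real.sqrt_pos.mpr (by positivity)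
    have hr2 : √((n : ℝ) + 1) ^ 2 = n + 1 := Real.sq_sqrt (by positivity)
    rw [hB]
    simp only
    set r := √((n : ℝ) + 1) with hr
    rw [hN, aux_prodB, aux_sum_sq]
    have hm0 : (m : ℝ) = r ^ 2 / 4 := by rw [hr2, hN']; ring
    congr 4
    · push_cast
      rw [hm0]
      field_simp
      ring
    · have hc : ((2 * (2 * m) : ℕ) : ℝ) = r ^ 2 := by push_cast; rw [hm0]; ring
      rw [← hr2, hc]
      field_simp
  have hd : Tendsto (fun n : ℕ => ∏ j ∈ Finset.range (n + 1),
      auxPhi p q ((-1) ^ j * (u / √(n + 1 : ℝ) + j * (v / √(n + 1 : ℝ) ^ 3))) - B n) atTop (nhds 0) := by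
    have hlim : Tendsto (fun n : ℕ => 20 * (|u| + |v|) ^ 3 * (1 / √((n : ℝ) + 1))) atTop (nhds 0) := by
      simpa using hε2.const_mul (20 * (|u| + |v|) ^ 3)
    refine squeeze_zero_norm' ?_ hlim
    have hsm : ∀ᶠ n : ℕ in atTop, (|u| + |v|) * (1 / √((n : ℝ) + 1)) < 1 / 2 := by
      have := hε2.const_mul (|u| + |v|)
      rw [mul_zero] at this
      exact this.eventually_lt_const (by norm_num)
    filter_upwards [hsm] with n hn
    have hr0 : 0 < √((n : ℝ) + 1) := Real.sqrt_pos.mpr (by positivity)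
    have hr2 : √((n : ℝ) + 1) ^ 2 = n + 1 := Real.sq_sqrt (by positivity)
    refine (aux_prod_diff (n + 1) _ _ (fun j => auxPhi_norm_le_one p q _ hp hq hpq)
      (fun j => auxB_norm_le_one p q _ hp hq)).trans ?_
    set r := √((n : ℝ) + 1) with hr
    have hb : ∀ j ∈ Finset.range (n + 1), ‖auxPhi p q ((-1) ^ j * (u / r + j * (v / r ^ 3))) -
        auxB p q ((-1) ^ j * (u / r + j * (v / r ^ 3)))‖ ≤ 20 * ((|u| + |v|) * (1 / r)) ^ 3 := by
      intro j hj
      have hj' : (j : ℝ) ≤ r ^ 2 := by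
        rw [hr2]
        have := Finset.mem_range.mp hj
        exact_mod_cast this.le
      have hx : |(-1) ^ j * (u / r + j * (v / r ^ 3))| ≤ (|u| + |v|) * (1 / r) := by
        rw [abs_mul, abs_pow, abs_neg, abs_one, one_pow, one_mul]
        calc |u / r + j * (v / r ^ 3)| ≤ |u / r| + |j * (v / r ^ 3)| := abs_add_le _ _
          _ = |u| / r + j * (|v| / r ^ 3) := by
            rw [abs_mul, abs_div, abs_div, abs_of_pos hr0, abs_of_pos (pow_pos hr0 3), Nat.abs_cast]
          _ ≤ |u| / r + r ^ 2 * (|v| / r ^ 3) := by gcongr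
          _ = _ := by field_simp
      refine (aux_phiB p q _ hp hq hpq (hx.trans hn.le)).trans ?_
      gcongr
    refine (Finset.sum_le_sum hb).trans (le_of_eq ?_)
    rw [Finset.sum_const, Finset.card_range, nsmul_eq_mul]
    push_cast
    rw [← hr2]
    field_simp
  have := (hd.mono_left (inf_le_left : atTop ⊓ Filter.principal {n : ℕ | 4 ∣ n + 1} ≤ atTop)).add hBl
  rw [zero_add] at this
  refine this.congr fun n => ?_
  ring

lemma aux_gauss (b : ℝ) (hb : 0 < b) :
    ∫ z : ℝ × ℝ, Real.exp (-b * (z.1 ^ 2 + z.1 * z.2 + z.2 ^ 2 / 3)) = 2 * √3 * Real.pi / b := by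
  have hi : Integrable (fun z : ℝ × ℝ => Real.exp (-b * (z.1 ^ 2 + z.1 * z.2 + z.2 ^ 2 / 3)))
      (volume.prod volume) := by
    have h1 := (integrable_exp_neg_mul_sq (show 0 < b / 16 by positivity)).mul_prod
      (integrable_exp_neg_mul_sq (show 0 < b / 16 by positivity))
    refine h1.mono' (by fun_prop) (Eventually.of_forall fun z => ?_)
    rw [Real.norm_eq_abs, abs_of_pos (Real.exp_pos _), ← Real.exp_add]
    apply Real.exp_le_exp.mpr
    have : (z.1 ^ 2 + z.2 ^ 2) / 16 ≤ z.1 ^ 2 + z.1 * z.2 + z.2 ^ 2 / 3 := by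
      nlinarith [sq_nonneg (15 * z.1 + 8 * z.2), sq_nonneg z.2]
    nlinarith
  rw [Measure.volume_eq_prod, integral_prod_symm _ hi]
  have h2 : ∀ y : ℝ, ∫ x : ℝ, Real.exp (-b * (x ^ 2 + x * y + y ^ 2 / 3)) =
      √(Real.pi / b) * Real.exp (-(b / 12) * y ^ 2) := by
    intro y
    have : ∀ x : ℝ, Real.exp (-b * (x ^ 2 + x * y + y ^ 2 / 3)) =
        Real.exp (-b * (x + y / 2) ^ 2) * Real.exp (-(b / 12) * y ^ 2) := by
      intro x; rw [← Real.exp_add]; congr 1; ring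
    simp_rw [this]
    rw [integral_mul_const, integral_add_right_eq_self (fun x : ℝ => Real.exp (-b * x ^ 2)) (y / 2),
      integral_gaussian]
  simp only [h2]
  rw [integral_const_mul, integral_gaussian, ← Real.sqrt_mul (by positivity),
    show Real.pi / b * (Real.pi / (b / 12)) = (2 * Real.pi / b) ^ 2 * 3 by field_simp; ring,
    Real.sqrt_mul (by positivity), Real.sqrt_sq (by positivity)]
  ring

lemma aux_fourier_s15 (α : ℝ) (hα : 0 < α) (k : ℤ) :
    ∫ u in Set.Icc (-(Real.pi / 2 * α)) (Real.pi / 2 * α),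
      Complex.exp (Complex.I * (2 * k) / α * (u : ℝ)) = if k = 0 then ((Real.pi * α : ℝ) : ℂ) else 0 := by
  have hle : -(Real.pi / 2 * α) ≤ Real.pi / 2 * α := by
    have : 0 < Real.pi / 2 * α := by positivity
    linarith
  rw [integral_Icc_eq_integral_Ioc, ← intervalIntegral.integral_of_le hle]
  split_ifs with hk
  · subst hk
    simp
    ring
  · have hα' : (α : ℂ) ≠ 0 := by exact_mod_cast hα.ne'
    have hk' : (k : ℂ) ≠ 0 := by exact_mod_cast hk
    rw [integral_exp_mul_complex (by
      refine div_ne_zero (mul_ne_zero Complex.I_ne_zero (mul_ne_zero two_ne_zero hk')) hα')]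
    rw [div_eq_zero_iff]
    left
    rw [sub_eq_zero, Complex.exp_eq_exp_iff_exists_int]
    refine ⟨k, ?_⟩
    push_cast
    field_simp
    ring

section
variable (μ : Measure ℤ) [IsProbabilityMeasure μ]

lemma aux_mu_ae (hsupp : μ (({-1, 0, 1} : Set ℤ)ᶜ) = 0) (h0 : μ ({0} : Set ℤ) = 0) :
    ∀ᵐ x ∂μ, x ∈ ({-1, 1} : Set ℤ) := by
  have h1 : ∀ᵐ x ∂μ, x ∈ ({-1, 0, 1} : Set ℤ) := hsupp
  have h2 : ∀ᵐ x ∂μ, x ∉ ({0} : Set ℤ) := measure_eq_zero_iff_ae_notMem.mp h0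
  filter_upwards [h1, h2] with x hx1 hx2
  simp at hx1 hx2 ⊢
  tauto

lemma aux_mu_int {E : Type*} [NormedAddCommGroup E] [NormedSpace ℝ E] [CompleteSpace E]
    (hsupp : μ (({-1, 0, 1} : Set ℤ)ᶜ) = 0) (h0 : μ ({0} : Set ℤ) = 0) (f : ℤ → E) :
    ∫ x, f x ∂μ = (μ {1}).toReal • f 1 + (μ {-1}).toReal • f (-1) := by
  have h := aux_mu_ae μ hsupp h0
  have e : (({-1, 1} : Finset ℤ) : Set ℤ) = {-1, 1} := by simp
  rw [← Measure.restrict_eq_self_of_ae_mem h, ← e, setIntegral_finset _ ?_]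
  · rw [Finset.sum_pair (by norm_num), add_comm, e, Measure.restrict_eq_self_of_ae_mem h]
    rfl
  · exact IntegrableOn.finset

lemma aux_mu_sum (hsupp : μ (({-1, 0, 1} : Set ℤ)ᶜ) = 0) (h0 : μ ({0} : Set ℤ) = 0) :
    (μ {1}).toReal + (μ {-1}).toReal = 1 := by
  have := aux_mu_int μ hsupp h0 (fun _ => (1 : ℝ))
  simp at this
  exact this.symm

lemma aux_coeffVar (hsupp : μ (({-1, 0, 1} : Set ℤ)ᶜ) = 0) (h0 : μ ({0} : Set ℤ) = 0) :
    coeffVar μ = 4 * (μ {1}).toReal * (μ {-1}).toReal := by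
  have h := aux_mu_sum μ hsupp h0
  unfold coeffVar coeffMean
  rw [aux_mu_int μ hsupp h0, aux_mu_int μ hsupp h0]
  have : (μ {-1}).toReal = 1 - (μ {1}).toReal := by linarith
  rw [this]
  simp
  ring

def auxS (n : ℕ) (a : Fin (n + 1) → ℤ) : ℤ := ∑ j, a j * (-1) ^ (j : ℕ)
def auxT (n : ℕ) (a : Fin (n + 1) → ℤ) : ℤ := ∑ j, a j * ((-1) ^ (j : ℕ) * (j : ℕ))

lemma aux_event (n : ℕ) (a : Fin (n + 1) → ℤ) :
    ((polyOf n a).eval (-1) = 0 ∧ (Polynomial.derivative (polyOf n a)).eval (-1) = 0) ↔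
      (auxS n a = 0 ∧ auxT n a = 0) := by
  have h1 : (polyOf n a).eval (-1) = ((auxS n a : ℤ) : ℂ) := by
    unfold polyOf auxS
    simp [Polynomial.eval_finsetSum]
  have h2 : (Polynomial.derivative (polyOf n a)).eval (-1) = -((auxT n a : ℤ) : ℂ) := by
    unfold polyOf auxT
    rw [Polynomial.derivative_sum, Polynomial.eval_finsetSum]
    push_cast
    rw [← Finset.sum_neg_distrib]
    refine Finset.sum_congr rfl fun j _ => ?_
    rw [Polynomial.derivative_C_mul_X_pow]
    simp only [Polynomial.eval_mul, Polynomial.eval_C, Polynomial.eval_pow, Polynomial.eval_X]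
    rcases (j : ℕ) with _ | i
    · simp
    · rw [Nat.add_sub_cancel, pow_succ]; ring
  rw [h1, h2, neg_eq_zero, Int.cast_eq_zero, Int.cast_eq_zero]

lemma aux_parity (n m : ℕ) (hn : n + 1 = 4 * m) (a : Fin (n + 1) → ℤ)
    (ha : ∀ j, a j ∈ ({-1, 1} : Set ℤ)) : (∃ k, auxS n a = 2 * k) ∧ ∃ k, auxT n a = 2 * k := by
  have : ∀ j, ∃ b : ℤ, a j = 1 + 2 * b := by
    intro j
    rcases ha j with h | h
    · exact ⟨-1, by rw [h]; norm_num⟩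
    · exact ⟨0, by simpa using h⟩
  choose b hb using this
  have hN : n + 1 = 2 * (2 * m) := by omega
  constructor
  · refine ⟨∑ j, b j * (-1) ^ (j : ℕ), ?_⟩
    have := aux_sum_alt (2 * m)
    rw [← hN, ← Fin.sum_univ_eq_sum_range] at this
    unfold auxS
    rw [Finset.mul_sum]
    simp_rw [hb, add_mul, one_mul]
    rw [Finset.sum_add_distrib, this, zero_add]
    exact Finset.sum_congr rfl fun _ _ => by ring
  · refine ⟨-m + ∑ j, b j * ((-1) ^ (j : ℕ) * (j : ℕ)), ?_⟩
    have := aux_sum_alt_mul (2 * m)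
    rw [← hN, ← Fin.sum_univ_eq_sum_range (fun j : ℕ => (-1 : ℤ) ^ j * j)] at this
    unfold auxT
    rw [mul_add, Finset.mul_sum]
    simp_rw [hb, add_mul, one_mul]
    rw [Finset.sum_add_distrib, this]
    push_cast
    congr 1
    · ring
    · exact Finset.sum_congr rfl fun _ _ => by ring

lemma aux_inversion (hsupp : μ (({-1, 0, 1} : Set ℤ)ᶜ) = 0) (h0 : μ ({0} : Set ℤ) = 0)
    (n m : ℕ) (hn : n + 1 = 4 * m) (α β : ℝ) (hα : 0 < α) (hβ : 0 < β) :
    ∫ z in Set.Icc (-(Real.pi / 2 * α)) (Real.pi / 2 * α) ×ˢ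
        Set.Icc (-(Real.pi / 2 * β)) (Real.pi / 2 * β),
      ∏ j ∈ Finset.range (n + 1), auxPhi (μ {1}).toReal (μ {-1}).toReal
        ((-1) ^ j * (z.1 / α + j * (z.2 / β))) =
      ((((Measure.pi fun _ : Fin (n + 1) => μ)
          {a | (polyOf n a).eval (-1) = 0 ∧
               (Polynomial.derivative (polyOf n a)).eval (-1) = 0}).toReal *
        ((Real.pi * α) * (Real.pi * β)) : ℝ) : ℂ) := by
  set R := Set.Icc (-(Real.pi / 2 * α)) (Real.pi / 2 * α) ×ˢ
        Set.Icc (-(Real.pi / 2 * β)) (Real.pi / 2 * β) with hR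
  set E : Set (Fin (n + 1) → ℤ) := {a | (polyOf n a).eval (-1) = 0 ∧
               (Polynomial.derivative (polyOf n a)).eval (-1) = 0} with hE
  have h1 : ∀ z : ℝ × ℝ, ∏ j ∈ Finset.range (n + 1), auxPhi (μ {1}).toReal (μ {-1}).toReal
        ((-1) ^ j * (z.1 / α + j * (z.2 / β))) =
      ∫ a, Complex.exp (Complex.I * (auxS n a) / α * (z.1 : ℝ)) *
        Complex.exp (Complex.I * (auxT n a) / β * (z.2 : ℝ)) ∂(Measure.pi fun _ : Fin (n + 1) => μ) := by
    intro z
    rw [← Fin.prod_univ_eq_prod_range (fun j : ℕ => auxPhi (μ {1}).toReal (μ {-1}).toReal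
        ((-1) ^ j * (z.1 / α + j * (z.2 / β))))]
    have : ∀ j : Fin (n + 1), auxPhi (μ {1}).toReal (μ {-1}).toReal
        ((-1) ^ (j : ℕ) * (z.1 / α + (j : ℕ) * (z.2 / β))) =
        ∫ x, Complex.exp (Complex.I * ((x : ℤ) : ℂ) *
          (((-1) ^ (j : ℕ) * (z.1 / α + (j : ℕ) * (z.2 / β)) : ℝ) : ℂ)) ∂μ := by
      intro j
      rw [aux_mu_int μ hsupp h0]
      unfold auxPhi
      rw [Complex.real_smul, Complex.real_smul]
      congr 3 <;> push_cast <;> ring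
    simp_rw [this]
    rw [← integral_fintype_prod_eq_prod (fun (j : Fin (n + 1)) (x : ℤ) => Complex.exp (Complex.I * ((x : ℤ) : ℂ) *
          (((-1) ^ (j : ℕ) * (z.1 / α + (j : ℕ) * (z.2 / β)) : ℝ) : ℂ)))]
    congr 1
    funext a
    rw [← Complex.exp_sum, ← Complex.exp_add]
    congr 1
    unfold auxS auxT
    push_cast
    rw [Finset.mul_sum, Finset.mul_sum, Finset.sum_div, Finset.sum_div, Finset.sum_mul, Finset.sum_mul,
      ← Finset.sum_add_distrib]
    exact Finset.sum_congr rfl fun _ _ => by ring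
  simp_rw [h1]
  rw [← integral_integral_swap]
  · have h2 : ∀ᵐ a ∂(Measure.pi fun _ : Fin (n + 1) => μ),
        ∫ z in R, Complex.exp (Complex.I * (auxS n a) / α * (z.1 : ℝ)) *
        Complex.exp (Complex.I * (auxT n a) / β * (z.2 : ℝ)) =
        E.indicator (fun _ => (((Real.pi * α) * (Real.pi * β) : ℝ) : ℂ)) a := by
      have hae : ∀ᵐ a ∂(Measure.pi fun _ : Fin (n + 1) => μ), ∀ j, a j ∈ ({-1, 1} : Set ℤ) := by
        rw [ae_all_iff]
        intro j
        exact Measure.tendsto_eval_ae_ae.eventually (aux_mu_ae μ hsupp h0)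
      filter_upwards [hae] with a ha
      obtain ⟨⟨k, hk⟩, ⟨l, hl⟩⟩ := aux_parity n m hn a ha
      rw [hR, Measure.volume_eq_prod, setIntegral_prod_mul
        (fun x : ℝ => Complex.exp (Complex.I * (auxS n a) / α * (x : ℝ)))
        (fun x : ℝ => Complex.exp (Complex.I * (auxT n a) / β * (x : ℝ)))]
      have f1 := aux_fourier_s15 α hα k
      have f2 := aux_fourier_s15 β hβ l
      have hmem : a ∈ E ↔ k = 0 ∧ l = 0 := by
        rw [hE, Set.mem_ofPred_eq, aux_event, hk, hl]
        constructor <;> rintro ⟨h, h'⟩ <;> constructor <;> omega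
      rw [hk, hl]
      push_cast
      rw [f1, f2]
      by_cases hk0 : k = 0 <;> by_cases hl0 : l = 0 <;> simp [Set.indicator, hmem, hk0, hl0]
    rw [integral_congr_ae h2, integral_indicator_const _ (Set.to_countable E).measurableSet,
      Complex.real_smul]
    push_cast
    rfl
  · have hfin : IsFiniteMeasure ((volume : Measure (ℝ × ℝ)).restrict R) := by
      constructor
      rw [Measure.restrict_apply_univ]
      exact (isCompact_Icc.prod isCompact_Icc).measure_lt_top
    have hmS : Measurable (fun a : Fin (n + 1) → ℤ => ((auxS n a : ℤ) : ℂ)) := measurable_of_countable _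
    have hmT : Measurable (fun a : Fin (n + 1) → ℤ => ((auxT n a : ℤ) : ℂ)) := measurable_of_countable _
    refine Integrable.of_bound (C := 1) ?_ (Eventually.of_forall ?_)
    · apply Measurable.aestronglyMeasurable
      unfold Function.uncurry
      have hmS' : Measurable (fun x : (Fin (n + 1) → ℤ) × (ℝ × ℝ) => ((auxS n x.1 : ℤ) : ℂ)) :=
        hmS.comp measurable_fst
      have hmT' : Measurable (fun x : (Fin (n + 1) → ℤ) × (ℝ × ℝ) => ((auxT n x.1 : ℤ) : ℂ)) :=
        hmT.comp measurable_fst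
      fun_prop
    · rintro ⟨a, z⟩
      simp only [Function.uncurry]
      rw [norm_mul, show Complex.I * (auxS n a) / α * (z.1 : ℝ) =
        ((auxS n a / α * z.1 : ℝ) : ℂ) * Complex.I by push_cast; ring,
        show Complex.I * (auxT n a) / β * (z.2 : ℝ) =
        ((auxT n a / β * z.2 : ℝ) : ℂ) * Complex.I by push_cast; ring,
        Complex.norm_exp_ofReal_mul_I, Complex.norm_exp_ofReal_mul_I, one_mul]

end

/-- Under condition (C) and `μ({0}) = 0`, along `n` with `4 ∣ n + 1`, the probability that
`-1` is a double root of `P_n` is `4√3/(π·Var(ξ₀)·n²) + o(n⁻²)`. -/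
theorem minus_one_double_root_asymptotics (μ : MeasureTheory.Measure ℤ)
    [IsProbabilityMeasure μ]
    (hsupp : μ (({-1, 0, 1} : Set ℤ)ᶜ) = 0)
    (hC : ∀ x ∈ ({-1, 0, 1} : Set ℤ), (μ {x}).toReal < 1 / Real.sqrt 3)
    (h0 : μ ({0} : Set ℤ) = 0) :
    Tendsto (fun n : ℕ => (n : ℝ) ^ 2 *
        ((Measure.pi fun _ : Fin (n + 1) => μ)
          {a | (polyOf n a).eval (-1) = 0 ∧
               (Polynomial.derivative (polyOf n a)).eval (-1) = 0}).toReal)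
      (atTop ⊓ Filter.principal {n : ℕ | 4 ∣ n + 1})
      (nhds (4 * Real.sqrt 3 / (Real.pi * coeffVar μ))) := by
  have hpq := aux_mu_sum μ hsupp h0
  have hlt : 1 / √(3 : ℝ) < 1 := by
    rw [div_lt_one (by positivity)]
    exact Real.lt_sqrt_of_sq_lt (by norm_num)
  have hp1 := hC 1 (by simp)
  have hq1 := hC (-1) (by simp)
  rw [aux_coeffVar μ hsupp h0]
  have hinv := aux_inversion μ hsupp h0
  set p := (μ {1}).toReal with hpd
  set q := (μ {-1}).toReal with hqd
  have hp : 0 < p := by linarith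
  have hq : 0 < q := by linarith
  clear_value p q
  set P : ℕ → ℝ := fun n => ((Measure.pi fun _ : Fin (n + 1) => μ)
          {a | (polyOf n a).eval (-1) = 0 ∧
               (Polynomial.derivative (polyOf n a)).eval (-1) = 0}).toReal with hP
  set l := (atTop ⊓ Filter.principal {n : ℕ | 4 ∣ n + 1} : Filter ℕ) with hl
  set R : ℕ → Set (ℝ × ℝ) := fun n =>
    Set.Icc (-(Real.pi / 2 * √((n : ℝ) + 1))) (Real.pi / 2 * √((n : ℝ) + 1)) ×ˢ
        Set.Icc (-(Real.pi / 2 * √((n : ℝ) + 1) ^ 3)) (Real.pi / 2 * √((n : ℝ) + 1) ^ 3) with hR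
  set G : ℕ → ℝ × ℝ → ℂ := fun n z => ∏ j ∈ Finset.range (n + 1),
      auxPhi p q ((-1) ^ j * (z.1 / √(n + 1 : ℝ) + j * (z.2 / √(n + 1 : ℝ) ^ 3))) with hG
  have hRm : ∀ n, MeasurableSet (R n) := fun n => measurableSet_Icc.prod measurableSet_Icc
  have hsq : Tendsto (fun n : ℕ => √((n : ℝ) + 1)) atTop atTop :=
    Real.tendsto_sqrt_atTop.comp (tendsto_atTop_add_const_right _ _ tendsto_natCast_atTop_atTop)
  obtain ⟨K, hK⟩ := aux_prod_bound p q hp hq hpq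
  have hev : ∀ᶠ n in l, 4 ∣ n + 1 := by
    rw [hl, eventually_inf_principal]; exact Eventually.of_forall fun n h => h
  have hmain : Tendsto (fun n => ∫ z, (R n).indicator (G n) z) l
      (nhds (∫ z : ℝ × ℝ, ((Real.exp (-(2 * p * q) * (z.1 ^ 2 + z.1 * z.2 + z.2 ^ 2 / 3)) : ℝ) : ℂ))) := by
    refine tendsto_integral_filter_of_dominated_convergence
      (fun z : ℝ × ℝ => max K 0 * ((1 + z.1 ^ 2)⁻¹ * (1 + z.2 ^ 2)⁻¹)) ?_ ?_ ?_ ?_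
    · refine Eventually.of_forall fun n => ?_
      refine AEStronglyMeasurable.indicator ?_ (hRm n)
      apply Continuous.aestronglyMeasurable
      rw [hG]
      unfold auxPhi
      fun_prop
    · filter_upwards [hev] with n hn
      refine Eventually.of_forall fun z => ?_
      obtain ⟨m, hm⟩ := hn
      have hpos : 0 ≤ (1 + z.1 ^ 2)⁻¹ * (1 + z.2 ^ 2)⁻¹ := by positivity
      by_cases hz : z ∈ R n
      · rw [Set.indicator_of_mem hz]
        have hr0 : 0 < √((n : ℝ) + 1) := Real.sqrt_pos.mpr (by positivity)
        have hr2 : √((n : ℝ) + 1) ^ 2 = 4 * m := by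
          rw [Real.sq_sqrt (by positivity)]; exact_mod_cast hm
        have := hK m (by omega) z.1 z.2 _ hr0 hr2 (abs_le.mpr hz.1) (abs_le.mpr hz.2)
        rw [← hm] at this
        exact this.trans (mul_le_mul_of_nonneg_right (le_max_left _ _) hpos)
      · rw [Set.indicator_of_notMem hz, norm_zero]
        positivity
    · exact (integrable_inv_one_add_sq.mul_prod integrable_inv_one_add_sq).const_mul _
    · refine Eventually.of_forall fun z => ?_
      refine (aux_pointwise p q hp hq hpq z.1 z.2).congr' ?_
      have e1 : ∀ᶠ n : ℕ in atTop, |z.1| + |z.2| + 1 ≤ √((n : ℝ) + 1) :=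
        hsq.eventually_ge_atTop _
      have e2 := (inf_le_left : l ≤ atTop) e1
      filter_upwards [e2] with n hn
      have hz : z ∈ R n := by
        have hp3 := Real.pi_gt_three
        have a1 := abs_nonneg z.1
        have a2 := abs_nonneg z.2
        set r := √((n : ℝ) + 1)
        have hr1 : 1 ≤ r := by linarith
        have hr3 : r ≤ r ^ 3 := le_self_pow₀ hr1 (by norm_num)
        refine ⟨abs_le.mp ?_, abs_le.mp ?_⟩
        · nlinarith
        · nlinarith
      rw [Set.indicator_of_mem hz]
  have hval : ∫ z : ℝ × ℝ, ((Real.exp (-(2 * p * q) * (z.1 ^ 2 + z.1 * z.2 + z.2 ^ 2 / 3)) : ℝ) : ℂ) =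
      ((2 * √3 * Real.pi / (2 * p * q) : ℝ) : ℂ) := by
    rw [integral_complex_ofReal, aux_gauss _ (by positivity)]
  rw [hval] at hmain
  have hmain2 : Tendsto (fun n : ℕ => P n * (Real.pi ^ 2 * ((n : ℝ) + 1) ^ 2)) l
      (nhds (2 * √3 * Real.pi / (2 * p * q))) := by
    have h3 := (Complex.continuous_re.tendsto _).comp hmain
    rw [Complex.ofReal_re] at h3
    refine h3.congr' ?_
    filter_upwards [hev] with n hn
    obtain ⟨m, hm⟩ := hn
    have hr0 : 0 < √((n : ℝ) + 1) := Real.sqrt_pos.mpr (by positivity)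
    have hr2 : √((n : ℝ) + 1) ^ 2 = (n : ℝ) + 1 := Real.sq_sqrt (by positivity)
    rw [Function.comp_apply, integral_indicator (hRm n)]
    have := hinv n m hm (√((n : ℝ) + 1)) (√((n : ℝ) + 1) ^ 3) hr0 (pow_pos hr0 3)
    rw [this, Complex.ofReal_re]
    change P n * _ = _
    linear_combination (P n * Real.pi ^ 2 * (√((n : ℝ) + 1) ^ 2 + ((n : ℝ) + 1))) * hr2
  have hfrac : Tendsto (fun n : ℕ => (1 - 1 / ((n : ℝ) + 1)) ^ 2 / Real.pi ^ 2) l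
      (nhds ((1 - 0) ^ 2 / Real.pi ^ 2)) :=
    (((tendsto_one_div_add_atTop_nhds_zero_nat (𝕜 := ℝ)).mono_left
      (inf_le_left : l ≤ atTop)).const_sub 1 |>.pow 2).div_const _
  have hfin := hmain2.mul hfrac
  have e : 2 * √3 * Real.pi / (2 * p * q) * ((1 - 0) ^ 2 / Real.pi ^ 2) =
      4 * √3 / (Real.pi * (4 * p * q)) := by
    have := Real.pi_pos
    field_simp
    ring
  rw [e] at hfin
  refine hfin.congr fun n => ?_
  have h1 : (n : ℝ) + 1 ≠ 0 := by positivity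
  have h2 := Real.pi_pos.ne'
  field_simp
  ring
end
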